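/- For each K ≥ 1, the K-bounded non-termination problem for DCPS is decidable: there is an algorithm that, given a DCPS A, decides whether A has an infinite K-context switch bounded run. -/

import Mathlib

/-!
Formalization of context-bounded liveness for dynamic networks of concurrent
pushdown systems (DCPS) and VASS with balloons (VASSB).
Global states, stack symbols, places, balloon states etc. are drawn from ℕ;
the finite components of the systems are recorded as `Finset`s.
-/

noncomputable section

namespace CBL

/-! ### Dynamic networks of concurrent pushdown systems (DCPS) -/

/-- A local configuration of a thread: its stack content (top of stack is the
head of the list) together with its context-switch number. -/
abbrev Loc : Type := List ℕ × ℕ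

/-- A DCPS `(G, Γ, Δ, g0, γ0)`.  The transition rules `Δ` are split into the
four kinds.  A creation rule `g|γ ↪ g'|w' (▷ γ')` is recorded as
`(g, γ, g', w', none/some γ')`; an interruption rule `g|γ ↦ g'|w'` as
`(g, γ, g', w')`; a resumption rule `g ↦ g' ◁ γ` as `(g, g', γ)`; a
termination rule `g ↦ g'` as `(g, g')`. -/
structure DCPS where
  glob : Finset ℕ
  alph : Finset ℕ
  creation : Finset (ℕ × ℕ × ℕ × List ℕ × Option ℕ)
  interruption : Finset (ℕ × ℕ × ℕ × List ℕ)
  resumption : Finset (ℕ × ℕ × ℕ)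
  termination : Finset (ℕ × ℕ)
  g0 : ℕ
  gamma0 : ℕ
  creation_wf : ∀ r ∈ creation, r.2.2.2.1.length ≤ 2
  interruption_wf : ∀ r ∈ interruption, 1 ≤ r.2.2.2.length ∧ r.2.2.2.length ≤ 2

/-- A configuration `⟨g, t, m⟩` of a DCPS: global state, active slot
(`none` denotes the schedule point `#`), and the multiset of local
configurations of the inactive threads. -/
structure DConfig where
  g : ℕ
  act : Option Loc
  pend : Multiset Loc

/-- The initial configuration `⟨g0, #, {(γ0, 0)}⟩`. -/
def DCPS.init (A : DCPS) : DConfig :=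
  ⟨A.g0, none, {([A.gamma0], 0)}⟩

/-- The multiset of freshly spawned threads of a creation rule. -/
def spawnOf : Option ℕ → Multiset Loc
  | none => 0
  | some gam => {([gam], 0)}

/-- A thread step: a creation rule rewrites the global state and the top of
stack of the active thread, possibly spawning a new thread. -/
def ThreadStep (A : DCPS) (c c' : DConfig) : Prop :=
  ∃ (gam : ℕ) (w : List ℕ) (i : ℕ) (g' : ℕ) (w' : List ℕ) (sp : Option ℕ),
    (c.g, gam, g', w', sp) ∈ A.creation ∧
    c.act = some (gam :: w, i) ∧ c'.g = g' ∧ c'.act = some (w' ++ w, i) ∧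
    c'.pend = c.pend + spawnOf sp

/-- The scheduler step `Swap`. -/
def SwapStep (A : DCPS) (c c' : DConfig) : Prop :=
  ∃ (gam : ℕ) (w : List ℕ) (i : ℕ) (g' : ℕ) (w' : List ℕ),
    (c.g, gam, g', w') ∈ A.interruption ∧
    c.act = some (gam :: w, i) ∧ c'.g = g' ∧ c'.act = none ∧
    c'.pend = c.pend + {(w' ++ w, i + 1)}

/-- The scheduler step `Resume`, resuming (an instance of) the local
configuration `t`. -/
def ResumeStep (A : DCPS) (t : Loc) (c c' : DConfig) : Prop :=
  ∃ (gam : ℕ) (w : List ℕ) (i : ℕ) (g' : ℕ) (p0 : Multiset Loc),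
    (c.g, g', gam) ∈ A.resumption ∧ t = (gam :: w, i) ∧
    c.act = none ∧ c.pend = p0 + {t} ∧
    c'.g = g' ∧ c'.act = some t ∧ c'.pend = p0

/-- The scheduler step `Term`, removing the active thread when its stack is
empty. -/
def TermStep (A : DCPS) (c c' : DConfig) : Prop :=
  ∃ (i : ℕ) (g' : ℕ),
    (c.g, g') ∈ A.termination ∧ c.act = some ([], i) ∧
    c'.g = g' ∧ c'.act = none ∧ c'.pend = c.pend

/-- Any single step of the DCPS. -/
def DStep (A : DCPS) (c c' : DConfig) : Prop :=
  ThreadStep A c c' ∨ SwapStep A c c' ∨ (∃ t, ResumeStep A t c c') ∨ TermStep A c c'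

/-- An infinite run of a DCPS: it starts in the initial configuration, takes a
step at each moment, performs at least one thread step between consecutive
scheduler steps (every scheduled thread executes a nonempty sequence of thread
steps), and alternates thread executions with scheduler steps forever (there
are infinitely many scheduler steps, witnessed by schedule points `#`). -/
def IsInfRunD (A : DCPS) (rho : ℕ → DConfig) : Prop :=
  rho 0 = A.init ∧ (∀ i, DStep A (rho i) (rho (i + 1))) ∧
  (∀ i, (rho i).act = none → (rho (i + 2)).act ≠ none) ∧
  (∀ i, ∃ j ≥ i, (rho j).act = none)

/-- A finite run of length `n` of a DCPS (the first `n` steps of `rho`). -/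
def IsFinRunD (A : DCPS) (rho : ℕ → DConfig) (n : ℕ) : Prop :=
  rho 0 = A.init ∧ (∀ i < n, DStep A (rho i) (rho (i + 1))) ∧
  (∀ i, i + 2 ≤ n → (rho i).act = none → (rho (i + 2)).act ≠ none)

/-- A run is `K`-context switch bounded if in every configuration the
context-switch number of the active thread is at most `K`. -/
def KBoundedD (K : ℕ) (rho : ℕ → DConfig) : Prop :=
  ∀ i w j, (rho i).act = some (w, j) → j ≤ K

/-- `K`-context switch boundedness for the first `n + 1` configurations. -/
def KBoundedUpToD (K n : ℕ) (rho : ℕ → DConfig) : Prop :=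
  ∀ i ≤ n, ∀ w j, (rho i).act = some (w, j) → j ≤ K

/-- The thread `t = (γw, i)` is ready at configuration `c = ⟨g, #, m⟩`. -/
def ReadyAt (A : DCPS) (t : Loc) (c : DConfig) : Prop :=
  c.act = none ∧ t ∈ c.pend ∧
  ∃ (gam : ℕ) (w : List ℕ) (g' : ℕ), t.1 = gam :: w ∧ (c.g, g', gam) ∈ A.resumption

/-- The thread `t` is resumed (made active) at moment `k` of the run `rho`. -/
def ResumedAt (A : DCPS) (rho : ℕ → DConfig) (k : ℕ) (t : Loc) : Prop :=
  ResumeStep A t (rho k) (rho (k + 1))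

/-- Fairness: no thread is ready at infinitely many configurations while being
resumed only finitely often. -/
def FairD (A : DCPS) (rho : ℕ → DConfig) : Prop :=
  ∀ t : Loc, (∀ N, ∃ k ≥ N, ReadyAt A t (rho k)) → (∀ N, ∃ k ≥ N, ResumedAt A rho k t)

/-- Progressiveness for a context-switch bound `K`:  the rule `Term` is only
ever applied to an active thread with exactly `K` context switches (from an
active thread with empty stack only `Term` steps are possible, so this is
expressed by requiring that an active thread with an empty stack has
context-switch number `K`), and every local configuration of an inactive
thread is resumed at some later point of the run. -/
def ProgressiveD (A : DCPS) (K : ℕ) (rho : ℕ → DConfig) : Prop :=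
  (∀ k i, (rho k).act = some ([], i) → i = K) ∧
  (∀ k, ∀ t ∈ (rho k).pend, ∃ j ≥ k, ResumedAt A rho j t)

/-- All threads (active and inactive) of a configuration. -/
def allThreads (c : DConfig) : Multiset Loc :=
  c.pend + (match c.act with | none => 0 | some t => {t})

/-- The thread `t = (w, i)` is starved in the run `rho`: from some moment `j`
on, at least one thread with local configuration `t` is always present, and
whenever `t` is resumed there are at least two of them. -/
def StarvesD (A : DCPS) (rho : ℕ → DConfig) (t : Loc) : Prop :=
  ∃ j, (∀ k ≥ j, 1 ≤ (allThreads (rho k)).count t) ∧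
       (∀ k ≥ j, ResumedAt A rho k t → 2 ≤ (allThreads (rho k)).count t)

/-- Step `k` of the run is a thread step spawning a new thread. -/
def SpawnAt (rho : ℕ → DConfig) (k : ℕ) : Prop :=
  (rho k).act ≠ none ∧ (rho (k + 1)).act ≠ none ∧
  ∃ gam : ℕ, (rho (k + 1)).pend = (rho k).pend + {([gam], 0)}

/-- A run is shallow if there is a bound `B ∈ ℕ` on the number of threads
spawned by each thread along the run, i.e. on the number of spawns performed
during any contiguous interval of the run in which a single thread stays
active. -/
def ShallowD (rho : ℕ → DConfig) : Prop :=
  ∃ B, ∀ a b : ℕ, (∀ k, a ≤ k → k ≤ b → (rho k).act ≠ none) →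
    Set.ncard {k | a ≤ k ∧ k < b ∧ SpawnAt rho k} ≤ B

/-- The number of pending threads of a configuration: the size of the multiset
of inactive threads, plus one if there is an active thread. -/
def pendCount (c : DConfig) : ℕ :=
  Multiset.card c.pend + (match c.act with | none => 0 | some _ => 1)

/-! ### Effective encodings of DCPS and their configurations -/

/-- An effective encoding of DCPS by natural numbers. -/
def encodeDCPS (A : DCPS) : ℕ :=
  Encodable.encode (A.glob.val, A.alph.val, A.creation.val, A.interruption.val,
    A.resumption.val, A.termination.val, A.g0, A.gamma0)

/-- An effective encoding of DCPS configurations by natural numbers. -/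
def encodeDConfig (c : DConfig) : ℕ :=
  Encodable.encode (c.g, c.act, c.pend)

attribute [fun_prop] Primrec
section
variable {α β γ σ : Type} [Primcodable α] [Primcodable β] [Primcodable γ] [Primcodable σ]

@[fun_prop] theorem primrec_id' : Primrec fun a : α => a := Primrec.id
@[fun_prop] theorem primrec_const' (b : β) : Primrec fun _ : α => b := Primrec.const b
@[fun_prop] theorem primrec_comp' {f : β → γ} {g : α → β} (hf : Primrec f) (hg : Primrec g) :
    Primrec fun a => f (g a) := hf.comp hg
@[fun_prop] theorem primrec_fst' {f : α → β × γ} (hf : Primrec f) : Primrec fun a => (f a).1 :=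
  Primrec.fst.comp hf
@[fun_prop] theorem primrec_snd' {f : α → β × γ} (hf : Primrec f) : Primrec fun a => (f a).2 :=
  Primrec.snd.comp hf
@[fun_prop] theorem primrec_pair' {f : α → β} {g : α → γ} (hf : Primrec f) (hg : Primrec g) :
    Primrec fun a => (f a, g a) := hf.pair hg
@[fun_prop] theorem primrec_cons' {f : α → β} {g : α → List β} (hf : Primrec f) (hg : Primrec g) :
    Primrec fun a => f a :: g a := Primrec.list_cons.comp hf hg
@[fun_prop] theorem primrec_append' {f g : α → List β} (hf : Primrec f) (hg : Primrec g) :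
    Primrec fun a => f a ++ g a := Primrec.list_append.comp hf hg
@[fun_prop] theorem primrec_some' {f : α → β} (hf : Primrec f) :
    Primrec fun a => some (f a) := Primrec.option_some.comp hf
@[fun_prop] theorem primrec_add' {f g : α → ℕ} (hf : Primrec f) (hg : Primrec g) :
    Primrec fun a => f a + g a := Primrec.nat_add.comp hf hg

@[fun_prop] theorem primrec_range' {f : α → ℕ} (hf : Primrec f) :
    Primrec fun a => List.range (f a) := Primrec.list_range.comp hf

/-- Semidecidable predicates, presented as projections of primitive recursive ones. -/
def Sig (p : α → Prop) : Prop :=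
  ∃ q : α × ℕ → Bool, Primrec q ∧ ∀ a, p a ↔ ∃ n, q (a, n) = true

namespace Sig

theorem of_primrecPred {p : α → Prop} (h : PrimrecPred p) : Sig p := by
  obtain ⟨_, h⟩ := h
  exact ⟨fun x => decide (p x.1), h.comp Primrec.fst, fun a => by simp⟩

theorem congr {p q : α → Prop} (hp : Sig p) (h : ∀ a, q a ↔ p a) : Sig q := by
  obtain ⟨r, hr, hp⟩ := hp
  exact ⟨r, hr, fun a => (h a).trans (hp a)⟩

theorem comp {p : β → Prop} {f : α → β} (hp : Sig p) (hf : Primrec f) : Sig fun a => p (f a) := by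
  obtain ⟨r, hr, hp⟩ := hp
  exact ⟨fun x => r (f x.1, x.2), by fun_prop, fun a => hp _⟩

theorem ex {p : α → β → Prop} (hp : Sig fun x : α × β => p x.1 x.2) :
    Sig fun a => ∃ b, p a b := by
  obtain ⟨r, hr, hp⟩ := hp
  refine ⟨fun x => Option.casesOn (motive := fun _ => Bool)
    (Encodable.decode (α := β × ℕ) x.2) false fun y => r ((x.1, y.1), y.2), ?_, fun a => ?_⟩
  · exact Primrec.option_casesOn (Primrec.decode.comp Primrec.snd) (Primrec.const _)
      (by unfold Primrec₂; fun_prop)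
  · constructor
    · rintro ⟨b, hb⟩
      obtain ⟨n, hn⟩ := (hp (a, b)).1 hb
      exact ⟨Encodable.encode (b, n), by simpa only [Encodable.encodek] using hn⟩
    · rintro ⟨n, hn⟩
      simp only at hn
      generalize Encodable.decode (α := β × ℕ) n = o at hn
      cases o with
      | none => exact absurd hn (by simp)
      | some y => exact ⟨y.1, (hp (a, y.1)).2 ⟨_, hn⟩⟩

theorem and {p q : α → Prop} (hp : Sig p) (hq : Sig q) : Sig fun a => p a ∧ q a := by
  obtain ⟨r, hr, hp⟩ := hp
  obtain ⟨s, hs, hq⟩ := hq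
  have : Sig fun a => ∃ n m, r (a, n) = true ∧ s (a, m) = true := by
    refine ex (ex (of_primrecPred (PrimrecPred.and ?_ ?_)))
    · exact Primrec.eq.comp (f := fun x : (α × ℕ) × ℕ => r (x.1.1, x.1.2)) (by fun_prop)
        (Primrec.const true)
    · exact Primrec.eq.comp (f := fun x : (α × ℕ) × ℕ => s (x.1.1, x.2)) (by fun_prop)
        (Primrec.const true)
  exact this.congr fun a => by rw [hp, hq]; simp

theorem or {p q : α → Prop} (hp : Sig p) (hq : Sig q) : Sig fun a => p a ∨ q a := by
  obtain ⟨r, hr, hp⟩ := hp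
  obtain ⟨s, hs, hq⟩ := hq
  refine ⟨fun x => r x || s x, Primrec.or.comp hr hs, fun a => ?_⟩
  simp only [hp, hq, Bool.or_eq_true, exists_or]

theorem eq {f g : α → β} (hf : Primrec f) (hg : Primrec g) : Sig fun a => f a = g a := by
  classical
  exact of_primrecPred (Primrec.eq.comp hf hg)

theorem ne {f g : α → β} (hf : Primrec f) (hg : Primrec g) : Sig fun a => f a ≠ g a := by
  classical
  exact of_primrecPred (Primrec.eq.comp hf hg).not

theorem le {f g : α → ℕ} (hf : Primrec f) (hg : Primrec g) : Sig fun a => f a ≤ g a :=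
  of_primrecPred (Primrec.nat_le.comp hf hg)

theorem lt {f g : α → ℕ} (hf : Primrec f) (hg : Primrec g) : Sig fun a => f a < g a :=
  of_primrecPred (Primrec.nat_lt.comp hf hg)

theorem mem {f : α → β} {l : α → List β} (hf : Primrec f) (hl : Primrec l) :
    Sig fun a => f a ∈ l a :=
  (ex (p := fun a i => (l a)[i]? = some (f a)) (eq
    (Primrec.list_getElem?.comp (hl.comp Primrec.fst) Primrec.snd)
    (Primrec.option_some.comp (hf.comp Primrec.fst)))).congr fun a => by
    rw [List.mem_iff_getElem?]

theorem notMem {f : α → β} {l : α → List β} (hf : Primrec f) (hl : Primrec l) :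
    Sig fun a => f a ∉ l a := by
  classical
  have : PrimrecPred fun a => ∀ b ∈ l a, ¬ b = f a :=
    PrimrecRel.comp (PrimrecRel.forall_mem_list (R := fun (b c : β) => ¬ b = c)
      (PrimrecPred.not (Primrec.eq (α := β)))) hl hf
  exact (of_primrecPred this).congr fun a =>
    ⟨fun h b hb e => h (e ▸ hb), fun h hb => h _ hb rfl⟩

theorem all_mem {l : α → List β} {p : α → β → Prop} (hl : Primrec l)
    (hp : Sig fun x : α × β => p x.1 x.2) : Sig fun a => ∀ b ∈ l a, p a b := by
  obtain ⟨r, hr, hp⟩ := hp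
  have h1 : PrimrecRel fun (n : ℕ) (x : α × β) => r (x, n) = true :=
    Primrec.eq.comp (f := fun x : ℕ × (α × β) => r (x.2, x.1)) (by fun_prop) (Primrec.const true)
  have h2 : PrimrecRel fun (b : β) (x : α × ℕ) => ∃ n < x.2, r ((x.1, b), n) = true :=
    (PrimrecPred.of_eq (PrimrecRel.comp h1.exists_mem_list
      (f := fun x : β × (α × ℕ) => List.range x.2.2)
      (g := fun x : β × (α × ℕ) => (x.2.1, x.1)) (by fun_prop) (by fun_prop)) fun x => by simp)
  have h3 : Sig fun a => ∃ N, ∀ b ∈ l a, ∃ n < N, r ((a, b), n) = true :=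
    ex (of_primrecPred (PrimrecRel.comp h2.forall_mem_list (f := fun x : α × ℕ => l x.1)
      (by fun_prop) Primrec.id))
  refine h3.congr fun a => ⟨fun h => ?_, fun ⟨N, h⟩ b hb => ?_⟩
  · have : ∀ L : List β, (∀ b ∈ L, p a b) → ∃ N, ∀ b ∈ L, ∃ n < N, r ((a, b), n) = true := by
      intro L
      induction L with
      | nil => exact fun _ => ⟨0, by simp⟩
      | cons b L ih =>
        intro h
        obtain ⟨N, hN⟩ := ih fun c hc => h c (List.mem_cons_of_mem _ hc)
        obtain ⟨n, hn⟩ := (hp (a, b)).1 (h b List.mem_cons_self)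
        refine ⟨max N (n + 1), fun c hc => ?_⟩
        rcases List.mem_cons.1 hc with rfl | hc
        · exact ⟨n, by omega, hn⟩
        · obtain ⟨m, hm, hc⟩ := hN c hc
          exact ⟨m, by omega, hc⟩
    exact this _ h
  · obtain ⟨n, -, hn⟩ := h b hb
    exact (hp (a, b)).2 ⟨n, hn⟩

theorem reflTransGen {r : α → β → β → Prop} {f g : α → β}
    (hr : Sig fun x : (α × β) × β => r x.1.1 x.1.2 x.2) (hf : Primrec f) (hg : Primrec g) :
    Sig fun a => Relation.ReflTransGen (r a) (f a) (g a) := by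
  have : Sig fun a => ∃ (n : ℕ) (l : List β), l[0]? = some (f a) ∧ l[n]? = some (g a) ∧
      ∀ i ∈ List.range n, ∃ u v, l[i]? = some u ∧ l[i + 1]? = some v ∧ r a u v := by
    refine ex (ex (and ?_ (and ?_ (all_mem ?_ (ex (ex (and ?_ (and ?_ ?_))))))))
    · exact eq (Primrec.list_getElem?.comp (by fun_prop) (by fun_prop)) (by fun_prop)
    · exact eq (Primrec.list_getElem?.comp (by fun_prop) (by fun_prop)) (by fun_prop)
    · fun_prop
    · exact eq (Primrec.list_getElem?.comp (by fun_prop) (by fun_prop)) (by fun_prop)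
    · exact eq (Primrec.list_getElem?.comp (by fun_prop) (by fun_prop)) (by fun_prop)
    · exact hr.comp (f := fun x : ((((α × ℕ) × List β) × ℕ) × β) × β =>
        ((x.1.1.1.1.1, x.1.2), x.2)) (by fun_prop)
  refine this.congr fun a => ⟨fun h => ?_, ?_⟩
  · generalize g a = c at h
    induction h with
    | refl => exact ⟨0, [f a], by simp⟩
    | tail _ hbc ih =>
      rename_i b c _
      obtain ⟨n, l, h0, hn, hl⟩ := ih
      have hlen : n < l.length := (List.getElem?_eq_some_iff.1 hn).1
      have hlt : (l.take (n + 1)).length = n + 1 := by rw [List.length_take]; omega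
      refine ⟨n + 1, l.take (n + 1) ++ [c], ?_, ?_, fun i hi => ?_⟩
      · rw [List.getElem?_append_left (by omega), List.getElem?_take_of_lt (by omega), h0]
      · rw [List.getElem?_append_right (by omega), hlt]; simp
      · have hi' := List.mem_range.1 hi
        by_cases hin : i = n
        · subst hin
          refine ⟨b, c, ?_, ?_, hbc⟩
          · rw [List.getElem?_append_left (by omega), List.getElem?_take_of_lt (by omega), hn]
          · rw [List.getElem?_append_right (by omega), hlt]; simp
        · obtain ⟨u, v, hu, hv, huv⟩ := hl i (List.mem_range.2 (by omega))
          refine ⟨u, v, ?_, ?_, huv⟩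
          · rw [List.getElem?_append_left (by omega), List.getElem?_take_of_lt (by omega), hu]
          · rw [List.getElem?_append_left (by omega), List.getElem?_take_of_lt (by omega), hv]
  · rintro ⟨n, l, h0, hn, hl⟩
    have : ∀ m ≤ n, ∀ c, l[m]? = some c → Relation.ReflTransGen (r a) (f a) c := by
      intro m
      induction m with
      | zero =>
        intro _ c hc
        rw [h0, Option.some_inj] at hc
        rw [hc]
      | succ m ih =>
        intro hm c hc
        obtain ⟨u, v, hu, hv, huv⟩ := hl m (List.mem_range.2 (by omega))
        rw [hc, Option.some_inj] at hv
        exact (ih (by omega) u hu).tail (hv ▸ huv)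
    exact this n le_rfl _ hn

theorem transGen {r : α → β → β → Prop} {f g : α → β}
    (hr : Sig fun x : (α × β) × β => r x.1.1 x.1.2 x.2) (hf : Primrec f) (hg : Primrec g) :
    Sig fun a => Relation.TransGen (r a) (f a) (g a) := by
  have : Sig fun a => ∃ b, r a (f a) b ∧ Relation.ReflTransGen (r a) b (g a) := by
    refine ex (and ?_ ?_)
    · exact hr.comp (f := fun x : α × β => ((x.1, f x.1), x.2)) (by fun_prop)
    · refine reflTransGen (r := fun x : α × β => r x.1) ?_ (by fun_prop) (by fun_prop)
      exact hr.comp (f := fun x : ((α × β) × β) × β => ((x.1.1.1, x.1.2), x.2)) (by fun_prop)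
  exact this.congr fun a => Relation.TransGen.head'_iff

theorem exists_computable {P N : α → Prop} (hP : Sig P) (hN : Sig N) (h : ∀ a, P a ∨ N a) :
    ∃ f : α → Bool, Computable f ∧ ∀ a, (f a = true → P a) ∧ (f a = false → N a) := by
  obtain ⟨p, hp, hP⟩ := hP
  obtain ⟨q, hq, hN⟩ := hN
  have hex : ∀ a, ∃ n, (p (a, n) || q (a, n)) = true := fun a => by
    rcases h a with h | h
    · obtain ⟨n, hn⟩ := (hP a).1 h; exact ⟨n, by simp [hn]⟩
    · obtain ⟨n, hn⟩ := (hN a).1 h; exact ⟨n, by simp [hn]⟩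
  have hfind : Computable fun a => Nat.find (hex a) := by
    have h1 : Computable₂ fun (a : α) (n : ℕ) => (p (a, n) || q (a, n)) :=
      (Primrec.or.comp hp hq).to_comp
    have h2 : Partrec fun a => Nat.rfind fun n => Part.some (p (a, n) || q (a, n)) :=
      Partrec.rfind h1.partrec₂
    refine h2.of_eq fun a => ?_
    refine Part.eq_some_iff.2 (Nat.mem_rfind.2 ?_)
    refine ⟨by simpa using (Nat.find_spec (hex a)).symm, fun {m} hm => ?_⟩
    simpa using Nat.find_min (hex a) hm
  refine ⟨fun a => p (a, Nat.find (hex a)), hp.to_comp.comp (Computable.id.pair hfind), fun a =>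
    ⟨fun ha => (hP a).2 ⟨_, ha⟩, fun ha => (hN a).2 ⟨Nat.find (hex a), ?_⟩⟩⟩
  have := Nat.find_spec (hex a)
  simp only at ha
  rwa [ha, Bool.false_or] at this

end Sig
end

section Farkas

theorem farkas_dual {V ι : Type*} [AddCommGroup V] [Module ℚ V] [DecidableEq ι] (S : Finset ι) :
    ∀ (a : ι → Module.Dual ℚ V) (b : Module.Dual ℚ V),
      (∀ x, (∀ i ∈ S, 0 ≤ a i x) → 0 ≤ b x) →
      ∃ l : ι → ℚ, (∀ i ∈ S, 0 ≤ l i) ∧ b = ∑ i ∈ S, l i • a i := by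
  induction S using Finset.induction_on with
  | empty =>
    intro a b h
    refine ⟨0, by simp, ?_⟩
    ext x
    have h1 := h x (by simp)
    have h2 := h (-x) (by simp)
    rw [map_neg] at h2
    simp only [Finset.sum_empty, LinearMap.zero_apply]
    linarith
  | insert m S hm ih =>
    intro a b h
    by_cases hb : ∀ x, (∀ i ∈ S, 0 ≤ a i x) → 0 ≤ b x
    · obtain ⟨l, hl, hbl⟩ := ih a b hb
      refine ⟨fun i => if i = m then 0 else l i, fun i _ => ?_, ?_⟩
      · by_cases him : i = m
        · simp [him]
        · simp only [him, if_false]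
          exact hl i ((Finset.mem_insert.1 ‹_›).resolve_left him)
      · rw [Finset.sum_insert hm, hbl]
        simp only [if_true, zero_smul, zero_add]
        refine Finset.sum_congr rfl fun i hi => ?_
        have : i ≠ m := fun e => hm (e ▸ hi)
        simp [this]
    · push Not at hb
      obtain ⟨x1, hx1, hbx1⟩ := hb
      have ham : a m x1 < 0 := by
        by_contra! hc
        have := h x1 fun i hi => (Finset.mem_insert.1 hi).elim (fun e => e ▸ hc) (hx1 i)
        linarith
      set c : ℚ := (-(a m x1))⁻¹ with hc
      have hc0 : 0 < c := inv_pos.2 (by linarith)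
      set x0 := c • x1 with hx0
      have hm0 : a m x0 = -1 := by
        rw [hx0, map_smul, smul_eq_mul, hc, inv_neg, neg_mul, inv_mul_cancel₀ ham.ne]
      have hS0 : ∀ i ∈ S, 0 ≤ a i x0 := fun i hi => by
        rw [hx0, map_smul, smul_eq_mul]; exact mul_nonneg hc0.le (hx1 i hi)
      have hb0 : b x0 < 0 := by
        rw [hx0, map_smul, smul_eq_mul]; exact mul_neg_of_pos_of_neg hc0 hbx1
      obtain ⟨l, hl, hbl⟩ := ih (fun i => a i + a i x0 • a m) (b + b x0 • a m) (by
        intro x hx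
        have key : ∀ f : Module.Dual ℚ V, (f + f x0 • a m) x = f (x + a m x • x0) := by
          intro f; simp; ring
        rw [key]
        refine h _ fun i hi => ?_
        rcases Finset.mem_insert.1 hi with rfl | hi
        · simp [hm0]
        · rw [← key]; exact hx i hi)
      refine ⟨fun i => if i = m then (∑ i ∈ S, l i * a i x0) - b x0 else l i, fun i hi => ?_, ?_⟩
      · by_cases him : i = m
        · simp only [him, if_true]
          have := Finset.sum_nonneg fun i hi => mul_nonneg (hl i hi) (hS0 i hi)
          linarith
        · simp only [him, if_false]
          exact hl i ((Finset.mem_insert.1 hi).resolve_left him)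
      · rw [Finset.sum_insert hm]
        have h2 : ∑ i ∈ S, (if i = m then (∑ i ∈ S, l i * a i x0) - b x0 else l i) • a i
            = ∑ i ∈ S, l i • a i := Finset.sum_congr rfl fun i hi => by
          have : i ≠ m := fun e => hm (e ▸ hi)
          simp [this]
        rw [h2]
        simp only [if_true]
        have h3 := eq_sub_of_add_eq hbl
        generalize b x0 = d at h3 ⊢
        rw [h3]
        simp only [smul_add, Finset.sum_add_distrib, smul_smul, sub_smul, Finset.sum_smul]
        abel

theorem exists_nat_scaling {ι : Type*} [Fintype ι] (q : ι → ℚ) (hq : ∀ i, 0 ≤ q i) :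
    ∃ (N : ℕ) (n : ι → ℕ), 0 < N ∧ ∀ i, (n i : ℚ) = N * q i := by
  classical
  refine ⟨∏ i, (q i).den, fun i => (q i).num.toNat * ∏ j ∈ Finset.univ.erase i, (q j).den,
    Finset.prod_pos fun i _ => (q i).den_pos, fun i => ?_⟩
  rw [← Finset.mul_prod_erase Finset.univ (fun j => (q j).den) (Finset.mem_univ i)]
  have h1 : (((q i).num.toNat : ℕ) : ℚ) = (q i).num := by
    have : (((q i).num.toNat : ℕ) : ℤ) = (q i).num := Int.toNat_of_nonneg (Rat.num_nonneg.2 (hq i))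
    exact_mod_cast congrArg (fun z : ℤ => (z : ℚ)) this
  have h2 : ((q i).num : ℚ) = (q i).den * q i := by rw [mul_comm]; exact (Rat.mul_den_eq_num _).symm
  push_cast
  rw [h1, h2]; ring

/-- Either there is a strictly positive integral solution of `A x ≥ 0`, or there is a nonnegative
row combination that is nonpositive everywhere and negative somewhere. -/
theorem exists_pos_solution_or_certificate {E R : Type*} [Fintype E] [Fintype R]
    (A : R → E → ℤ) :
    (∃ x : E → ℕ, (∀ e, 0 < x e) ∧ ∀ r, 0 ≤ ∑ e, A r e * x e) ∨
    ∃ y : R → ℕ, (∀ e, ∑ r, y r * A r e ≤ 0) ∧ ∃ e, ∑ r, y r * A r e < 0 := by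
  classical
  let gen : E ⊕ R → Module.Dual ℚ (E → ℚ) :=
    Sum.elim (fun e => LinearMap.proj e) fun r => ∑ e, (A r e : ℚ) • LinearMap.proj e
  by_cases hex : ∀ e0, ∃ x : E → ℚ, (∀ i, 0 ≤ gen i x) ∧ 0 < x e0
  · left
    choose x hx hx0 using hex
    let z : E → ℚ := ∑ e0, x e0
    have hz : ∀ i, 0 ≤ gen i z := fun i => by
      simp only [z, map_sum]; exact Finset.sum_nonneg fun e _ => hx e i
    have hxe : ∀ e0 e, 0 ≤ x e0 e := fun e0 e => by simpa [gen] using hx e0 (Sum.inl e)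
    have hzp : ∀ e, 0 < z e := fun e => by
      simp only [z, Finset.sum_apply]
      exact Finset.sum_pos' (fun e0 _ => hxe e0 e) ⟨e, Finset.mem_univ _, hx0 e⟩
    obtain ⟨N, n, hN, hn⟩ := exists_nat_scaling z fun e => (hzp e).le
    have hN' : (0 : ℚ) < N := by exact_mod_cast hN
    refine ⟨n, fun e => ?_, fun r => ?_⟩
    · have : (0 : ℚ) < n e := by rw [hn]; exact mul_pos hN' (hzp e)
      exact_mod_cast this
    · have h1 : (0 : ℚ) ≤ ∑ e, (A r e : ℚ) * z e := by
        have := hz (Sum.inr r)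
        simpa [gen] using this
      have h2 : (0 : ℚ) ≤ ∑ e, (A r e : ℚ) * n e := by
        have : ∑ e, (A r e : ℚ) * n e = N * ∑ e, (A r e : ℚ) * z e := by
          rw [Finset.mul_sum]
          exact Finset.sum_congr rfl fun e _ => by rw [hn]; ring
        rw [this]; exact mul_nonneg hN'.le h1
      exact_mod_cast h2
  · right
    push Not at hex
    obtain ⟨e0, he0⟩ := hex
    obtain ⟨l, hl, hb⟩ := farkas_dual Finset.univ gen (-LinearMap.proj e0) (by
      intro x hx
      have := he0 x fun i => hx i (Finset.mem_univ _)
      simpa using this)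
    obtain ⟨N, n, hN, hn⟩ := exists_nat_scaling (fun r => l (Sum.inr r)) fun r =>
      hl _ (Finset.mem_univ _)
    have hN' : (0 : ℚ) < N := by exact_mod_cast hN
    have hcoef : ∀ e, ∑ r, (n r : ℚ) * A r e = N * (-(l (Sum.inl e)) - if e = e0 then 1 else 0) := by
      intro e
      have h1 := congrArg (fun f : Module.Dual ℚ (E → ℚ) => f (Pi.single e 1)) hb
      simp only [Fintype.sum_sum_type, gen, Sum.elim_inl, Sum.elim_inr, LinearMap.add_apply,
        LinearMap.sum_apply, LinearMap.smul_apply, LinearMap.neg_apply, LinearMap.proj_apply,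
        smul_eq_mul, Pi.single_apply, mul_ite, mul_one, mul_zero, Finset.sum_ite_eq',
        Finset.mem_univ, if_true] at h1
      have h2 : ∑ r, (n r : ℚ) * A r e = N * ∑ r, l (Sum.inr r) * A r e := by
        rw [Finset.mul_sum]
        exact Finset.sum_congr rfl fun r _ => by rw [hn]; ring
      rw [h2]
      congr 1
      by_cases h : e = e0
      · subst h; simp only [if_true] at h1 ⊢; linarith
      · have h' : ¬ e0 = e := fun x => h x.symm
        simp only [h, h', if_false] at h1 ⊢; linarith
    have hle : ∀ e, -(l (Sum.inl e)) ≤ 0 := fun e => by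
      have := hl (Sum.inl e) (Finset.mem_univ _); linarith
    refine ⟨n, fun e => ?_, e0, ?_⟩
    · have : (∑ r, (n r : ℚ) * A r e) ≤ 0 := by
        rw [hcoef]
        refine mul_nonpos_of_nonneg_of_nonpos hN'.le ?_
        have := hle e
        split_ifs <;> linarith
      exact_mod_cast this
    · have : (∑ r, (n r : ℚ) * A r e0) < 0 := by
        rw [hcoef]
        refine mul_neg_of_pos_of_neg hN' ?_
        have := hle e0
        simp only [if_true]; linarith
      exact_mod_cast this

end Farkas

section Ideals
variable {P : Type} [DecidableEq P]

/-- `InI d m`: the multiset `m` lies in the ideal given by the finite part `d.1` and the list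
`d.2` of unbounded elements. -/
def InI (d : List P × List P) (m : Multiset P) : Prop :=
  ∀ x, x ∈ d.2 ∨ m.count x ≤ d.1.count x

/-- A cofinal chain of elements of the ideal `d`. -/
def inst (d : List P × List P) (n : ℕ) : Multiset P := (d.1 : Multiset P) + n • (d.2 : Multiset P)

theorem InI.mono {d : List P × List P} {m m' : Multiset P} (h : InI d m') (hm : m ≤ m') :
    InI d m := fun x => (h x).imp_right fun hx => (Multiset.count_le_of_le x hm).trans hx

theorem inI_inst (d : List P × List P) (n : ℕ) : InI d (inst d n) := fun x => by
  by_cases hx : x ∈ d.2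
  · exact Or.inl hx
  · right
    simp [inst, List.count_eq_zero_of_not_mem hx]

theorem inst_mono (d : List P × List P) : Monotone (inst d) := fun n n' h => by
  rw [Multiset.le_iff_count]
  intro x
  simp only [inst, Multiset.count_add, Multiset.coe_count, Multiset.count_nsmul]
  gcongr

theorem exists_le_of_finite_support (F : Finset P) (f : ℕ → Multiset P)
    (hf : ∀ n, ∀ x ∈ f n, x ∈ F) : ∃ i j, i < j ∧ f i ≤ f j := by
  have hw : WellQuasiOrderedLE (F → ℕ) := inferInstance
  obtain ⟨i, j, hij, h⟩ := hw.wqo fun n x => (f n).count x.1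
  refine ⟨i, j, hij, Multiset.le_iff_count.2 fun x => ?_⟩
  by_cases hx : x ∈ f i
  · exact h ⟨x, hf i x hx⟩
  · rw [Multiset.count_eq_zero_of_notMem hx]; exact Nat.zero_le _

/-- Downward closed sets of multisets with elements in `F`. -/
def DownIn (F : Finset P) (U : Set (Multiset P)) : Prop :=
  (∀ m ∈ U, ∀ x ∈ m, x ∈ F) ∧ ∀ m ∈ U, ∀ m' ≤ m, m' ∈ U

theorem downIn_wellFounded (F : Finset P) :
    WellFounded fun U V : {U : Set (Multiset P) // DownIn F U} => U.1 ⊂ V.1 := by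
  rw [wellFounded_iff_isEmpty_descending_chain]
  refine ⟨fun ⟨f, hf⟩ => ?_⟩
  have hanti : ∀ i j, i ≤ j → (f j).1 ⊆ (f i).1 := fun i j h => by
    induction j, h using Nat.le_induction with
    | base => exact subset_rfl
    | succ j _ ih => exact (hf j).1.trans ih
  have hex : ∀ n, ∃ m ∈ (f n).1, m ∉ (f (n + 1)).1 := fun n => Set.not_subset.1 (hf n).2
  choose u hu hu' using hex
  obtain ⟨i, j, hij, h⟩ := exists_le_of_finite_support F u fun n => (f n).2.1 _ (hu n)
  exact hu' i ((f (i + 1)).2.2 _ (hanti _ _ hij (hu j)) _ h)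

theorem exists_ideal_of_directed {F : Finset P} {U : Set (Multiset P)} (hU : DownIn F U)
    (hne : U.Nonempty) (hdir : ∀ a ∈ U, ∀ b ∈ U, ∃ c ∈ U, a ≤ c ∧ b ≤ c) :
    ∃ d : List P × List P, (∀ x ∈ d.2, x ∉ d.1) ∧ (∀ m ∈ U, InI d m) ∧ ∀ n, inst d n ∈ U := by
  classical
  have hfam : ∀ (G : Finset P) (t : P → Multiset P), (∀ x ∈ G, t x ∈ U) →
      ∃ c ∈ U, ∀ x ∈ G, t x ≤ c := by
    intro G t
    induction G using Finset.induction_on with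
    | empty => exact fun _ => ⟨_, hne.some_mem, by simp⟩
    | insert a G _ ih =>
      intro h
      obtain ⟨c, hc, hc'⟩ := ih fun x hx => h x (Finset.mem_insert_of_mem hx)
      obtain ⟨e, he, h1, h2⟩ := hdir _ (h a (Finset.mem_insert_self a G)) _ hc
      refine ⟨e, he, fun x hx => ?_⟩
      rcases Finset.mem_insert.1 hx with rfl | hx
      · exact h1
      · exact (hc' x hx).trans h2
  let om : Finset P := F.filter fun x => ∀ n, ∃ m ∈ U, n ≤ m.count x
  have hmax : ∀ x, x ∉ om → ∃ m ∈ U, ∀ m' ∈ U, m'.count x ≤ m.count x := by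
    intro x hx
    by_contra! hcon
    have hgrow : ∀ n, ∃ m ∈ U, n ≤ m.count x := by
      intro n
      induction n with
      | zero => exact ⟨_, hne.some_mem, Nat.zero_le _⟩
      | succ n ih =>
        obtain ⟨m, hm, hn⟩ := ih
        obtain ⟨m', hm', h⟩ := hcon m hm
        exact ⟨m', hm', by omega⟩
    refine hx (Finset.mem_filter.2 ⟨?_, hgrow⟩)
    obtain ⟨m, hm, h⟩ := hgrow 1
    exact hU.1 m hm x (Multiset.one_le_count_iff_mem.1 h)
  choose! mx hmx hmx' using hmax
  obtain ⟨c, hc, hcmax⟩ := hfam (F \ om) mx fun x hx => hmx x (Finset.mem_sdiff.1 hx).2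
  have hcount : ∀ x, x ∉ om → ∀ m ∈ U, m.count x ≤ c.count x := by
    intro x hx m hm
    by_cases hF : x ∈ F
    · exact (hmx' x hx m hm).trans
        (Multiset.count_le_of_le x (hcmax x (Finset.mem_sdiff.2 ⟨hF, hx⟩)))
    · rw [Multiset.count_eq_zero_of_notMem fun h => hF (hU.1 m hm x h)]; exact Nat.zero_le _
  refine ⟨((c.filter (· ∉ om)).toList, om.toList), fun x hx h => ?_, fun m hm x => ?_, fun n => ?_⟩
  · rw [Finset.mem_toList] at hx
    rw [Multiset.mem_toList, Multiset.mem_filter] at h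
    exact h.2 hx
  · by_cases hx : x ∈ om
    · exact Or.inl (Finset.mem_toList.2 hx)
    · right
      rw [← Multiset.coe_count, Multiset.coe_toList, Multiset.count_filter_of_pos (p := (· ∉ om)) hx]
      exact hcount x hx m hm
  · have homb : ∀ x ∈ om, ∃ m ∈ U, n ≤ m.count x := fun x hx => (Finset.mem_filter.1 hx).2 n
    choose! t ht ht' using homb
    obtain ⟨c', hc', hcc⟩ := hfam om t ht
    obtain ⟨e, he, h1, h2⟩ := hdir c hc c' hc'
    refine hU.2 e he _ (Multiset.le_iff_count.2 fun x => ?_)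
    simp only [inst, Multiset.count_add, Multiset.count_nsmul, Multiset.coe_toList,
      Finset.coe_toList, Multiset.count_filter]
    have hom : om.val.count x = if x ∈ om then 1 else 0 := by
      simpa using Multiset.count_eq_of_nodup om.nodup (a := x)
    rw [hom]
    by_cases hx : x ∈ om
    · simp only [hx, not_true, if_false, if_true, mul_one, zero_add]
      exact (ht' x hx).trans (Multiset.count_le_of_le x ((hcc x hx).trans h2))
    · simp only [hx, not_false_eq_true, if_true, if_false, mul_zero, add_zero]
      exact Multiset.count_le_of_le x h1

/-- Downward closed sets with finite support are finite unions of ideals. -/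
theorem exists_ideal_decomposition (F : Finset P) (U : Set (Multiset P)) (hU : DownIn F U) :
    ∃ L : List (List P × List P), (∀ m ∈ U, ∃ d ∈ L, InI d m) ∧
      ∀ d ∈ L, (∀ x ∈ d.2, x ∉ d.1) ∧ ∀ n, inst d n ∈ U := by
  suffices h : ∀ V : {U : Set (Multiset P) // DownIn F U},
      ∃ L : List (List P × List P), (∀ m ∈ V.1, ∃ d ∈ L, InI d m) ∧
        ∀ d ∈ L, (∀ x ∈ d.2, x ∉ d.1) ∧ ∀ n, inst d n ∈ V.1 from h ⟨U, hU⟩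
  intro V
  induction V using (downIn_wellFounded F).induction with
  | _ V ih =>
  rcases V.1.eq_empty_or_nonempty with hne | hne
  · exact ⟨[], by simp [hne]⟩
  by_cases hdir : ∀ a ∈ V.1, ∀ b ∈ V.1, ∃ c ∈ V.1, a ≤ c ∧ b ≤ c
  · obtain ⟨d, h0, h1, h2⟩ := exists_ideal_of_directed V.2 hne hdir
    exact ⟨[d], fun m hm => ⟨d, by simp, h1 m hm⟩, by simpa using ⟨h0, h2⟩⟩
  · push Not at hdir
    obtain ⟨a, ha, b, hb, hab⟩ := hdir
    have hdown : ∀ a, DownIn F {u ∈ V.1 | ¬ a ≤ u} := fun a =>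
      ⟨fun m hm => V.2.1 m hm.1, fun m hm m' h => ⟨V.2.2 m hm.1 m' h, fun h' => hm.2 (h'.trans h)⟩⟩
    have hlt : ∀ a ∈ V.1, {u ∈ V.1 | ¬ a ≤ u} ⊂ V.1 := fun a ha =>
      ⟨fun u hu => hu.1, fun h => (h ha).2 le_rfl⟩
    obtain ⟨L1, h1, h1'⟩ := ih ⟨_, hdown a⟩ (hlt a ha)
    obtain ⟨L2, h2, h2'⟩ := ih ⟨_, hdown b⟩ (hlt b hb)
    refine ⟨L1 ++ L2, fun m hm => ?_, fun d hd => ?_⟩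
    · by_cases hma : a ≤ m
      · obtain ⟨d, hd, h⟩ := h2 m ⟨hm, hab m hm hma⟩
        exact ⟨d, List.mem_append_right _ hd, h⟩
      · obtain ⟨d, hd, h⟩ := h1 m ⟨hm, hma⟩
        exact ⟨d, List.mem_append_left _ hd, h⟩
    · rcases List.mem_append.1 hd with hd | hd
      · exact ⟨(h1' d hd).1, fun n => ((h1' d hd).2 n).1⟩
      · exact ⟨(h2' d hd).1, fun n => ((h2' d hd).2 n).1⟩

/-- An ideal lies in a finite union of ideals as soon as its cofinal chain does. -/
theorem exists_common_ideal {L : List (List P × List P)} (f : ℕ → Multiset P) (hf : Monotone f)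
    (h : ∀ n, ∃ d ∈ L, InI d (f n)) : ∃ d ∈ L, ∀ n, InI d (f n) := by
  by_contra! hcon
  have : ∀ L' : List (List P × List P), L' ⊆ L → ∃ n, ∀ d ∈ L', ¬ InI d (f n) := by
    intro L'
    induction L' with
    | nil => exact fun _ => ⟨0, by simp⟩
    | cons d L' ih =>
      intro hs
      obtain ⟨n, hn⟩ := ih fun x hx => hs (List.mem_cons_of_mem _ hx)
      obtain ⟨k, hk⟩ := hcon d (hs List.mem_cons_self)
      refine ⟨max n k, fun e he hI => ?_⟩
      rcases List.mem_cons.1 he with rfl | he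
      · exact hk (hI.mono (hf (le_max_right _ _)))
      · exact hn e he (hI.mono (hf (le_max_left _ _)))
  obtain ⟨n, hn⟩ := this L fun _ h => h
  obtain ⟨d, hd, h'⟩ := h n
  exact hn d hd h'

end Ideals

section Euler
variable {V E : Type} (src dst : E → V)

/-- `IsWalk src dst u l v`: the list of edges `l` is a walk from `u` to `v`. -/
def IsWalk : V → List E → V → Prop
  | u, [], v => u = v
  | u, e :: l, v => src e = u ∧ IsWalk (dst e) l v

variable {src dst}

theorem isWalk_append {u v : V} {l l' : List E} :
    IsWalk src dst u (l ++ l') v ↔ ∃ w, IsWalk src dst u l w ∧ IsWalk src dst w l' v := by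
  induction l generalizing u with
  | nil => simp [IsWalk]
  | cons e l ih => simp only [List.cons_append, IsWalk, ih, and_assoc, exists_and_left]

theorem IsWalk.map_add {u v : V} {l : List E} (h : IsWalk src dst u l v) :
    (l : Multiset E).map src + {v} = (l : Multiset E).map dst + {u} := by
  induction l generalizing u with
  | nil => obtain rfl : u = v := h; rfl
  | cons e l ih =>
    obtain ⟨rfl, h⟩ := h
    have := ih h
    rw [← Multiset.cons_coe, Multiset.map_cons, Multiset.map_cons, Multiset.cons_add, this,
      ← Multiset.singleton_add, ← Multiset.singleton_add]
    ac_rfl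

theorem exists_closed_walk {M : Multiset E} (hM : M.map src = M.map dst) {e : E} (he : e ∈ M) :
    ∃ l : List E, l ≠ [] ∧ IsWalk src dst (src e) l (src e) ∧ (l : Multiset E) ≤ M := by
  classical
  let p : ℕ → Prop := fun n => ∃ l w, l.length = n ∧ l ≠ [] ∧ IsWalk src dst (src e) l w ∧
    (l : Multiset E) ≤ M
  have hp1 : p 1 := ⟨[e], dst e, rfl, by simp, by simp [IsWalk], by simpa using he⟩
  have hb : ∀ n, p n → n ≤ Multiset.card M := by
    rintro n ⟨l, w, rfl, -, -, h⟩
    simpa using Multiset.card_le_card h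
  obtain ⟨l, w, hl, hne, hw, hle⟩ := Nat.findGreatest_spec (hb 1 hp1) hp1
  by_cases hwe : w = src e
  · exact ⟨l, hne, hwe ▸ hw, hle⟩
  exfalso
  obtain ⟨R, rfl⟩ := Multiset.le_iff_exists_add.1 hle
  have h1 := congrArg (Multiset.count w) hw.map_add
  have h2 := congrArg (Multiset.count w) hM
  simp only [Multiset.map_add, Multiset.count_add, Multiset.count_singleton, if_true, hwe,
    if_false] at h1 h2
  have h3 : w ∈ R.map src := Multiset.one_le_count_iff_mem.1 (by omega)
  obtain ⟨f, hf, rfl⟩ := Multiset.mem_map.1 h3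
  have hp : p (l.length + 1) := by
    refine ⟨l ++ [f], dst f, by simp, by simp, isWalk_append.2 ⟨_, hw, by simp [IsWalk]⟩, ?_⟩
    rw [← Multiset.coe_add]
    exact add_le_add_right (by simpa using hf) _
  have := Nat.le_findGreatest (hb _ hp) hp
  omega

theorem exists_euler_walk {M : Multiset E} (hM : M.map src = M.map dst) (hM0 : M ≠ 0)
    (hconn : ∀ e ∈ M, ∀ e' ∈ M,
      Relation.ReflTransGen (fun u v => ∃ f ∈ M, src f = u ∧ dst f = v) (src e) (src e')) :
    ∃ (l : List E) (v : V), IsWalk src dst v l v ∧ (l : Multiset E) = M := by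
  classical
  let p : ℕ → Prop := fun n => ∃ l v, l.length = n ∧ l ≠ [] ∧ IsWalk src dst v l v ∧
    (l : Multiset E) ≤ M
  have hb : ∀ n, p n → n ≤ Multiset.card M := by
    rintro n ⟨l, w, rfl, -, -, h⟩
    simpa using Multiset.card_le_card h
  obtain ⟨e, he⟩ := Multiset.exists_mem_of_ne_zero hM0
  obtain ⟨l0, h1, h2, h3⟩ := exists_closed_walk hM he
  have hp0 : p l0.length := ⟨l0, _, rfl, h1, h2, h3⟩
  obtain ⟨l, v, hl, hne, hw, hle⟩ := Nat.findGreatest_spec (hb _ hp0) hp0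
  refine ⟨l, v, hw, ?_⟩
  obtain ⟨R, rfl⟩ := Multiset.le_iff_exists_add.1 hle
  by_contra hR
  have hbal : (l : Multiset E).map src = (l : Multiset E).map dst :=
    add_right_cancel hw.map_add
  have hRbal : R.map src = R.map dst := by
    rw [Multiset.map_add, Multiset.map_add, hbal] at hM
    exact add_left_cancel hM
  have hR0 : R ≠ 0 := fun h => hR (by simp [h])
  have hf : ∃ f ∈ R, src f ∈ (l : Multiset E).map src := by
    by_contra! hcon
    obtain ⟨f, hf⟩ := Multiset.exists_mem_of_ne_zero hR0
    obtain ⟨e0, he0⟩ := List.exists_mem_of_ne_nil l hne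
    have hreach := hconn e0 (by simp [he0]) f (by simp [hf])
    have hall : src f ∈ (l : Multiset E).map src := by
      generalize src f = b at hreach
      induction hreach with
      | refl => exact Multiset.mem_map_of_mem src (by simpa using he0)
      | tail _ hstep ih =>
        obtain ⟨g, hg, rfl, rfl⟩ := hstep
        rcases Multiset.mem_add.1 hg with hg | hg
        · rw [hbal]; exact Multiset.mem_map_of_mem _ hg
        · exact absurd ih (hcon g hg)
    exact hcon f hf hall
  obtain ⟨f, hfR, hfl⟩ := hf
  obtain ⟨c, hc0, hc, hcR⟩ := exists_closed_walk hRbal hfR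
  obtain ⟨g, hg, hgf⟩ := Multiset.mem_map.1 hfl
  obtain ⟨l1, l2, rfl⟩ := List.append_of_mem (Multiset.mem_coe.1 hg)
  obtain ⟨w, hw1, hw2⟩ := isWalk_append.1 hw
  obtain rfl : src g = w := hw2.1
  have hp : p (c ++ ((g :: l2) ++ l1)).length := by
    refine ⟨_, src f, rfl, by simp, isWalk_append.2 ⟨_, hc, ?_⟩, ?_⟩
    · rw [← hgf]; exact isWalk_append.2 ⟨_, hw2, hw1⟩
    · rw [← Multiset.coe_add, add_comm]
      refine add_le_add (le_of_eq ?_) hcR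
      exact Multiset.coe_eq_coe.2 List.perm_append_comm
  have h := Nat.le_findGreatest (hb _ hp) hp
  have hlen : 0 < c.length := List.length_pos_of_ne_nil hc0
  simp only [List.length_append] at h hl
  omega

end Euler

section Net
variable {P : Type} [DecidableEq P]

/-- Transitions of an ω-net with control states `ℕ` and places `P`: source control state, consumed
place, target control state, produced tokens, places receiving arbitrarily many tokens. -/
abbrev NTrans (P : Type) := ℕ × P × ℕ × List P × List P

abbrev NNode (P : Type) := ℕ × List P × List P

abbrev NEdge (P : Type) := NNode P × NTrans P × NNode P

abbrev ePl (e : NEdge P) : P := e.2.1.2.1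
abbrev ePost (e : NEdge P) : List P := e.2.1.2.2.2.1
abbrev eOm (e : NEdge P) : List P := e.2.1.2.2.2.2

/-- A step of an ω-net in which `v` is the multiset of additionally produced tokens. -/
def NStep (T : List (NTrans P)) (v : Multiset P) (c c' : ℕ × Multiset P) : Prop :=
  ∃ τ ∈ T, ∃ m0, c = (τ.1, τ.2.1 ::ₘ m0) ∧ (∀ x ∈ v, x ∈ τ.2.2.2.2) ∧
    c' = (τ.2.2.1, m0 + τ.2.2.2.1 + v)

def NRel (T : List (NTrans P)) (c c' : ℕ × Multiset P) : Prop := ∃ v, NStep T v c c'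

def NLasso (T : List (NTrans P)) (c : ℕ × Multiset P) : Prop :=
  ∃ h m m', Relation.ReflTransGen (NRel T) c (h, m) ∧
    Relation.TransGen (NRel T) (h, m) (h, m') ∧ m ≤ m'

def dot {Q : Type} [DecidableEq Q] (y : List Q) (m : List Q) : ℕ := (y.map fun x => m.count x).sum

def subs {Q : Type} (l : List Q) : List (List Q) :=
  l.foldr (fun a acc => acc ++ acc.map fun s => a :: s) [[]]

def EdgeOk (e : NEdge P) : Prop :=
  e.2.2.1 = e.2.1.2.2.1 ∧ (∀ x ∈ e.1.2.2 ++ eOm e, x ∈ e.2.2.2.2) ∧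
  ∀ x ∈ e.1.2.1 ++ ePost e, x ∈ e.2.2.2.2 ∨
    e.1.2.1.count x + (ePost e).count x ≤ e.2.2.2.1.count x + [ePl e].count x

def RankOk (S : List (NEdge P)) (yp : List P) (yn : List (NNode P)) : Prop :=
  (∀ e ∈ S, ∀ x ∈ eOm e, x ∉ yp) ∧
  (∀ e ∈ S, dot yp (ePost e) + dot yn [e.2.2] ≤ dot yp [ePl e] + dot yn [e.1]) ∧
  ((∃ e ∈ S, dot yp (ePost e) + dot yn [e.2.2] < dot yp [ePl e] + dot yn [e.1]) ∨
    (yp = [] ∧ ∃ e ∈ S, ∃ e' ∈ S, dot yn [e.1] ≠ dot yn [e'.1]))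

/-- A certificate of termination of an ω-net started with a single token in place `p0`. -/
def NCert (T : List (NTrans P)) (g0 : ℕ) (p0 : P) : Prop :=
  ∃ (M : List (NNode P)) (Ed : List (NEdge P)),
    (∃ V ∈ M, V.1 = g0 ∧ p0 ∈ V.2.1 ++ V.2.2) ∧
    (∀ V ∈ M, ∀ τ ∈ T, τ.1 ≠ V.1 ∨ τ.2.1 ∉ V.2.1 ++ V.2.2 ∨
      ∃ V' ∈ M, (V, τ, V') ∈ Ed ∧ EdgeOk (V, τ, V')) ∧
    ∀ S ∈ subs Ed, S = [] ∨ ∃ yp yn, RankOk S yp yn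

theorem mem_subs {Q : Type} {l s : List Q} : s ∈ subs l ↔ s.Sublist l := by
  induction l generalizing s with
  | nil => simp [subs]
  | cons a l ih =>
    have : subs (a :: l) = subs l ++ (subs l).map fun s => a :: s := rfl
    rw [this, List.mem_append, List.mem_map, ih, List.sublist_cons_iff]
    refine or_congr Iff.rfl ⟨?_, ?_⟩
    · rintro ⟨t, ht, rfl⟩; exact ⟨t, rfl, ih.1 ht⟩
    · rintro ⟨t, rfl, ht⟩; exact ⟨t, ih.2 ht, rfl⟩

/-- `dot` for multisets. -/
def dotM {Q : Type} [DecidableEq Q] (y : List Q) (m : Multiset Q) : ℕ :=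
  (y.map fun x => m.count x).sum

theorem dotM_coe {Q : Type} [DecidableEq Q] (y l : List Q) : dotM y (l : Multiset Q) = dot y l := by
  simp [dotM, dot]

theorem dotM_add {Q : Type} [DecidableEq Q] (y : List Q) (m m' : Multiset Q) :
    dotM y (m + m') = dotM y m + dotM y m' := by
  simp [dotM, List.sum_map_add]

theorem dotM_eq_zero {Q : Type} [DecidableEq Q] {y : List Q} {m : Multiset Q}
    (h : ∀ x ∈ m, x ∉ y) : dotM y m = 0 := by
  simp only [dotM, List.sum_eq_zero_iff, List.mem_map]
  rintro _ ⟨x, hx, rfl⟩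
  exact Multiset.count_eq_zero_of_notMem fun h' => h x h' hx

theorem InI.step {e : NEdge P} (he : EdgeOk e) {m0 v : Multiset P} (hm : InI e.1.2 (ePl e ::ₘ m0))
    (hv : ∀ x ∈ v, x ∈ eOm e) : InI e.2.2.2 (m0 + (ePost e : Multiset P) + v) := by
  intro x
  by_cases hx : x ∈ e.2.2.2.2
  · exact Or.inl hx
  right
  have h1 : x ∉ e.1.2.2 ++ eOm e := fun h => hx (he.2.1 x h)
  rw [List.mem_append, not_or] at h1
  have h2 : v.count x = 0 := Multiset.count_eq_zero_of_notMem fun h => h1.2 (hv x h)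
  have h3 := (hm x).resolve_left h1.1
  have h4 : e.1.2.1.count x + (ePost e).count x ≤ e.2.2.2.1.count x + [ePl e].count x := by
    by_cases h : x ∈ e.1.2.1 ++ ePost e
    · exact (he.2.2 x h).resolve_left hx
    · rw [List.mem_append, not_or] at h
      rw [List.count_eq_zero_of_not_mem h.1, List.count_eq_zero_of_not_mem h.2]
      exact Nat.zero_le _
  rw [← Multiset.singleton_add, ← Multiset.coe_singleton] at h3
  simp only [Multiset.count_add, Multiset.coe_count] at h3 ⊢
  omega

/-- A certified ω-net has no infinite run. -/
theorem NCert.no_infinite_run {T : List (NTrans P)} {g0 : ℕ} {p0 : P} (hc : NCert T g0 p0)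
    (c : ℕ → ℕ × Multiset P) (h0 : c 0 = (g0, {p0})) (hstep : ∀ n, NRel T (c n) (c (n + 1))) :
    False := by
  classical
  obtain ⟨M, Ed, ⟨V0, hV0, hV0g, hV0p⟩, hcl, hrk⟩ := hc
  have hnext : ∀ n (V : {V : NNode P // V ∈ M ∧ V.1 = (c n).1 ∧ InI V.2 (c n).2}),
      ∃ (V' : {V : NNode P // V ∈ M ∧ V.1 = (c (n + 1)).1 ∧ InI V.2 (c (n + 1)).2})
        (τ : NTrans P), (V.1, τ, V'.1) ∈ Ed ∧ ∃ m0 v, (c n).2 = τ.2.1 ::ₘ m0 ∧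
          (∀ x ∈ v, x ∈ τ.2.2.2.2) ∧ (c (n + 1)).2 = m0 + τ.2.2.2.1 + v := by
    rintro n ⟨V, hVM, hVg, hVI⟩
    obtain ⟨v, τ, hτ, m0, hcn, hv, hcn'⟩ := hstep n
    rw [hcn] at hVg hVI
    have hpl : τ.2.1 ∈ V.2.1 ++ V.2.2 := by
      rw [List.mem_append]
      rcases hVI τ.2.1 with h | h
      · exact Or.inr h
      · left
        rw [Multiset.count_cons_self] at h
        exact List.one_le_count_iff.1 (by omega)
    rcases hcl V hVM τ hτ with h | h | ⟨V', hV', hE, hok⟩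
    · exact absurd hVg.symm h
    · exact absurd hpl h
    · refine ⟨⟨V', hV', ?_, ?_⟩, τ, hE, m0, v, by rw [hcn], hv, by rw [hcn']⟩
      · rw [hcn']; exact hok.1
      · rw [hcn']; exact InI.step hok hVI hv
  choose nxt tr hEd m0 v hm hv hm' using hnext
  let Vs : ∀ n, {V : NNode P // V ∈ M ∧ V.1 = (c n).1 ∧ InI V.2 (c n).2} := fun n =>
    Nat.rec ⟨V0, hV0, by rw [h0]; exact hV0g, by
      rw [h0]; intro x
      rcases List.mem_append.1 hV0p with h | h
      · by_cases hx : x = p0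
        · right; subst hx; rw [Multiset.count_singleton_self]; exact List.one_le_count_iff.2 h
        · right; rw [Multiset.count_singleton, if_neg hx]; exact Nat.zero_le _
      · by_cases hx : x = p0
        · left; exact hx ▸ h
        · right; rw [Multiset.count_singleton, if_neg hx]; exact Nat.zero_le _⟩
      (fun n V => nxt n V) n
  have hVs : ∀ n, Vs (n + 1) = nxt n (Vs n) := fun n => rfl
  let ed : ℕ → NEdge P := fun n => ((Vs n).1, tr n (Vs n), (Vs (n + 1)).1)
  have hed : ∀ n, ed n ∈ Ed := fun n => by simp only [ed, hVs]; exact hEd n _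
  let S := Ed.filter fun e => decide (∀ N, ∃ n ≥ N, ed n = e)
  have hSinf : ∀ e ∈ S, ∀ N, ∃ n ≥ N, ed n = e := fun e he => by
    simpa using (List.mem_filter.1 he).2
  have hev : ∃ N, ∀ n ≥ N, ed n ∈ S := by
    have : ∀ L : List (NEdge P), L ⊆ Ed → ∃ N, ∀ n ≥ N, ed n ∈ L → ed n ∈ S := by
      intro L
      induction L with
      | nil => exact fun _ => ⟨0, by simp⟩
      | cons e L ih =>
        intro hs
        obtain ⟨N, hN⟩ := ih fun x hx => hs (List.mem_cons_of_mem _ hx)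
        by_cases he : ∀ N, ∃ n ≥ N, ed n = e
        · refine ⟨N, fun n hn hmem => ?_⟩
          rcases List.mem_cons.1 hmem with h | h
          · rw [h]; exact List.mem_filter.2 ⟨hs List.mem_cons_self, by simpa using he⟩
          · exact hN n hn h
        · push Not at he
          obtain ⟨N', hN'⟩ := he
          refine ⟨max N N', fun n hn hmem => ?_⟩
          rcases List.mem_cons.1 hmem with h | h
          · exact absurd h (hN' n (le_trans (le_max_right _ _) hn))
          · exact hN n (le_trans (le_max_left _ _) hn) h
    obtain ⟨N, hN⟩ := this Ed fun _ h => h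
    exact ⟨N, fun n hn => hN n hn (hed n)⟩
  obtain ⟨N, hN⟩ := hev
  have hne : S ≠ [] := List.ne_nil_of_mem (hN N le_rfl)
  obtain ⟨yp, yn, hom, hdec, hstr⟩ :=
    (hrk S (mem_subs.2 List.filter_sublist)).resolve_left hne
  let Φ : ℕ → ℕ := fun n => dotM yp (c n).2 + dot yn [(Vs n).1]
  have hΦ : ∀ n ≥ N, Φ n + (dot yp (ePost (ed n)) + dot yn [(ed n).2.2]) =
      Φ (n + 1) + (dot yp [ePl (ed n)] + dot yn [(ed n).1]) := by
    intro n hn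
    have e1 := hm n (Vs n)
    have e2 := hm' n (Vs n)
    have f1 : dotM yp (c n).2 = dot yp [ePl (ed n)] + dotM yp (m0 n (Vs n)) := by
      rw [e1, ← Multiset.singleton_add, dotM_add, ← Multiset.coe_singleton, dotM_coe]
    have f2 : dotM yp (c (n + 1)).2 = dotM yp (m0 n (Vs n)) + dot yp (ePost (ed n)) := by
      rw [e2, dotM_add, dotM_add, dotM_coe,
        dotM_eq_zero (m := v n (Vs n)) fun x hx => hom _ (hN n hn) x (hv n (Vs n) x hx)]
      rfl
    have f3 : (ed n).2.2 = (Vs (n + 1)).1 := rfl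
    have f4 : (ed n).1 = (Vs n).1 := rfl
    simp only [Φ]
    rw [f1, f2, f3, f4]
    omega
  have hanti : ∀ n ≥ N, Φ (n + 1) ≤ Φ n := fun n hn => by
    have := hΦ n hn
    have := hdec _ (hN n hn)
    omega
  obtain ⟨n0, hn0, hmin⟩ : ∃ n0 ≥ N, ∀ n ≥ N, Φ n0 ≤ Φ n := by
    have hne : (Φ '' Set.Ici N).Nonempty := ⟨_, N, Set.mem_Ici.2 (le_refl N), rfl⟩
    obtain ⟨n0, hn0, h⟩ := Nat.sInf_mem hne
    exact ⟨n0, hn0, fun n hn => h ▸ Nat.sInf_le ⟨n, hn, rfl⟩⟩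
  have hconst : ∀ n ≥ n0, Φ n = Φ n0 := by
    intro n hn
    induction n, hn using Nat.le_induction with
    | base => rfl
    | succ n hn ih =>
      have := hanti n (le_trans hn0 hn)
      have := hmin (n + 1) (by omega)
      omega
  rcases hstr with ⟨e, he, hlt⟩ | ⟨rfl, e, he, e', he', hdiff⟩
  · obtain ⟨n, hn, rfl⟩ := hSinf e he n0
    have h1 := hΦ n (by omega)
    have h2 := hconst n hn
    have h3 := hconst (n + 1) (by omega)
    omega
  · obtain ⟨n, hn, rfl⟩ := hSinf e he n0
    obtain ⟨n', hn', rfl⟩ := hSinf e' he' n0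
    have h1 := hconst n hn
    have h2 := hconst n' hn'
    simp only [Φ, dotM, List.map_nil, List.sum_nil, zero_add] at h1 h2
    exact hdiff (h1.trans h2.symm)

end Net

section Net
variable {P : Type} [DecidableEq P]

/-- The number of occurrences of an element of a list. -/
def lcount {Q : Type} [DecidableEq Q] (x : Q) (l : List Q) : ℕ := l.count x

theorem lcount_eq_zero {Q : Type} [DecidableEq Q] {x : Q} {l : List Q} (h : x ∉ l) :
    lcount x l = 0 := List.count_eq_zero_of_not_mem h

theorem dot_flatMap_replicate {Q R : Type} [DecidableEq Q] (L : List R) (f : R → Q) (y : R → ℕ)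
    (l : List Q) : dot (L.flatMap fun r => List.replicate (y r) (f r)) l =
      (L.map fun r => y r * lcount (f r) l).sum := by
  induction L with
  | nil => simp [dot]
  | cons r L ih =>
    simp only [dot] at ih
    simp [dot, ih, lcount]

theorem dot_singleton_of_nodup {Q : Type} [DecidableEq Q] {y : List Q} (hy : y.Nodup) (x : Q) :
    dot y [x] = if x ∈ y then 1 else 0 := by
  induction y with
  | nil => simp [dot]
  | cons a y ih =>
    rw [List.nodup_cons] at hy
    have h1 : dot (a :: y) [x] = [x].count a + dot y [x] := by simp [dot]
    rw [h1, ih hy.2, List.count_singleton]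
    by_cases h : x = a
    · subst h; simp [hy.1]
    · simp [h]

theorem map_sum_smul {E : Type} {ι : Type} [Fintype ι] (x : ι → ℕ) (g : ι → E) (f : E → ℕ) :
    ((∑ i, x i • ({g i} : Multiset E)).map f).sum = ∑ i, x i * f (g i) := by
  let φ : Multiset E →+ ℕ := Multiset.sumAddMonoidHom.comp (Multiset.mapAddMonoidHom f)
  change φ _ = _
  rw [map_sum]
  refine Finset.sum_congr rfl fun i _ => ?_
  rw [map_nsmul]
  simp [φ]

theorem count_map_eq_sum {E Q : Type} [DecidableEq Q] (M : Multiset E) (f : E → Q) (x : Q) :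
    (M.map f).count x = (M.map fun e => lcount x [f e]).sum := by
  induction M using Multiset.induction with
  | empty => simp
  | cons e M ih =>
    rw [Multiset.map_cons, Multiset.map_cons, Multiset.sum_cons, ← ih, ← Multiset.singleton_add,
      Multiset.count_add, ← Multiset.coe_singleton, Multiset.coe_count, lcount]

abbrev EReach (S : List (NEdge P)) : NNode P → NNode P → Prop :=
  Relation.ReflTransGen fun u v => ∃ f ∈ S, f.1 = u ∧ f.2.2 = v

/-- Either a set of edges admits a ranking function, or it is strongly connected and carries a
circulation with nonnegative effect. -/
theorem exists_rank_or_circulation (S : List (NEdge P)) :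
    (∃ yp yn, RankOk S yp yn) ∨
    (∀ e ∈ S, ∀ e' ∈ S, EReach S e.1 e'.1) ∧ ∃ M : Multiset (NEdge P), (∀ e, e ∈ M ↔ e ∈ S) ∧
      M.map (fun e => e.1) = M.map (fun e => e.2.2) ∧
      ∀ x, (∀ e ∈ S, x ∉ eOm e) →
        (M.map fun e => [ePl e].count x).sum ≤ (M.map fun e => (ePost e).count x).sum := by
  classical
  by_cases hconn : ∀ e ∈ S, ∀ e' ∈ S, EReach S e.1 e'.1
  swap
  · left
    push Not at hconn
    obtain ⟨e, he, e', he', hn⟩ := hconn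
    let nodes := (S.map (fun e => e.1) ++ S.map (fun e => e.2.2)).dedup
    let yn := nodes.filter fun V => decide (¬ EReach S e.1 V)
    have hy : yn.Nodup := (List.nodup_dedup _).filter _
    have hsrc : ∀ f ∈ S, f.1 ∈ yn ↔ ¬ EReach S e.1 f.1 := fun f hf => by
      simp only [yn, List.mem_filter, decide_eq_true_eq, nodes, List.mem_dedup, List.mem_append,
        List.mem_map]
      exact ⟨fun h => h.2, fun h => ⟨Or.inl ⟨f, hf, rfl⟩, h⟩⟩
    refine ⟨[], yn, fun _ _ _ _ h => (List.not_mem_nil h), fun f hf => ?_,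
      Or.inr ⟨rfl, e, he, e', he', ?_⟩⟩
    · rw [dot_singleton_of_nodup hy, dot_singleton_of_nodup hy]
      by_cases h : f.1 ∈ yn
      · rw [if_pos h]; simp only [dot, List.map_nil, List.sum_nil]; split_ifs <;> omega
      · have h2 : f.2.2 ∉ yn := fun h' => by
          rw [hsrc f hf, not_not] at h
          exact (of_decide_eq_true (List.mem_filter.1 h').2) (h.tail ⟨f, hf, rfl, rfl⟩)
        rw [if_neg h, if_neg h2]; simp [dot]
    · rw [dot_singleton_of_nodup hy, dot_singleton_of_nodup hy, if_neg, if_pos]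
      · decide
      · exact (hsrc e' he').2 hn
      · rw [hsrc e he, not_not]
  let rel : Finset P := (S.flatMap fun e => ePl e :: ePost e).toFinset.filter
    fun x => ∀ e ∈ S, x ∉ eOm e
  let nodes : Finset (NNode P) := (S.map fun e => e.1).toFinset
  let A : rel ⊕ nodes → {e // e ∈ S} → ℤ := fun r e => Sum.elim
    (fun x => (lcount x.1 (ePost e.1) : ℤ) - lcount x.1 [ePl e.1])
    (fun V => (lcount V.1 [e.1.2.2] : ℤ) - lcount V.1 [e.1.1]) r
  rcases exists_pos_solution_or_certificate A with ⟨x, hx, hA⟩ | ⟨y, hy, e1, hy1⟩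
  · right
    refine ⟨hconn, ∑ e, x e • {e.1}, fun e => ?_, ?_, fun p hp => ?_⟩
    · rw [Multiset.mem_sum]
      constructor
      · rintro ⟨e', -, h⟩
        rw [Multiset.mem_nsmul] at h
        rw [Multiset.mem_singleton.1 h.2]; exact e'.2
      · intro h
        refine ⟨⟨e, h⟩, Finset.mem_univ _, ?_⟩
        rw [Multiset.mem_nsmul]
        exact ⟨(hx _).ne', Multiset.mem_singleton_self _⟩
    · refine Multiset.eq_of_le_of_card_le ?_ (by simp)
      rw [Multiset.le_iff_count]
      intro V
      rw [count_map_eq_sum, count_map_eq_sum, map_sum_smul, map_sum_smul]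
      by_cases hV : V ∈ nodes
      · have := hA (Sum.inr ⟨V, hV⟩)
        simp only [A, Sum.elim_inr, sub_mul, Finset.sum_sub_distrib, sub_nonneg] at this
        have h2 : ∀ f : {e // e ∈ S} → ℕ, ∑ e, f e * x e = ∑ e, x e * f e := fun f =>
          Finset.sum_congr rfl fun _ _ => mul_comm _ _
        rw [← h2, ← h2]
        exact_mod_cast this
      · refine le_of_eq_of_le (Finset.sum_eq_zero fun e _ => ?_) (Nat.zero_le _)
        rw [lcount_eq_zero, mul_zero]
        rw [List.mem_singleton]
        rintro rfl
        exact hV (List.mem_toFinset.2 (List.mem_map.2 ⟨e.1, e.2, rfl⟩))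
    · rw [map_sum_smul, map_sum_smul]
      by_cases hV : p ∈ rel
      · have := hA (Sum.inl ⟨p, hV⟩)
        simp only [A, Sum.elim_inl, sub_mul, Finset.sum_sub_distrib, sub_nonneg] at this
        have h2 : ∀ f : {e // e ∈ S} → ℕ, ∑ e, f e * x e = ∑ e, x e * f e := fun f =>
          Finset.sum_congr rfl fun _ _ => mul_comm _ _
        rw [← h2, ← h2]
        simp only [lcount] at this
        exact_mod_cast this
      · refine le_of_eq_of_le (Finset.sum_eq_zero fun e _ => ?_) (Nat.zero_le _)
        rw [List.count_eq_zero_of_not_mem, mul_zero]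
        rw [List.mem_singleton]
        intro h
        refine hV (Finset.mem_filter.2 ⟨List.mem_toFinset.2 (List.mem_flatMap.2 ⟨e.1, e.2, ?_⟩), hp⟩)
        rw [h]; exact List.mem_cons_self
  · left
    let yp := (Finset.univ : Finset rel).toList.flatMap fun x => List.replicate (y (.inl x)) x.1
    let yn := (Finset.univ : Finset nodes).toList.flatMap fun x => List.replicate (y (.inr x)) x.1
    have hyp : ∀ l, dot yp l = ∑ x : rel, y (.inl x) * lcount x.1 l := fun l => by
      simp only [yp]; rw [dot_flatMap_replicate, Finset.sum_map_toList]
    have hyn : ∀ l, dot yn l = ∑ x : nodes, y (.inr x) * lcount x.1 l := fun l => by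
      simp only [yn]; rw [dot_flatMap_replicate, Finset.sum_map_toList]
    have hval : ∀ e : {e // e ∈ S}, ∑ r, (y r : ℤ) * A r e =
        ((dot yp (ePost e.1) + dot yn [e.1.2.2] : ℕ) : ℤ) -
          (dot yp [ePl e.1] + dot yn [e.1.1] : ℕ) := fun e => by
      rw [Fintype.sum_sum_type]
      simp only [A, Sum.elim_inl, Sum.elim_inr, mul_sub, Finset.sum_sub_distrib, hyp, hyn]
      push_cast
      ring
    refine ⟨yp, yn, fun e he x hx hxy => ?_, fun e he => ?_, Or.inl ⟨e1.1, e1.2, ?_⟩⟩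
    · obtain ⟨z, -, hz⟩ := List.mem_flatMap.1 hxy
      rw [List.eq_of_mem_replicate hz] at hx
      exact (Finset.mem_filter.1 z.2).2 e he hx
    · have := hy ⟨e, he⟩
      rw [hval] at this
      dsimp only at this
      omega
    · rw [hval] at hy1
      omega

/-- Following a walk in the graph of ideals. -/
theorem walk_run {T : List (NTrans P)} (N : ℕ) (W : P → Prop) :
    ∀ (l : List (NEdge P)) (u w : NNode P) (m : Multiset P),
    IsWalk (fun e : NEdge P => e.1) (fun e => e.2.2) u l w →
    (∀ e ∈ l, e.2.1 ∈ T ∧ e.2.1.1 = e.1.1 ∧ e.2.2.1 = e.2.1.2.2.1 ∧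
      (W (ePl e) ∨ ePl e ∈ e.1.2.1) ∧
      ∀ x, ¬ W x → e.2.2.2.1.count x + [ePl e].count x = e.1.2.1.count x + (ePost e).count x) →
    (∀ x, ¬ W x → u.2.1.count x ≤ m.count x) → (∀ x, W x → l.length ≤ m.count x) →
    ∃ m', Relation.ReflTransGen (NRel T) (u.1, m) (w.1, m') ∧
      (l ≠ [] → Relation.TransGen (NRel T) (u.1, m) (w.1, m')) ∧
      ∀ x, m.count x + ((l : Multiset (NEdge P)).map fun e => (ePost e).count x).sum +
        ((l : Multiset (NEdge P)).map fun e => N * (eOm e).count x).sum =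
        m'.count x + ((l : Multiset (NEdge P)).map fun e => [ePl e].count x).sum := by
  intro l
  induction l with
  | nil =>
    intro u w m h _ _ _
    obtain rfl : u = w := h
    exact ⟨m, .refl, fun h => absurd rfl h, by simp⟩
  | cons e l ih =>
    intro u w m hw he hm hmW
    obtain ⟨rfl, hw⟩ := hw
    obtain ⟨hT, hs, hd, hpl, heff⟩ := he e List.mem_cons_self
    have hin : ePl e ∈ m := by
      rw [← Multiset.count_pos]
      by_cases hW : W (ePl e)
      · have := hmW _ hW; rw [List.length_cons] at this; omega
      · have := hm _ hW
        have h5 : 0 < e.1.2.1.count (ePl e) := List.count_pos_iff.2 (hpl.resolve_left hW)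
        exact lt_of_lt_of_le h5 this
    obtain ⟨m0, rfl⟩ := Multiset.exists_cons_of_mem hin
    have hstep : NRel T (e.1.1, ePl e ::ₘ m0)
        (e.2.2.1, m0 + (ePost e : Multiset P) + N • (eOm e : Multiset P)) := by
      refine ⟨N • (eOm e : Multiset P), e.2.1, hT, m0, by rw [hs], fun x hx => ?_, by rw [hd]⟩
      rw [Multiset.mem_nsmul] at hx
      exact hx.2
    have hcnt : ∀ x, (ePl e ::ₘ m0).count x = [ePl e].count x + m0.count x := fun x => by
      rw [← Multiset.singleton_add, ← Multiset.coe_singleton, Multiset.count_add,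
        Multiset.coe_count]
    obtain ⟨m', h1, -, h3⟩ := ih e.2.2 w (m0 + (ePost e : Multiset P) + N • (eOm e : Multiset P)) hw
      (fun f hf => he f (List.mem_cons_of_mem _ hf)) (fun x hx => by
        have h4 : e.1.2.1.count x ≤ _ := hm x hx
        have := heff x hx
        rw [hcnt] at h4
        simp only [Multiset.count_add, Multiset.coe_count]
        omega) (fun x hx => by
        have := hmW x hx
        rw [hcnt, List.length_cons] at this
        have : [ePl e].count x ≤ 1 := by simpa using List.count_le_length (a := x) (l := [ePl e])
        simp only [Multiset.count_add]
        omega)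
    refine ⟨m', .head hstep h1, fun _ => .head' hstep h1, fun x => ?_⟩
    have := h3 x
    rw [hcnt, ← Multiset.cons_coe]
    simp only [Multiset.map_cons, Multiset.sum_cons, Multiset.count_add, Multiset.coe_count,
      Multiset.count_nsmul] at this ⊢
    omega

end Net

section Net
variable {P : Type} [DecidableEq P]

theorem eq_of_sum_map_le {E : Type} {M : Multiset E} {f g : E → ℕ} (h : ∀ e ∈ M, f e ≤ g e)
    (hs : (M.map g).sum ≤ (M.map f).sum) : ∀ e ∈ M, f e = g e := by
  induction M using Multiset.induction with
  | empty => simp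
  | cons a M ih =>
    simp only [Multiset.map_cons, Multiset.sum_cons] at hs
    have h1 := h a (Multiset.mem_cons_self _ _)
    have h2 : (M.map f).sum ≤ (M.map g).sum :=
      Multiset.sum_map_le_sum_map f g fun e he => h e (Multiset.mem_cons_of_mem he)
    intro e he
    rcases Multiset.mem_cons.1 he with rfl | he
    · omega
    · exact ih (fun e he => h e (Multiset.mem_cons_of_mem he)) (by omega) e he

theorem sum_map_count_singleton_le (x : P) (l : List (NEdge P)) :
    ((l : Multiset (NEdge P)).map fun e => [ePl e].count x).sum ≤ l.length := by
  have := Multiset.sum_map_le_sum_map (s := (l : Multiset (NEdge P)))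
    (fun e => [ePl e].count x) (fun _ => 1) fun e _ => by
      simpa using List.count_le_length (a := x) (l := [ePl e])
  simpa using this

theorem nLasso_of_circulation {T : List (NTrans P)} {c : ℕ × Multiset P} {S : List (NEdge P)}
    (hS : S ≠ [])
    (hE : ∀ e ∈ S, e.2.1 ∈ T ∧ e.2.1.1 = e.1.1 ∧ ePl e ∈ e.1.2.1 ++ e.1.2.2 ∧ EdgeOk e)
    (hreach : ∀ e ∈ S, ∀ N, ∃ m', inst e.1.2 N ≤ m' ∧
      Relation.ReflTransGen (NRel T) c (e.1.1, m'))
    (hconn : ∀ e ∈ S, ∀ e' ∈ S, EReach S e.1 e'.1) {M : Multiset (NEdge P)}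
    (hMS : ∀ e, e ∈ M ↔ e ∈ S) (hM : M.map (fun e => e.1) = M.map (fun e => e.2.2))
    (hME : ∀ x, (∀ e ∈ S, x ∉ eOm e) →
      (M.map fun e => [ePl e].count x).sum ≤ (M.map fun e => (ePost e).count x).sum) :
    NLasso T c := by
  obtain ⟨e0, he0⟩ := List.exists_mem_of_ne_nil S hS
  obtain ⟨l, v, hl, rfl⟩ := exists_euler_walk hM
    (fun h => by have := (hMS e0).2 he0; rw [h] at this; simp at this)
    (fun e he e' he' => by
      have := hconn e ((hMS e).1 he) e' ((hMS e').1 he')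
      simpa only [hMS] using this)
  have hlne : l ≠ [] := fun h => by
    have := (hMS e0).2 he0; rw [h] at this; simp at this
  obtain ⟨f0, hf0, rfl⟩ : ∃ f ∈ S, f.1 = v := by
    cases l with
    | nil => exact absurd rfl hlne
    | cons f l => exact ⟨f, (hMS f).1 (by simp), hl.1⟩
  have hmono : ∀ u w, EReach S u w → ∀ x ∈ u.2.2, x ∈ w.2.2 := by
    intro u w h
    induction h with
    | refl => exact fun _ h => h
    | tail _ h ih =>
      obtain ⟨f, hf, rfl, rfl⟩ := h
      exact fun x hx => (hE f hf).2.2.2.2.1 x (List.mem_append_left _ (ih x hx))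
  have hsrc : ∀ e ∈ S, ∀ x, x ∈ e.1.2.2 ↔ x ∈ f0.1.2.2 := fun e he x =>
    ⟨hmono _ _ (hconn e he f0 hf0) x, hmono _ _ (hconn f0 hf0 e he) x⟩
  have hdst : ∀ e ∈ S, ∀ x, x ∈ e.2.2.2.2 ↔ x ∈ f0.1.2.2 := fun e he x => by
    have : e.2.2 ∈ (l : Multiset (NEdge P)).map (fun e => e.1) := by
      rw [hM]; exact Multiset.mem_map_of_mem (fun e => e.2.2) ((hMS e).2 he)
    obtain ⟨f, hf, h⟩ := Multiset.mem_map.1 this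
    rw [← h]
    exact hsrc f ((hMS f).1 hf) x
  have hle : ∀ x, x ∉ f0.1.2.2 → ∀ e ∈ (l : Multiset (NEdge P)),
      e.1.2.1.count x + (ePost e).count x ≤ e.2.2.2.1.count x + [ePl e].count x := by
    intro x hx e he
    have heS := (hMS e).1 he
    by_cases hx2 : x ∈ e.1.2.1 ++ ePost e
    · exact ((hE e heS).2.2.2.2.2 x hx2).resolve_left fun h => hx ((hdst e heS x).1 h)
    · rw [List.mem_append, not_or] at hx2
      rw [List.count_eq_zero_of_not_mem hx2.1, List.count_eq_zero_of_not_mem hx2.2]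
      exact Nat.zero_le _
  have hOm : ∀ x, x ∉ f0.1.2.2 → ∀ e ∈ S, x ∉ eOm e := fun x hx e he h =>
    hx ((hdst e he x).1 ((hE e he).2.2.2.2.1 x (List.mem_append_right _ h)))
  have heq : ∀ x, x ∉ f0.1.2.2 → ∀ e ∈ (l : Multiset (NEdge P)),
      e.1.2.1.count x + (ePost e).count x = e.2.2.2.1.count x + [ePl e].count x := by
    intro x hx
    refine eq_of_sum_map_le (hle x hx) ?_
    rw [Multiset.sum_map_add, Multiset.sum_map_add]
    have h1 := hME x (hOm x hx)
    have h2 := congrArg (fun s => (s.map fun V : NNode P => V.2.1.count x).sum) hM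
    simp only [Multiset.map_map, Function.comp_def] at h2
    omega
  obtain ⟨m, hm, hr⟩ := hreach f0 hf0 l.length
  have hcm : ∀ x, f0.1.2.1.count x + l.length * f0.1.2.2.count x ≤ m.count x := fun x => by
    have := Multiset.count_le_of_le x hm
    simpa [inst] using this
  obtain ⟨m', -, h2, h3⟩ := walk_run (T := T) l.length (fun x => x ∈ f0.1.2.2) l f0.1 f0.1 m hl
    (fun e he => by
      have heS := (hMS e).1 he
      obtain ⟨hT, hs, hpl, hok⟩ := hE e heS
      refine ⟨hT, hs, hok.1, ?_, fun x hx => (heq x hx e he).symm⟩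
      rcases List.mem_append.1 hpl with h | h
      · exact Or.inr h
      · exact Or.inl ((hsrc e heS _).1 h))
    (fun x _ => by have := hcm x; omega)
    (fun x hx => by
      have := hcm x
      have : 1 ≤ f0.1.2.2.count x := List.one_le_count_iff.2 hx
      nlinarith)
  refine ⟨f0.1.1, m, m', hr, h2 hlne, Multiset.le_iff_count.2 fun x => ?_⟩
  have h4 := h3 x
  by_cases hx : ∀ e ∈ S, x ∉ eOm e
  · have := hME x hx
    omega
  · push Not at hx
    obtain ⟨e, he, hxe⟩ := hx
    have h5 := sum_map_count_singleton_le x l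
    have h6 : l.length ≤ ((l : Multiset (NEdge P)).map fun e => l.length * (eOm e).count x).sum := by
      have h7 : l.length * (eOm e).count x ∈
          (l : Multiset (NEdge P)).map fun e => l.length * (eOm e).count x :=
        Multiset.mem_map_of_mem (fun e => l.length * (eOm e).count x) ((hMS e).2 he)
      have h8 := Multiset.single_le_sum (fun _ _ => Nat.zero_le _) _ h7
      have : 1 ≤ (eOm e).count x := List.one_le_count_iff.2 hxe
      exact le_trans (Nat.le_mul_of_pos_right _ this) h8
    omega

/-- An ω-net without lassos is certified to terminate. -/
theorem nCert_of_not_nLasso {T : List (NTrans P)} {g0 : ℕ} {p0 : P}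
    (h : ¬ NLasso T (g0, {p0})) : NCert T g0 p0 := by
  classical
  let F : Finset P := (p0 :: T.flatMap fun τ => τ.2.2.2.1 ++ τ.2.2.2.2).toFinset
  have hF0 : p0 ∈ F := by simp [F]
  have hFT : ∀ τ ∈ T, ∀ x, x ∈ τ.2.2.2.1 ∨ x ∈ τ.2.2.2.2 → x ∈ F := fun τ hτ x hx => by
    refine List.mem_toFinset.2 (List.mem_cons_of_mem _ (List.mem_flatMap.2 ⟨τ, hτ, ?_⟩))
    exact List.mem_append.2 hx
  have hFin : ∀ c, Relation.ReflTransGen (NRel T) (g0, ({p0} : Multiset P)) c →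
      (∀ x ∈ c.2, x ∈ F) ∧ c.1 ∈ g0 :: T.map fun τ => τ.2.2.1 := by
    intro c hc
    induction hc with
    | refl => exact ⟨fun x hx => (Multiset.mem_singleton.1 hx) ▸ hF0, by simp⟩
    | tail _ h ih =>
      obtain ⟨v, τ, hτ, m0, rfl, hv, rfl⟩ := h
      refine ⟨fun x hx => ?_, List.mem_cons_of_mem _ (List.mem_map.2 ⟨τ, hτ, rfl⟩)⟩
      rcases Multiset.mem_add.1 hx with hx | hx
      · rcases Multiset.mem_add.1 hx with hx | hx
        · exact ih.1 x (Multiset.mem_cons_of_mem hx)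
        · exact hFT τ hτ x (Or.inl (by simpa using hx))
      · exact hFT τ hτ x (Or.inr (hv x hx))
  let U : ℕ → Set (Multiset P) := fun h =>
    {m | ∃ m', m ≤ m' ∧ Relation.ReflTransGen (NRel T) (g0, {p0}) (h, m')}
  have hU : ∀ h, DownIn F (U h) := fun h =>
    ⟨fun m ⟨m', hm, hr⟩ x hx => (hFin _ hr).1 x (Multiset.mem_of_le hm hx),
      fun m ⟨m', hm, hr⟩ m2 h2 => ⟨m', h2.trans hm, hr⟩⟩
  choose L hL hL' using fun h => exists_ideal_decomposition F (U h) (hU h)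
  let ctl := g0 :: T.map fun τ => τ.2.2.1
  let M : List (NNode P) := ctl.flatMap fun h => (L h).map fun d => (h, d)
  have hMmem : ∀ V, V ∈ M ↔ V.1 ∈ ctl ∧ V.2 ∈ L V.1 := by
    rintro ⟨h, d⟩
    simp only [M, List.mem_flatMap, List.mem_map]
    constructor
    · rintro ⟨h', hh, d', hd, he⟩; cases he; exact ⟨hh, hd⟩
    · rintro ⟨hh, hd⟩; exact ⟨h, hh, d, hd, rfl⟩
  let Ed : List (NEdge P) := (M.flatMap fun V => T.flatMap fun τ => M.map fun V' => (V, τ, V')).filter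
    fun e => decide (e.2.1.1 = e.1.1 ∧ ePl e ∈ e.1.2.1 ++ e.1.2.2 ∧ EdgeOk e)
  have hEd : ∀ e : NEdge P, e ∈ Ed ↔ (e.1 ∈ M ∧ e.2.1 ∈ T ∧ e.2.2 ∈ M) ∧
      e.2.1.1 = e.1.1 ∧ ePl e ∈ e.1.2.1 ++ e.1.2.2 ∧ EdgeOk e := by
    rintro ⟨V, τ, V'⟩
    simp only [Ed, List.mem_filter, decide_eq_true_eq, List.mem_flatMap, List.mem_map]
    refine and_congr_left fun _ => ⟨?_, ?_⟩
    · rintro ⟨V, hV, τ, hτ, V', hV', he⟩; cases he; exact ⟨hV, hτ, hV'⟩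
    · rintro ⟨hV, hτ, hV'⟩; exact ⟨V, hV, τ, hτ, V', hV', rfl⟩
  refine ⟨M, Ed, ?_, ?_, ?_⟩
  · obtain ⟨d, hd, hI⟩ := hL g0 {p0} ⟨{p0}, le_rfl, .refl⟩
    refine ⟨(g0, d), (hMmem _).2 ⟨List.mem_cons_self, hd⟩, rfl, ?_⟩
    rcases hI p0 with h | h
    · exact List.mem_append_right _ h
    · rw [Multiset.count_singleton_self] at h
      exact List.mem_append_left _ (List.one_le_count_iff.1 h)
  · rintro ⟨g, d⟩ hV τ hτ
    by_cases h1 : τ.1 = g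
    swap
    · exact Or.inl h1
    by_cases h2 : τ.2.1 ∈ d.1 ++ d.2
    swap
    · exact Or.inr (Or.inl h2)
    right; right
    obtain ⟨hgctl, hdL⟩ := (hMmem _).1 hV
    simp only at hgctl hdL
    let f : ℕ → Multiset P := fun n =>
      (inst d (n + 1) - {τ.2.1}) + (τ.2.2.2.1 : Multiset P) + n • (τ.2.2.2.2 : Multiset P)
    have hf : Monotone f := fun n k hnk => by
      refine add_le_add (add_le_add (tsub_le_tsub_right (inst_mono d (by omega)) _) le_rfl) ?_
      rw [Multiset.le_iff_count]
      intro x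
      simp only [Multiset.count_nsmul]
      gcongr
    have hfU : ∀ n, f n ∈ U τ.2.2.1 := by
      intro n
      obtain ⟨m', hm', hr⟩ := (hL' g d hdL).2 (n + 1)
      have hmem : τ.2.1 ∈ inst d (n + 1) := by
        rcases List.mem_append.1 h2 with h | h
        · exact Multiset.mem_add.2 (Or.inl (by simpa using h))
        · exact Multiset.mem_add.2 (Or.inr (Multiset.mem_nsmul.2 ⟨by omega, by simpa using h⟩))
      have hmem' := Multiset.mem_of_le hm' hmem
      refine ⟨(m' - {τ.2.1}) + (τ.2.2.2.1 : Multiset P) + n • (τ.2.2.2.2 : Multiset P),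
        add_le_add (add_le_add (tsub_le_tsub_right hm' _) le_rfl) le_rfl, hr.tail ?_⟩
      refine ⟨n • (τ.2.2.2.2 : Multiset P), τ, hτ, m' - {τ.2.1}, ?_, fun x hx => ?_, rfl⟩
      · rw [h1, ← Multiset.singleton_add, add_tsub_cancel_of_le (Multiset.singleton_le.2 hmem')]
      · rw [Multiset.mem_nsmul] at hx; exact hx.2
    obtain ⟨d', hd', hI⟩ := exists_common_ideal f hf fun n => hL _ _ (hfU n)
    have hdm : (τ.2.2.1, d') ∈ M :=
      (hMmem _).2 ⟨List.mem_cons_of_mem _ (List.mem_map.2 ⟨τ, hτ, rfl⟩), hd'⟩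
    have hcf : ∀ n x, (f n).count x = (d.1.count x + (n + 1) * d.2.count x - [τ.2.1].count x) +
        τ.2.2.2.1.count x + n * τ.2.2.2.2.count x := fun n x => by
      simp only [f, inst, Multiset.count_add, Multiset.count_nsmul, Multiset.coe_count,
        Multiset.count_sub, ← Multiset.coe_singleton]
    have hc1 : ∀ x, [τ.2.1].count x ≤ 1 := fun x => by
      simpa using List.count_le_length (a := x) (l := [τ.2.1])
    have hok : EdgeOk ((g, d), τ, (τ.2.2.1, d')) := by
      have hom : ∀ x ∈ d.2 ++ τ.2.2.2.2, x ∈ d'.2 := by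
        intro x hx
        refine (hI (d'.1.count x + 1) x).resolve_right fun hle => ?_
        rw [hcf] at hle
        have := hc1 x
        rcases List.mem_append.1 hx with h | h
        · have : 1 ≤ d.2.count x := List.one_le_count_iff.2 h
          have : (d'.1.count x + 1 + 1) * 1 ≤ (d'.1.count x + 1 + 1) * d.2.count x := by gcongr
          omega
        · have : 1 ≤ τ.2.2.2.2.count x := List.one_le_count_iff.2 h
          have : (d'.1.count x + 1) * 1 ≤ (d'.1.count x + 1) * τ.2.2.2.2.count x := by gcongr
          omega
      refine ⟨rfl, hom, fun x _ => ?_⟩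
      rcases hI 0 x with h | h
      · exact Or.inl h
      · right
        rw [hcf] at h
        by_cases hx : x ∈ d.2
        · have := hom x (List.mem_append_left _ hx)
          rw [List.count_eq_zero_of_not_mem ((hL' g d hdL).1 x hx)]
          rw [Nat.zero_mul] at h
          simp only [ePost, ePl]
          omega
        · rw [List.count_eq_zero_of_not_mem hx] at h
          simp only [ePost, ePl]
          omega
    exact ⟨_, hdm, (hEd _).2 ⟨⟨hV, hτ, hdm⟩, h1, h2, hok⟩, hok⟩
  · intro S hS
    have hsub : ∀ e ∈ S, e ∈ Ed := fun e he => (mem_subs.1 hS).subset he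
    rcases eq_or_ne S [] with h0 | h0
    · exact Or.inl h0
    rcases exists_rank_or_circulation S with hr | ⟨hconn, M', hM1, hM2, hM3⟩
    · exact Or.inr hr
    · refine absurd (nLasso_of_circulation h0 (fun e he => ?_) (fun e he N => ?_)
        hconn hM1 hM2 hM3) h
      · have := (hEd e).1 (hsub e he)
        exact ⟨this.1.2.1, this.2⟩
      · have := (hMmem _).1 ((hEd e).1 (hsub e he)).1.1
        exact (hL' _ _ this.2).2 N
end Net

section Pushdown
variable {X S E : Type}

/-- Pushdown rules: state, top of stack, emitted letters, new state, pushed symbols. -/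
abbrev PRule (X S E : Type) := X × S × List E × X × List S

/-- Summaries: ideals of emissions, indexed by state, stack symbol and outcome (the state in which
the symbol is popped, or `none` for incomplete computations). -/
abbrev Summary (X S E : Type) := List ((X × S × Option X) × (List E × List E))

/-- Computations of a pushdown system together with the multiset of emitted letters. -/
inductive Pth (R : Set (PRule X S E)) : X → List S → Option X → Multiset E → Prop
  | halt (x w) : Pth R x w none 0
  | done (x) : Pth R x [] (some x) 0
  | rule {x a o x' w' w oy e} (hr : (x, a, o, x', w') ∈ R) (h : Pth R x' (w' ++ w) oy e) :
      Pth R x (a :: w) oy ((o : Multiset E) + e)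

theorem Pth.append {R : Set (PRule X S E)} {x y : X} {w w2 : List S} {oy : Option X}
    {e e2 : Multiset E} (h : Pth R x w (some y) e) (h2 : Pth R y w2 oy e2) :
    Pth R x (w ++ w2) oy (e + e2) := by
  generalize ho : some y = oz at h
  induction h with
  | halt => cases ho
  | done => cases ho; simpa using h2
  | rule hr h ih =>
    rw [add_assoc]
    refine Pth.rule hr ?_
    have := ih ho
    rw [List.append_assoc] at this
    exact this

theorem Pth.append_halt {R : Set (PRule X S E)} {x : X} {w : List S} (w2 : List S)
    {e : Multiset E} (h : Pth R x w none e) :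
    Pth R x (w ++ w2) none e := by
  generalize ho : none = oz at h
  induction h with
  | halt => exact .halt _ _
  | done => cases ho
  | rule hr h ih =>
    refine Pth.rule hr ?_
    have := ih ho
    rw [List.append_assoc] at this
    exact this

theorem Pth.weaken {R : Set (PRule X S E)} {x : X} {w : List S} {oy : Option X}
    {e : Multiset E} (h : Pth R x w oy e) : Pth R x w none e := by
  induction h with
  | halt => exact .halt _ _
  | done => exact .halt _ _
  | rule hr h ih => exact .rule hr ih

/-- Sum of ideals. -/
def iadd (d d' : List E × List E) : List E × List E := (d.1 ++ d'.1, d.2 ++ d'.2)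

theorem inst_iadd (d d' : List E × List E) (n : ℕ) : inst (iadd d d') n = inst d n + inst d' n := by
  simp only [inst, CBL.iadd, ← Multiset.coe_add, nsmul_add]
  abel

theorem inst_nil (o : List E) (n : ℕ) : inst (o, []) n = o := by simp [inst]

variable [DecidableEq E]

/-- Inclusion of ideals. -/
def Sub (d d' : List E × List E) : Prop :=
  (∀ x ∈ d.2, x ∈ d'.2) ∧ ∀ x ∈ d.1, x ∈ d'.2 ∨ d.1.count x ≤ d'.1.count x

theorem InI.sub {d d' : List E × List E} {m : Multiset E} (h : InI d m) (hs : Sub d d') :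
    InI d' m := fun x => by
  rcases h x with h | h
  · exact Or.inl (hs.1 x h)
  · by_cases hx : x ∈ d.1
    · exact (hs.2 x hx).imp_right fun h' => h.trans h'
    · rw [List.count_eq_zero_of_not_mem hx] at h
      exact Or.inr (h.trans (Nat.zero_le _))

theorem InI.iadd {d d' : List E × List E} {m m' : Multiset E} (h : InI d m) (h' : InI d' m') :
    InI (iadd d d') (m + m') := fun x => by
  simp only [CBL.iadd, List.mem_append, List.count_append, Multiset.count_add]
  rcases h x with h | h
  · exact Or.inl (Or.inl h)
  rcases h' x with h' | h'
  · exact Or.inl (Or.inr h')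
  · exact Or.inr (add_le_add h h')

theorem inI_nil (o : List E) : InI (o, []) (o : Multiset E) := by
  simpa [inst] using inI_inst (o, []) 0

theorem sub_of_inst {d d' : List E × List E} (h : ∀ n, InI d' (inst d n)) : Sub d d' := by
  refine ⟨fun x hx => (h (d'.1.count x + 1) x).resolve_right fun hle => ?_, fun x _ => ?_⟩
  · simp only [inst, Multiset.count_add, Multiset.coe_count, Multiset.count_nsmul] at hle
    have : 1 ≤ d.2.count x := List.one_le_count_iff.2 hx
    nlinarith
  · simpa [inst] using h 0 x

def Cover (D : Summary X S E) (t : X × S × Option X) (d : List E × List E) : Prop :=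
  ∃ z ∈ D, z.1 = t ∧ Sub d z.2

/-- Closure of a summary under a rule. -/
def RClosed (D : Summary X S E) (r : PRule X S E) : Prop :=
  Cover D (r.1, r.2.1, none) (r.2.2.1, []) ∧
  (r.2.2.2.2 ≠ [] ∨ Cover D (r.1, r.2.1, some r.2.2.2.1) (r.2.2.1, [])) ∧
  ∀ z ∈ D, z.1.1 ≠ r.2.2.2.1 ∨
    ((r.2.2.2.2 ≠ [z.1.2.1] ∨ Cover D (r.1, r.2.1, z.1.2.2) (iadd (r.2.2.1, []) z.2)) ∧
    (r.2.2.2.2.head? ≠ some z.1.2.1 ∨ Cover D (r.1, r.2.1, none) (iadd (r.2.2.1, []) z.2)) ∧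
    ∀ z' ∈ D, z.1.2.2 ≠ some z'.1.1 ∨ r.2.2.2.2 ≠ [z.1.2.1, z'.1.2.1] ∨
      Cover D (r.1, r.2.1, z'.1.2.2) (iadd (r.2.2.1, []) (iadd z.2 z'.2)))

def PopClosed (D : Summary X S E) : Prop :=
  ∀ z ∈ D, z.1.2.2 = none ∨ Cover D (z.1.1, z.1.2.1, none) z.2

def Has (D : Summary X S E) (t : X × S × Option X) (e : Multiset E) : Prop :=
  ∃ d, (t, d) ∈ D ∧ InI d e

theorem Cover.has {D : Summary X S E} {t : X × S × Option X} {d : List E × List E}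
    (h : Cover D t d) {e : Multiset E} (he : InI d e) : Has D t e := by
  obtain ⟨⟨t, d'⟩, hz, rfl, hs⟩ := h
  exact ⟨d', hz, he.sub hs⟩

/-- Computations described by a summary. -/
def Cov (D : Summary X S E) : X → List S → Option X → Multiset E → Prop
  | x, [], oy, e => (oy = none ∨ oy = some x) ∧ e = 0
  | x, a :: w, oy, e => (oy = none ∧ (e = 0 ∨ Has D (x, a, none) e)) ∨
      ∃ y e1 e2, Has D (x, a, some y) e1 ∧ Cov D y w oy e2 ∧ e = e1 + e2

theorem Cov.rule {D : Summary X S E} {x : X} {a : S} {o : List E} {x' : X} {w' w : List S}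
    {oy : Option X} {e : Multiset E} (hw : w'.length ≤ 2) (hD : RClosed D (x, a, o, x', w'))
    (h : Cov D x' (w' ++ w) oy e) : Cov D x (a :: w) oy ((o : Multiset E) + e) := by
  obtain ⟨h0, h1, h2⟩ := hD
  match w', hw with
  | [], _ =>
    right
    exact ⟨x', o, e, (h1.resolve_left (by simp)).has (inI_nil o), h, rfl⟩
  | [b], _ =>
    rcases h with ⟨rfl, rfl | ⟨d, hd, hI⟩⟩ | ⟨y, e1, e2, ⟨d, hd, hI⟩, h, rfl⟩
    · left
      exact ⟨rfl, Or.inr (h0.has (by simpa using inI_nil o))⟩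
    · left
      have := ((h2 _ hd).resolve_left (by simp)).1.resolve_left (by simp)
      exact ⟨rfl, Or.inr (this.has ((inI_nil o).iadd hI))⟩
    · right
      have := ((h2 _ hd).resolve_left (by simp)).1.resolve_left (by simp)
      exact ⟨y, o + e1, e2, this.has ((inI_nil o).iadd hI), h, (add_assoc _ _ _).symm⟩
  | [b, b'], _ =>
    rcases h with ⟨rfl, rfl | ⟨d, hd, hI⟩⟩ | ⟨y, e1, e2, ⟨d, hd, hI⟩, h, rfl⟩
    · left
      exact ⟨rfl, Or.inr (h0.has (by simpa using inI_nil o))⟩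
    · left
      have := ((h2 _ hd).resolve_left (by simp)).2.1.resolve_left (by simp)
      exact ⟨rfl, Or.inr (this.has ((inI_nil o).iadd hI))⟩
    · rcases h with ⟨rfl, h⟩ | ⟨y', e3, e4, ⟨d', hd', hI'⟩, h, rfl⟩
      · left
        have := ((h2 _ hd).resolve_left (by simp)).2.1.resolve_left (by simp)
        refine ⟨rfl, Or.inr ?_⟩
        rcases h with rfl | ⟨d', hd', hI'⟩
        · rw [add_zero]
          exact this.has ((inI_nil o).iadd hI)
        · have := ((((h2 _ hd).resolve_left (by simp)).2.2 _ hd').resolve_left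
            (by simp)).resolve_left (by simp)
          exact this.has ((inI_nil o).iadd (hI.iadd hI'))
      · right
        have := ((((h2 _ hd).resolve_left (by simp)).2.2 _ hd').resolve_left (by simp)).resolve_left
          (by simp)
        exact ⟨y', o + (e1 + e3), e4, this.has ((inI_nil o).iadd (hI.iadd hI')), h, by
          simp only [add_assoc]⟩

/-- Closed summaries describe all computations. -/
theorem Pth.cov {D : Summary X S E} {R : Set (PRule X S E)} (hR : ∀ r ∈ R, RClosed D r)
    (hl : ∀ r ∈ R, r.2.2.2.2.length ≤ 2) {x : X} {w : List S} {oy : Option X} {e : Multiset E}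
    (h : Pth R x w oy e) : Cov D x w oy e := by
  induction h with
  | halt x w => cases w with
    | nil => exact ⟨Or.inl rfl, rfl⟩
    | cons a w => exact Or.inl ⟨rfl, Or.inl rfl⟩
  | done x => exact ⟨Or.inr rfl, rfl⟩
  | rule hr h ih => exact Cov.rule (hl _ hr) (hR _ hr) ih

theorem Pth.has {D : Summary X S E} {R : Set (PRule X S E)} (hR : ∀ r ∈ R, RClosed D r)
    (hl : ∀ r ∈ R, r.2.2.2.2.length ≤ 2) (hp : PopClosed D) {x : X} {a : S} {e : Multiset E}
    (h : Pth R x [a] none e) : e = 0 ∨ Has D (x, a, none) e := by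
  rcases h.cov hR hl with ⟨-, h⟩ | ⟨y, e1, e2, ⟨d, hd, hI⟩, ⟨-, rfl⟩, rfl⟩
  · exact h
  · rw [add_zero]
    exact Or.inr (((hp _ hd).resolve_left (by simp)).has hI)

/-- Every finite pushdown system has a closed summary all of whose ideals consist of emissions. -/
theorem exists_summary (R : Set (PRule X S E)) (hR : R.Finite) :
    ∃ D : Summary X S E, (∀ r ∈ R, RClosed D r) ∧ PopClosed D ∧
      ∀ z ∈ D, ∀ n, ∃ e, inst z.2 n ≤ e ∧ Pth R z.1.1 [z.1.2.1] z.1.2.2 e := by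
  classical
  let F : Finset E := hR.toFinset.biUnion fun r => r.2.2.1.toFinset
  have hF : ∀ x w oy e, Pth R x w oy e → ∀ l ∈ e, l ∈ F := by
    intro x w oy e h
    induction h with
    | halt => simp
    | done => simp
    | rule hr h ih =>
      intro l hl
      rcases Multiset.mem_add.1 hl with hl | hl
      · exact Finset.mem_biUnion.2 ⟨_, hR.mem_toFinset.2 hr, by simpa using hl⟩
      · exact ih l hl
  let U : X × S × Option X → Set (Multiset E) := fun t =>
    {m | ∃ e, m ≤ e ∧ Pth R t.1 [t.2.1] t.2.2 e}
  have hU : ∀ t, DownIn F (U t) := fun t =>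
    ⟨fun m ⟨e, hm, hr⟩ x hx => hF _ _ _ _ hr x (Multiset.mem_of_le hm hx),
      fun m ⟨e, hm, hr⟩ m2 h2 => ⟨e, h2.trans hm, hr⟩⟩
  choose L hL hL' using fun t => exists_ideal_decomposition F (U t) (hU t)
  let rs := hR.toFinset.toList
  have hrs : ∀ r, r ∈ rs ↔ r ∈ R := fun r => by simp [rs]
  let tg : List (X × S × Option X) := rs.flatMap fun r =>
    (r.1, r.2.1, none) :: rs.map fun r' => (r.1, r.2.1, some r'.2.2.2.1)
  let D : Summary X S E := tg.flatMap fun t => (L t).map fun d => (t, d)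
  have hD : ∀ z, z ∈ D ↔ z.1 ∈ tg ∧ z.2 ∈ L z.1 := by
    rintro ⟨t, d⟩
    simp only [D, List.mem_flatMap, List.mem_map]
    constructor
    · rintro ⟨t', ht, d', hd, he⟩; cases he; exact ⟨ht, hd⟩
    · rintro ⟨ht, hd⟩; exact ⟨t, ht, d, hd, rfl⟩
  have htg : ∀ x a oy, (x, a, oy) ∈ tg ↔ ∃ r ∈ R, r.1 = x ∧ r.2.1 = a ∧
      (oy = none ∨ ∃ r' ∈ R, oy = some r'.2.2.2.1) := by
    intro x a oy
    simp only [tg, List.mem_flatMap, List.mem_cons, List.mem_map, hrs, Prod.mk.injEq]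
    constructor
    · rintro ⟨r, hr, ⟨rfl, rfl, rfl⟩ | ⟨r', hr', rfl, rfl, rfl⟩⟩
      · exact ⟨r, hr, rfl, rfl, Or.inl rfl⟩
      · exact ⟨r, hr, rfl, rfl, Or.inr ⟨r', hr', rfl⟩⟩
    · rintro ⟨r, hr, rfl, rfl, rfl | ⟨r', hr', rfl⟩⟩
      · exact ⟨r, hr, Or.inl ⟨rfl, rfl, rfl⟩⟩
      · exact ⟨r, hr, Or.inr ⟨r', hr', rfl, rfl, rfl⟩⟩
  have hz : ∀ z ∈ D, ∀ n, ∃ e, inst z.2 n ≤ e ∧ Pth R z.1.1 [z.1.2.1] z.1.2.2 e :=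
    fun z hzD n => (hL' _ _ ((hD z).1 hzD).2).2 n
  have hcov : ∀ t ∈ tg, ∀ d, (∀ n, inst d n ∈ U t) → Cover D t d := by
    intro t ht d hd
    obtain ⟨d', hd', h⟩ := exists_common_ideal (inst d) (inst_mono d) fun n => hL t _ (hd n)
    exact ⟨(t, d'), (hD _).2 ⟨ht, hd'⟩, rfl, sub_of_inst h⟩
  refine ⟨D, fun r hr => ⟨?_, ?_, fun z hzD => ?_⟩, fun z hzD => ?_, hz⟩
  · refine hcov _ ((htg _ _ _).2 ⟨r, hr, rfl, rfl, Or.inl rfl⟩) _ fun n => ?_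
    rw [inst_nil]
    exact ⟨_, le_of_eq (add_zero _).symm, .rule (w := []) hr (.halt _ _)⟩
  · by_cases h : r.2.2.2.2 = []
    swap
    · exact Or.inl h
    right
    refine hcov _ ((htg _ _ _).2 ⟨r, hr, rfl, rfl, Or.inr ⟨r, hr, rfl⟩⟩) _ fun n => ?_
    rw [inst_nil]
    refine ⟨_, le_of_eq (add_zero _).symm, .rule (w := []) hr ?_⟩
    rw [h]; exact .done _
  · by_cases h1 : z.1.1 = r.2.2.2.1
    swap
    · exact Or.inl h1
    right
    have hzt := (htg _ _ _).1 ((hD z).1 hzD).1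
    obtain ⟨r0, -, -, -, hzo⟩ := hzt
    refine ⟨?_, ?_, fun z' hz' => ?_⟩
    · by_cases h2 : r.2.2.2.2 = [z.1.2.1]
      swap
      · exact Or.inl h2
      right
      refine hcov _ ((htg _ _ _).2 ⟨r, hr, rfl, rfl, hzo⟩) _ fun n => ?_
      obtain ⟨e, he, hp⟩ := hz z hzD n
      rw [inst_iadd, inst_nil]
      refine ⟨_, add_le_add le_rfl he, .rule (w := []) hr ?_⟩
      rw [← h1, h2]; exact hp
    · by_cases h2 : r.2.2.2.2.head? = some z.1.2.1
      swap
      · exact Or.inl h2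
      right
      refine hcov _ ((htg _ _ _).2 ⟨r, hr, rfl, rfl, Or.inl rfl⟩) _ fun n => ?_
      obtain ⟨e, he, hp⟩ := hz z hzD n
      rw [inst_iadd, inst_nil]
      refine ⟨_, add_le_add le_rfl he, .rule (w := []) hr ?_⟩
      obtain ⟨w, hw⟩ := List.head?_eq_some_iff.1 h2
      rw [← h1, hw, List.append_nil]
      exact hp.weaken.append_halt w
    · by_cases h2 : z.1.2.2 = some z'.1.1
      swap
      · exact Or.inl h2
      by_cases h3 : r.2.2.2.2 = [z.1.2.1, z'.1.2.1]
      swap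
      · exact Or.inr (Or.inl h3)
      right; right
      obtain ⟨r1, -, -, -, hzo'⟩ := (htg _ _ _).1 ((hD z').1 hz').1
      refine hcov _ ((htg _ _ _).2 ⟨r, hr, rfl, rfl, hzo'⟩) _ fun n => ?_
      obtain ⟨e, he, hp⟩ := hz z hzD n
      obtain ⟨e', he', hp'⟩ := hz z' hz' n
      rw [inst_iadd, inst_iadd, inst_nil]
      refine ⟨_, add_le_add le_rfl (add_le_add he he'), .rule (w := []) hr ?_⟩
      rw [← h1, h3]
      rw [h2] at hp
      exact hp.append hp'
  · right
    obtain ⟨r0, h0, h1, h2, -⟩ := (htg _ _ _).1 ((hD z).1 hzD).1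
    refine hcov _ ((htg _ _ _).2 ⟨r0, h0, h1, h2, Or.inl rfl⟩) _ fun n => ?_
    obtain ⟨e, he, hp⟩ := hz z hzD n
    exact ⟨e, he, hp.weaken⟩

end Pushdown

section Threads

/-- Lists describing a DCPS. -/
abbrev Code : Type := List ℕ × List ℕ × List (ℕ × ℕ × ℕ × List ℕ × Option ℕ) ×
  List (ℕ × ℕ × ℕ × List ℕ) × List (ℕ × ℕ × ℕ) × List (ℕ × ℕ) × ℕ × ℕ

abbrev cCre (c : Code) : List (ℕ × ℕ × ℕ × List ℕ × Option ℕ) := c.2.2.1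
abbrev cInt (c : Code) : List (ℕ × ℕ × ℕ × List ℕ) := c.2.2.2.1
abbrev cRes (c : Code) : List (ℕ × ℕ × ℕ) := c.2.2.2.2.1
abbrev cTer (c : Code) : List (ℕ × ℕ) := c.2.2.2.2.2.1
abbrev cG0 (c : Code) : ℕ := c.2.2.2.2.2.2.1
abbrev cGam0 (c : Code) : ℕ := c.2.2.2.2.2.2.2

/-- Sequences of thread steps, with their length and the list of spawned stack symbols. -/
inductive TRun (c : Code) : ℕ → ℕ → List ℕ → List ℕ → ℕ → List ℕ → Prop
  | refl (g w) : TRun c 0 g w [] g w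
  | step {d g a g1 w' sp w v g2 w2} (hr : (g, a, g1, w', sp) ∈ cCre c)
      (h : TRun c d g1 (w' ++ w) v g2 w2) : TRun c (d + 1) g (a :: w) (sp.toList ++ v) g2 w2

/-- The end of the execution of a thread, by interruption or termination. -/
def TEnd (c : Code) (g : ℕ) (w : List ℕ) (k g1 : ℕ) (o : Option Loc) : Prop :=
  (∃ a w' w0, (g, a, g1, w') ∈ cInt c ∧ w = a :: w0 ∧ o = some (w' ++ w0, k + 1)) ∨
  (w = [] ∧ (g, g1) ∈ cTer c ∧ o = none)

def TSeg (c : Code) (d g : ℕ) (w : List ℕ) (k : ℕ) (v : List ℕ) (g1 : ℕ) (o : Option Loc) :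
    Prop :=
  ∃ g2 w2, TRun c d g w v g2 w2 ∧ TEnd c g2 w2 k g1 o

/-- The execution of a thread between two schedule points. -/
def Seg (c : Code) (h : ℕ) (loc : Loc) (v : List ℕ) (g1 : ℕ) (o : Option Loc) : Prop :=
  ∃ a w g' d, loc.1 = a :: w ∧ (h, g', a) ∈ cRes c ∧ TSeg c (d + 1) g' loc.1 loc.2 v g1 o

abbrev PX : Type := ℕ × ℕ × ℕ
abbrev PS : Type := Option ℕ
abbrev PE : Type := ℕ × ℕ × ℕ

abbrev xStart : PX := (0, 0, 0)
abbrev xSusp (k : ℕ) : PX := (1, 0, k)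
abbrev xJust (g k : ℕ) : PX := (2, g, k)
abbrev xAct (g k : ℕ) : PX := (3, g, k)
abbrev xDead : PX := (4, 0, 0)
abbrev evIn (k h : ℕ) : PE := (0, k, h)
abbrev evOut (k g : ℕ) : PE := (1, k, g)
abbrev evSp (k s : ℕ) : PE := (2, k, s)

def encS (w : List ℕ) : List PS := w.map some ++ [none]

abbrev rStart (q : ℕ × ℕ × ℕ) : PRule PX PS PE :=
  (xStart, some q.2.2, [], xSusp 0, [some q.2.2, none])
abbrev rRes (k : ℕ) (q : ℕ × ℕ × ℕ) : PRule PX PS PE :=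
  (xSusp k, some q.2.2, [evIn k q.1], xJust q.2.1 k, [some q.2.2])
abbrev rCre0 (k : ℕ) (q : ℕ × ℕ × ℕ × List ℕ × Option ℕ) : PRule PX PS PE :=
  (xJust q.1 k, some q.2.1, q.2.2.2.2.toList.map (evSp k), xAct q.2.2.1 k, q.2.2.2.1.map some)
abbrev rCre1 (k : ℕ) (q : ℕ × ℕ × ℕ × List ℕ × Option ℕ) : PRule PX PS PE :=
  (xAct q.1 k, some q.2.1, q.2.2.2.2.toList.map (evSp k), xAct q.2.2.1 k, q.2.2.2.1.map some)
abbrev rInt (k : ℕ) (q : ℕ × ℕ × ℕ × List ℕ) : PRule PX PS PE :=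
  (xAct q.1 k, some q.2.1, [evOut k q.2.2.1], xSusp (k + 1), q.2.2.2.map some)
abbrev rTer (k : ℕ) (q : ℕ × ℕ) : PRule PX PS PE :=
  (xAct q.1 k, none, [evOut k q.2], xDead, [])

/-- The rules of the pushdown system that emits the interface behaviour of a single thread. -/
def ruleList (K : ℕ) (c : Code) : List (PRule PX PS PE) :=
  (cRes c).map rStart ++ (List.range (K + 1)).flatMap fun k =>
    (cRes c).map (rRes k) ++ (cCre c).map (rCre0 k) ++ (cCre c).map (rCre1 k) ++
      (cInt c).map (rInt k) ++ (cTer c).map (rTer k)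

theorem forall_ruleList {K : ℕ} {c : Code} {p : PRule PX PS PE → Prop} :
    (∀ r ∈ ruleList K c, p r) ↔ (∀ q ∈ cRes c, p (rStart q)) ∧ ∀ k ∈ List.range (K + 1),
      (∀ q ∈ cRes c, p (rRes k q)) ∧ (∀ q ∈ cCre c, p (rCre0 k q)) ∧
      (∀ q ∈ cCre c, p (rCre1 k q)) ∧ (∀ q ∈ cInt c, p (rInt k q)) ∧
      ∀ q ∈ cTer c, p (rTer k q) := by
  simp only [ruleList, List.forall_mem_append, List.forall_mem_map, List.mem_flatMap,
    forall_exists_index, and_imp]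
  refine and_congr_right fun _ => ⟨fun h k hk => ?_, fun h r k hk hr => ?_⟩
  · have h' := fun r => h r k hk
    simp only [List.forall_mem_append, List.forall_mem_map] at h'
    simpa only [and_assoc] using h'
  · have h' := h k hk
    have h2 : ∀ r ∈ (cRes c).map (rRes k) ++ (cCre c).map (rCre0 k) ++ (cCre c).map (rCre1 k) ++
      (cInt c).map (rInt k) ++ (cTer c).map (rTer k), p r := by
      simp only [List.forall_mem_append, List.forall_mem_map]
      simpa only [and_assoc] using h'
    exact h2 r hr

/-- The rules of `ruleList` as a set. -/
abbrev rules (K : ℕ) (c : Code) : Set (PRule PX PS PE) := {r | r ∈ ruleList K c}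

theorem mem_rules {K : ℕ} {c : Code} :
    (∀ q ∈ cRes c, rStart q ∈ rules K c) ∧ ∀ k ≤ K,
      (∀ q ∈ cRes c, rRes k q ∈ rules K c) ∧ (∀ q ∈ cCre c, rCre0 k q ∈ rules K c) ∧
      (∀ q ∈ cCre c, rCre1 k q ∈ rules K c) ∧ (∀ q ∈ cInt c, rInt k q ∈ rules K c) ∧
      ∀ q ∈ cTer c, rTer k q ∈ rules K c := by
  have := (forall_ruleList (K := K) (c := c) (p := fun r => r ∈ rules K c)).1 fun r h => h
  simpa [Nat.lt_succ_iff] using this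

theorem Pth.idx_le {K : ℕ} {c : Code} {x : PX} {st : List PS} {oy : Option PX} {e : Multiset PE}
    (h : Pth (rules K c) x st oy e) : ∀ ev ∈ e, ev.2.1 ≤ K := by
  have hr : ∀ r ∈ ruleList K c, ∀ ev ∈ r.2.2.1, ev.2.1 ≤ K := by
    rw [forall_ruleList]
    refine ⟨by simp, fun k hk => ?_⟩
    rw [List.mem_range, Nat.lt_succ_iff] at hk
    simp [hk]
  induction h with
  | halt => simp
  | done => simp
  | rule hr' h ih =>
    intro ev hev
    rcases Multiset.mem_add.1 hev with h | h
    · exact hr _ hr' ev (by simpa using h)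
    · exact ih ev h

/-- The thread configurations `t` account for the events in `e` from round `i0` on. -/
def Chain (c : Code) (t : ℕ → Option Loc) (e : Multiset PE) (i0 : ℕ) : Prop :=
  ∀ i h g1, i0 ≤ i → evIn i h ∈ e → evOut i g1 ∈ e → ∃ w v, t i = some (w, i) ∧
    Seg c h (w, i) v g1 (t (i + 1)) ∧ ∀ s, e.count (evSp i s) ≤ v.count s

def ActOk (c : Code) (m g k : ℕ) (w : List ℕ) (e : Multiset PE) : Prop :=
  (∀ ev ∈ e, k ≤ ev.2.1) ∧ (∀ h, evIn k h ∉ e) ∧ ∃ t, Chain c t e (k + 1) ∧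
    ∀ g1, evOut k g1 ∈ e → ∃ v d, TSeg c (d + m) g w k v g1 (t (k + 1)) ∧
      ∀ s, e.count (evSp k s) ≤ v.count s

def SuspOk (c : Code) (j : ℕ) (w : List ℕ) (e : Multiset PE) : Prop :=
  (∀ ev ∈ e, j ≤ ev.2.1) ∧ ∃ t, t j = some (w, j) ∧ Chain c t e j

theorem actOk_zero (c : Code) (m g k : ℕ) (w : List ℕ) : ActOk c m g k w 0 :=
  ⟨by simp, by simp, fun _ => none, fun _ _ _ _ h => by simp at h, fun _ h => by simp at h⟩

theorem ActOk.mono {c : Code} {g k : ℕ} {w : List ℕ} {e : Multiset PE} (h : ActOk c 1 g k w e) :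
    ActOk c 0 g k w e := by
  obtain ⟨h1, h2, t, h3, h4⟩ := h
  refine ⟨h1, h2, t, h3, fun g1 hg => ?_⟩
  obtain ⟨v, d, h5, h6⟩ := h4 g1 hg
  exact ⟨v, d + 1, h5, h6⟩

theorem ActOk.cre {c : Code} {g a g' k : ℕ} {w w' : List ℕ} {sp : Option ℕ} {e : Multiset PE}
    (hr : (g, a, g', w', sp) ∈ cCre c) (h : ActOk c 0 g' k (w' ++ w) e) :
    ActOk c 1 g k (a :: w) ((sp.toList.map (evSp k) : List PE) + e) := by
  obtain ⟨h1, h2, t, h3, h4⟩ := h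
  have hm : ∀ ev, ev ∈ (sp.toList.map (evSp k) : List PE) → ∃ s, ev = evSp k s := fun ev h => by
    obtain ⟨s, -, rfl⟩ := List.mem_map.1 h; exact ⟨s, rfl⟩
  have hmem : ∀ ev, (∀ s, ev ≠ evSp k s) →
      ev ∈ ((sp.toList.map (evSp k) : List PE) + e : Multiset PE) → ev ∈ e := fun ev hne h => by
    rcases Multiset.mem_add.1 h with h | h
    · obtain ⟨s, rfl⟩ := hm ev h; exact absurd rfl (hne s)
    · exact h
  refine ⟨fun ev hev => ?_, fun h hh => h2 h (hmem _ (by simp) hh), t, ?_, ?_⟩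
  · rcases Multiset.mem_add.1 hev with h | h
    · obtain ⟨s, rfl⟩ := hm ev h; exact le_rfl
    · exact h1 ev h
  · intro i h g1 hi hin hout
    obtain ⟨w, v, e1, e2, e3⟩ := h3 i h g1 hi (hmem _ (by simp) hin) (hmem _ (by simp) hout)
    refine ⟨w, v, e1, e2, fun s => ?_⟩
    rw [Multiset.count_add, Multiset.count_eq_zero_of_notMem, zero_add]
    · exact e3 s
    · intro h
      obtain ⟨s', h⟩ := hm _ h
      have := congrArg (fun e => e.2.1) h
      simp only at this
      omega
  · intro g1 hg
    obtain ⟨v, d, ⟨g2, w2, h5, h5'⟩, h6⟩ := h4 g1 (hmem _ (by simp) hg)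
    refine ⟨sp.toList ++ v, d, ⟨g2, w2, .step hr h5, h5'⟩, fun s => ?_⟩
    rw [Multiset.count_add, List.count_append, ← Multiset.map_coe]
    refine add_le_add (le_of_eq ?_) (h6 s)
    exact (Multiset.count_map_eq_count' (evSp k) (sp.toList : Multiset ℕ)
      (fun a b h => by simpa using h) s).trans (Multiset.coe_count _ _)

theorem ActOk.of_end {c : Code} {g k g1 : ℕ} {w : List ℕ} {e : Multiset PE}
    {t : ℕ → Option Loc} (h1 : ∀ ev ∈ e, k + 1 ≤ ev.2.1) (h2 : Chain c t e (k + 1))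
    (h3 : TEnd c g w k g1 (t (k + 1))) : ActOk c 0 g k w (([evOut k g1] : List PE) + e) := by
  have hlt : ∀ ev : PE, ev.2.1 = k → ev ∉ e := fun ev hk hev => by
    have := h1 ev hev
    omega
  have hmem : ∀ ev ∈ ((([evOut k g1] : List PE) : Multiset PE) + e), ev = evOut k g1 ∨ ev ∈ e :=
    fun ev hev => by simpa using hev
  have hcount : ∀ i s, Multiset.count (evSp i s) ((([evOut k g1] : List PE) : Multiset PE) + e)
      = e.count (evSp i s) := fun i s => by
    rw [Multiset.count_add, Multiset.count_eq_zero_of_notMem (by simp), zero_add]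
  refine ⟨fun ev hev => ?_, fun h hin => ?_, t, ?_, fun g' hg => ?_⟩
  · rcases hmem ev hev with rfl | h
    · exact le_rfl
    · exact (Nat.le_succ k).trans (h1 ev h)
  · rcases hmem _ hin with h | h
    · simp at h
    · exact hlt _ rfl h
  · intro i h g' hi hin hout
    simp only [hcount]
    refine h2 i h g' hi ((hmem _ hin).resolve_left (by simp)) ((hmem _ hout).resolve_left ?_)
    intro h
    have := congrArg (fun e => e.2.1) h
    simp only at this
    omega
  · obtain rfl : g' = g1 := by simpa using (hmem _ hg).resolve_right (hlt _ rfl)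
    exact ⟨[], 0, ⟨g, w, .refl _ _, h3⟩, fun s => by
      rw [hcount, Multiset.count_eq_zero_of_notMem (hlt _ rfl)]; simp⟩

theorem encS_cons {a : PS} {st : List PS} {w : List ℕ} (h : a :: st = encS w) :
    (a = none ∧ st = [] ∧ w = []) ∨ ∃ b w0, a = some b ∧ w = b :: w0 ∧ st = encS w0 := by
  cases w with
  | nil => simp only [encS, List.map_nil, List.nil_append, List.cons.injEq] at h; simp [h]
  | cons b w0 =>
    simp only [encS, List.map_cons, List.cons_append, List.cons.injEq] at h
    exact Or.inr ⟨b, w0, h.1, rfl, h.2⟩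

theorem encS_append (w' w : List ℕ) : w'.map some ++ encS w = encS (w' ++ w) := by
  simp [encS]

/-- What a computation of the emitting pushdown system says about its thread. -/
def PthOk (c : Code) (x : PX) (st : List PS) (e : Multiset PE) : Prop :=
  (∀ j w, x = xSusp j → st = encS w → SuspOk c j w e) ∧
  (∀ g k w, x = xJust g k → st = encS w → ActOk c 1 g k w e) ∧
  (∀ g k w, x = xAct g k → st = encS w → ActOk c 0 g k w e) ∧
  (x = xDead → e = 0)

theorem Pth.ok {K : ℕ} {c : Code} {x : PX} {st : List PS} {oy : Option PX} {e : Multiset PE}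
    (h : Pth (rules K c) x st oy e) : PthOk c x st e := by
  have hz : ∀ x st, PthOk c x st 0 := fun x st =>
    ⟨fun j w _ _ => ⟨by simp, fun _ => some (w, j), rfl, fun _ _ _ _ h => by simp at h⟩,
      fun _ _ _ _ _ => actOk_zero _ _ _ _ _, fun _ _ _ _ _ => actOk_zero _ _ _ _ _, fun _ => rfl⟩
  induction h with
  | halt => exact hz _ _
  | done => exact hz _ _
  | @rule x a o x' w' st oy e hr h ih =>
    suffices h : ∀ r ∈ ruleList K c, ∀ st e, PthOk c r.2.2.2.1 (r.2.2.2.2 ++ st) e →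
        PthOk c r.1 (r.2.1 :: st) ((r.2.2.1 : Multiset PE) + e) from h _ hr st e ih
    rw [forall_ruleList]
    refine ⟨fun q hq st e ih => ⟨?_, ?_, ?_, ?_⟩, fun k hk => ⟨fun q hq st e ih => ⟨?_, ?_, ?_, ?_⟩,
      fun q hq st e ih => ⟨?_, ?_, ?_, ?_⟩, fun q hq st e ih => ⟨?_, ?_, ?_, ?_⟩,
      fun q hq st e ih => ⟨?_, ?_, ?_, ?_⟩, fun q hq st e ih => ⟨?_, ?_, ?_, ?_⟩⟩⟩
    all_goals try (intro h; simp at h)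
    all_goals try (intro _ _ h; simp at h; done)
    all_goals try (intro _ _ _ h; simp at h; done)
    · intro j w hx hst
      obtain rfl : k = j := by simpa using hx
      obtain ⟨h0, -⟩ | ⟨b, w0, hb, rfl, rfl⟩ := encS_cons hst
      · simp at h0
      obtain rfl : q.2.2 = b := by simpa using hb
      obtain ⟨h1, h2, t, h3, h4⟩ := ih.2.1 _ _ (q.2.2 :: w0) rfl rfl
      refine ⟨fun ev hev => ?_, Function.update t k (some (q.2.2 :: w0, k)), by simp, ?_⟩
      · rcases Multiset.mem_add.1 hev with h | h
        · obtain rfl : ev = evIn k q.1 := by simpa using h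
          exact le_rfl
        · exact h1 ev h
      · intro i h g1 hi hin hout
        have hout : evOut i g1 ∈ e := by simpa using hout
        have hcount : ∀ s, Multiset.count (evSp i s) ((([evIn k q.1] : List PE) : Multiset PE) + e)
            = e.count (evSp i s) := fun s => by
          rw [Multiset.count_add, Multiset.count_eq_zero_of_notMem (by simp), zero_add]
        simp only [hcount]
        rw [Function.update_of_ne (show i + 1 ≠ k by omega)]
        rcases hi.eq_or_lt with rfl | hi
        · have hh : h = q.1 := by
            rcases Multiset.mem_add.1 hin with h' | h'
            · simpa using h'
            · exact absurd h' (h2 h)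
          obtain ⟨v, d, h5, h6⟩ := h4 g1 hout
          exact ⟨_, v, by simp, ⟨q.2.2, w0, q.2.1, d, rfl, hh ▸ hq, h5⟩, h6⟩
        · have hin : evIn i h ∈ e := by
            rcases Multiset.mem_add.1 hin with h' | h'
            · have := congrArg (fun e => e.2.1) (show evIn i h = evIn k q.1 by simpa using h')
              simp only at this
              omega
            · exact h'
          rw [Function.update_of_ne (show i ≠ k by omega)]
          exact h3 i h g1 hi hin hout
    · intro g k' w hx hst
      obtain ⟨rfl, rfl⟩ : q.1 = g ∧ k = k' := by simpa using hx
      obtain ⟨h0, -⟩ | ⟨b, w0, hb, rfl, rfl⟩ := encS_cons hst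
      · simp at h0
      obtain rfl : q.2.1 = b := by simpa using hb
      exact (ih.2.2.1 _ _ (q.2.2.2.1 ++ w0) rfl (encS_append _ _)).cre hq
    · intro g k' w hx hst
      obtain ⟨rfl, rfl⟩ : q.1 = g ∧ k = k' := by simpa using hx
      obtain ⟨h0, -⟩ | ⟨b, w0, hb, rfl, rfl⟩ := encS_cons hst
      · simp at h0
      obtain rfl : q.2.1 = b := by simpa using hb
      exact ((ih.2.2.1 _ _ (q.2.2.2.1 ++ w0) rfl (encS_append _ _)).cre hq).mono
    · intro g k' w hx hst
      obtain ⟨rfl, rfl⟩ : q.1 = g ∧ k = k' := by simpa using hx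
      obtain ⟨h0, -⟩ | ⟨b, w0, hb, rfl, rfl⟩ := encS_cons hst
      · simp at h0
      obtain rfl : q.2.1 = b := by simpa using hb
      obtain ⟨h1, t, h2, h3⟩ := ih.1 (k + 1) (q.2.2.2 ++ w0) rfl (encS_append _ _)
      refine ActOk.of_end (t := t) (fun ev hev => h1 ev hev) h3 ?_
      exact Or.inl ⟨_, _, _, hq, rfl, h2⟩
    · intro g k' w hx hst
      obtain ⟨rfl, rfl⟩ : q.1 = g ∧ k = k' := by simpa using hx
      obtain ⟨-, rfl, rfl⟩ | ⟨b, w0, hb, rfl, rfl⟩ := encS_cons hst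
      · obtain rfl : e = 0 := ih.2.2.2 rfl
        exact ActOk.of_end (t := fun _ => none) (by simp) (fun _ _ _ _ h => by simp at h)
          (Or.inr ⟨rfl, hq, rfl⟩)
      · simp at hb
end Threads

section Embedding
variable {K : ℕ} {c : Code}

theorem TRun.pth {d g k : ℕ} {w v : List ℕ} {g2 : ℕ} {w2 : List ℕ} {e : Multiset PE}
    (hk : k ≤ K) (h : TRun c d g w v g2 w2)
    (hp : Pth (rules K c) (xAct g2 k) (encS w2) none e) :
    Pth (rules K c) (xAct g k) (encS w) none ((v.map (evSp k) : List PE) + e) := by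
  induction h with
  | refl => simpa using hp
  | @step d g a g1 w' sp w v g2 w2 hr h ih =>
    have := Pth.rule ((mem_rules.2 k hk).2.2.1 _ hr) (w := encS w)
      (by rw [encS_append]; exact ih hp)
    simpa [encS, ← add_assoc] using this

theorem TRun.pth_succ {d g k : ℕ} {w v : List ℕ} {g2 : ℕ} {w2 : List ℕ} {e : Multiset PE}
    (hk : k ≤ K) (h : TRun c (d + 1) g w v g2 w2)
    (hp : Pth (rules K c) (xAct g2 k) (encS w2) none e) :
    Pth (rules K c) (xJust g k) (encS w) none ((v.map (evSp k) : List PE) + e) := by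
  cases h with
  | @step _ _ a g1 w' sp w v _ _ hr h =>
    have := Pth.rule ((mem_rules.2 k hk).2.1 _ hr) (w := encS w)
      (by rw [encS_append]; exact h.pth hk hp)
    simpa [encS, ← add_assoc] using this

/-- `e` can be emitted by the thread that `o` describes. -/
def Emits (K : ℕ) (c : Code) (o : Option Loc) (e : Multiset PE) : Prop :=
  o.elim (e = 0) fun loc => Pth (rules K c) (xSusp loc.2) (encS loc.1) none e

theorem emits_zero (o : Option Loc) : Emits K c o 0 := by
  cases o with
  | none => rfl
  | some loc => exact Pth.halt _ _

theorem TEnd.pth {g k g1 : ℕ} {w : List ℕ} {o : Option Loc} {e : Multiset PE} (hk : k ≤ K)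
    (h : TEnd c g w k g1 o) (he : Emits K c o e) :
    Pth (rules K c) (xAct g k) (encS w) none (([evOut k g1] : List PE) + e) := by
  obtain ⟨a, w', w0, hr, rfl, rfl⟩ | ⟨rfl, hr, rfl⟩ := h
  · exact Pth.rule ((mem_rules.2 k hk).2.2.2.1 _ hr) (w := encS w0)
      (by rw [encS_append]; exact he)
  · obtain rfl : e = 0 := he
    exact Pth.rule ((mem_rules.2 k hk).2.2.2.2 _ hr) (w := []) (Pth.halt _ _)

theorem Seg.emits {h g1 : ℕ} {loc : Loc} {v : List ℕ} {o : Option Loc} {e : Multiset PE}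
    (hk : loc.2 ≤ K) (hs : Seg c h loc v g1 o) (he : Emits K c o e) :
    Emits K c (some loc)
      ((evIn loc.2 h :: (v.map (evSp loc.2) ++ [evOut loc.2 g1]) : List PE) + e) := by
  obtain ⟨a, w, g', d, hl, hr, g2, w2, h1, h2⟩ := hs
  have h3 := h1.pth_succ hk (h2.pth hk he)
  rw [hl] at h3
  have := Pth.rule ((mem_rules.2 loc.2 hk).1 _ hr) (w := encS w) h3
  rw [Emits, Option.elim_some, hl]
  rw [← add_assoc, ← add_assoc] at this
  exact this

theorem mem_ruleList_cases {r : PRule PX PS PE} (hr : r ∈ ruleList K c) :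
    (r.1 = xStart → ∃ q ∈ cRes c, r = rStart q) ∧
    ∀ j, r.1 = xSusp j → ∃ q ∈ cRes c, r = rRes j q := by
  revert r
  rw [forall_ruleList]
  refine ⟨fun q hq => ⟨fun _ => ⟨q, hq, rfl⟩, by simp⟩, fun k _ => ⟨fun q hq => ⟨by simp, ?_⟩,
    by simp, by simp, by simp, by simp⟩⟩
  intro j hj
  obtain rfl : k = j := by simpa using hj
  exact ⟨q, hq, rfl⟩

theorem pth_start {γ : ℕ} {e : Multiset PE} (h : Pth (rules K c) (xSusp 0) (encS [γ]) none e) :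
    Pth (rules K c) xStart [some γ] none e := by
  cases h with
  | halt => exact Pth.halt _ _
  | @rule _ a o x' w' w _ e hr h =>
    obtain ⟨q, hq, h2⟩ := (mem_ruleList_cases hr).2 0 rfl
    obtain ⟨-, rfl, -⟩ := Prod.mk.injEq .. ▸ h2
    have h3 := Pth.rule (mem_rules.1 q hq) (w := [])
      (Pth.rule hr h)
    simpa using h3

theorem suspOk_of_pth_start {γ : ℕ} {e : Multiset PE}
    (h : Pth (rules K c) xStart [some γ] none e) : SuspOk c 0 [γ] e := by
  cases h with
  | halt => exact (Pth.halt (R := rules K c) (xSusp 0) (encS [γ])).ok.1 _ _ rfl rfl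
  | @rule _ a o x' w' w _ e hr h =>
    obtain ⟨q, hq, h2⟩ := (mem_ruleList_cases hr).1 rfl
    simp only [rStart, Prod.mk.injEq, true_and, Option.some.injEq] at h2
    obtain ⟨rfl, rfl, rfl, rfl⟩ := h2
    simpa using h.ok.1 0 [_] rfl rfl
end Embedding

section Macro

/-- The threads spawned with the stack symbols in `v`. -/
def spawned (v : List ℕ) : Multiset Loc := (v : Multiset ℕ).map fun s => ([s], 0)

def optM (o : Option Loc) : Multiset Loc := (o.toList : Multiset Loc)

/-- Steps between consecutive schedule points. -/
def Macro (K : ℕ) (c : Code) (s s' : ℕ × Multiset Loc) : Prop :=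
  ∃ loc p v o, s.2 = loc ::ₘ p ∧ loc.2 ≤ K ∧ Seg c s.1 loc v s'.1 o ∧
    s'.2 = p + spawned v + optM o

theorem Seg.snd_eq {c : Code} {h g1 : ℕ} {loc loc' : Loc} {v : List ℕ}
    (hs : Seg c h loc v g1 (some loc')) : loc'.2 = loc.2 + 1 := by
  obtain ⟨_, _, _, _, _, _, _, _, _, ⟨_, _, _, _, _, h⟩ | ⟨_, _, h⟩⟩ := hs
  · simp only [Option.some.injEq] at h
    rw [h]
  · cases h

end Macro

section Koenig
variable {C : Type}

/-- There is a sequence of `N` steps from `c` starting at time `n`. -/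
def LWalk (Q : ℕ → C → C → Prop) : ℕ → ℕ → C → Prop
  | 0, _, _ => True
  | N + 1, n, c => ∃ c', Q n c c' ∧ LWalk Q N (n + 1) c'

theorem LWalk.pred {Q : ℕ → C → C → Prop} {N n : ℕ} {c : C} (h : LWalk Q (N + 1) n c) :
    LWalk Q N n c := by
  induction N generalizing n c with
  | zero => trivial
  | succ N ih =>
    obtain ⟨c', h1, h2⟩ := h
    exact ⟨c', h1, ih h2⟩

theorem LWalk.le {Q : ℕ → C → C → Prop} {N M n : ℕ} {c : C} (h : LWalk Q N n c) (hM : M ≤ N) :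
    LWalk Q M n c := by
  induction N, hM using Nat.le_induction with
  | base => exact h
  | succ N _ ih => exact ih h.pred

theorem exists_run_of_lWalk {Q : ℕ → C → C → Prop} (hQ : ∀ n c, {c' | Q n c c'}.Finite) {c0 : C}
    (h : ∀ N, LWalk Q N 0 c0) : ∃ f : ℕ → C, f 0 = c0 ∧ ∀ n, Q n (f n) (f (n + 1)) := by
  have hs : ∀ n c, (∀ N, LWalk Q N n c) → ∃ c', Q n c c' ∧ ∀ N, LWalk Q N (n + 1) c' := by
    intro n c h
    by_contra! hc
    have hc : ∀ c', ∃ N, Q n c c' → ¬ LWalk Q N (n + 1) c' := fun c' => by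
      by_cases hq : Q n c c'
      · obtain ⟨N, hN⟩ := hc c' hq
        exact ⟨N, fun _ => hN⟩
      · exact ⟨0, fun h => absurd h hq⟩
    choose B hB using hc
    obtain ⟨M, hM⟩ := ((hQ n c).image B).bddAbove
    obtain ⟨c', h1, h2⟩ := h (M + 1)
    exact hB c' h1 (h2.le (hM ⟨c', h1, rfl⟩))
  choose F hF1 hF2 using hs
  let G : ∀ n : ℕ, {c // ∀ N, LWalk Q N n c} := fun n =>
    Nat.rec ⟨c0, h⟩ (fun n x => ⟨F n x.1 x.2, hF2 n x.1 x.2⟩) n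
  exact ⟨fun n => (G n).1, rfl, fun n => hF1 n (G n).1 (G n).2⟩

end Koenig

section Link

/-- Places: a number of context switches, an initial stack symbol and an ideal of behaviours. -/
abbrev Place : Type := ℕ × ℕ × (List PE × List PE)

instance : DecidableEq Place := instDecidableEqProd

abbrev freshP (γ : ℕ) : Place := (0, γ, ([], []))

abbrev suspP (j γ : ℕ) (d : List PE × List PE) : Place := (j, γ, d)

def plj (j γ : ℕ) (d : List PE × List PE) : Place := if j = 0 then freshP γ else suspP j γ d

/-- Places of the threads spawned in round `j`. -/
def spw (j : ℕ) (l : List PE) : List Place :=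
  l.flatMap fun ev => if ev.1 = 2 ∧ ev.2.1 = j then [freshP ev.2.2] else []

theorem count_spw (j s : ℕ) (l : List PE) :
    (spw j l : Multiset Place).count (freshP s) = (l : Multiset PE).count (evSp j s) := by
  induction l with
  | nil => rfl
  | cons ev l ih =>
    have : spw j (ev :: l) = (if ev.1 = 2 ∧ ev.2.1 = j then [freshP ev.2.2] else []) ++ spw j l :=
      rfl
    rw [this, ← Multiset.coe_add, Multiset.count_add, ih, ← Multiset.cons_coe, Multiset.count_cons,
      add_comm]
    obtain ⟨a, b, t⟩ := ev
    congr 1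
    by_cases h : a = 2 ∧ b = j
    · obtain ⟨rfl, rfl⟩ := h
      simp [Multiset.count_singleton]
    · simp only [h, if_false, Multiset.coe_nil, Multiset.count_zero]
      rw [if_neg]
      simp only [Prod.mk.injEq]
      tauto

theorem mem_spw {j : ℕ} {x : Place} {l : List PE} :
    x ∈ spw j l ↔ ∃ s, x = freshP s ∧ evSp j s ∈ l := by
  rw [spw, List.mem_flatMap]
  constructor
  · rintro ⟨⟨a, b, t⟩, h, hx⟩
    split_ifs at hx with h1
    · obtain ⟨rfl, rfl⟩ := h1
      exact ⟨t, by simpa using hx, h⟩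
    · simp at hx
  · rintro ⟨s, rfl, h⟩
    exact ⟨_, h, by simp⟩

/-- The net transition executing a thread in round `j` from global state `h` to `g`. -/
def mkT (γ : ℕ) (d : List PE × List PE) (j h g : ℕ) : NTrans Place :=
  (h, plj j γ d, g, suspP (j + 1) γ d :: spw j d.1, spw j d.2)

/-- All transitions required by a summary are present. -/
def TClosed (D : Summary PX PS PE) (T : List (NTrans Place)) : Prop :=
  ∀ z ∈ D, z.1.1 ≠ xStart ∨ z.1.2.2 ≠ none ∨ ∀ a ∈ z.2.1 ++ z.2.2, ∀ b ∈ z.2.1 ++ z.2.2,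
    a.1 ≠ 0 ∨ b.1 ≠ 1 ∨ a.2.1 ≠ b.2.1 ∨ z.1.2.1 = none ∨
      ∃ γ, z.1.2.1 = some γ ∧ mkT γ z.2 a.2.1 a.2.2 b.2.2 ∈ T

theorem TClosed.mkT_mem {D : Summary PX PS PE} {T : List (NTrans Place)} (h : TClosed D T)
    {γ : ℕ} {d : List PE × List PE} {j h g1 : ℕ} (hd : ((xStart, some γ, none), d) ∈ D)
    (h1 : evIn j h ∈ d.1 ++ d.2) (h2 : evOut j g1 ∈ d.1 ++ d.2) : mkT γ d j h g1 ∈ T := by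
  rename_i hT
  obtain ⟨γ', he, hm⟩ := (((((((hT _ hd).resolve_left (by simp)).resolve_left (by simp)) _ h1 _
    h2).resolve_left (by simp)).resolve_left (by simp)).resolve_left (by simp)).resolve_left
    (by simp)
  cases he
  exact hm

/-- A certificate that there is no infinite computation. -/
def Cert (K : ℕ) (c : Code) : Prop :=
  ∃ (D : Summary PX PS PE) (T : List (NTrans Place)),
    (∀ r ∈ ruleList K c, RClosed D r) ∧ PopClosed D ∧ TClosed D T ∧
      NCert T (cG0 c) (freshP (cGam0 c))

/-- Which tokens represent a thread that is going to emit `x.2`. -/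
def Repr (D : Summary PX PS PE) (x : Loc × Multiset PE) (pl : Place) : Prop :=
  (∃ γ, x.1 = ([γ], 0) ∧ pl = freshP γ) ∨
  ∃ γ d, 1 ≤ x.1.2 ∧ pl = suspP x.1.2 γ d ∧ ((xStart, some γ, none), d) ∈ D ∧ InI d x.2

/-- Net steps in which the additional tokens are the ones in `F` that are allowed. -/
def BStep (T : List (NTrans Place)) (F : Multiset Place) (s s' : ℕ × Multiset Place) : Prop :=
  ∃ τ ∈ T, ∃ m0, s = (τ.1, τ.2.1 ::ₘ m0) ∧
    s' = (τ.2.2.1, m0 + τ.2.2.2.1 + F.filter (fun x => x ∈ τ.2.2.2.2))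

theorem BStep.nRel {T : List (NTrans Place)} {F : Multiset Place} {s s' : ℕ × Multiset Place}
    (h : BStep T F s s') : NRel T s s' := by
  obtain ⟨τ, hτ, m0, h1, h2⟩ := h
  exact ⟨_, τ, hτ, m0, h1, fun x hx => (Multiset.mem_filter.1 hx).2, h2⟩

theorem finite_bStep (T : List (NTrans Place)) (F : Multiset Place) (s : ℕ × Multiset Place) :
    {s' | BStep T F s s'}.Finite := by
  refine ((List.finite_toSet T).image fun τ => (τ.2.2.1, s.2.erase τ.2.1 + τ.2.2.2.1 +
    F.filter (fun x => x ∈ τ.2.2.2.2))).subset ?_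
  rintro s' ⟨τ, hτ, m0, rfl, rfl⟩
  exact ⟨τ, hτ, by simp⟩

theorem Emits.exists_ideal {K : ℕ} {c : Code} {D : Summary PX PS PE}
    (hR : ∀ r ∈ ruleList K c, RClosed D r) (hl : ∀ r ∈ ruleList K c, r.2.2.2.2.length ≤ 2)
    (hp : PopClosed D) {loc : Loc} {e : Multiset PE} {pl : Place} (he : e ≠ 0)
    (h : Emits K c (some loc) e) (hx : Repr D (loc, e) pl) :
    ∃ γ d, pl = plj loc.2 γ d ∧ ((xStart, some γ, none), d) ∈ D ∧ InI d e := by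
  obtain ⟨γ, rfl, rfl⟩ | ⟨γ, d, h1, rfl, h2, h3⟩ := hx
  · obtain ⟨d, hd, hI⟩ := ((pth_start h).has hR hl hp).resolve_left he
    exact ⟨γ, d, rfl, hd, hI⟩
  · exact ⟨γ, d, by rw [plj, if_neg (by simp only at h1; omega)], h2, h3⟩

theorem InI.mem {d : List PE × List PE} {e : Multiset PE} (h : InI d e) {x : PE} (hx : x ∈ e) :
    x ∈ d.1 ++ d.2 := by
  rw [List.mem_append]
  rcases h x with h | h
  · exact Or.inr h
  · rw [← Multiset.coe_count] at h
    exact Or.inl (Multiset.one_le_count_iff_mem.1 ((Multiset.one_le_count_iff_mem.2 hx).trans h))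

theorem le_spw {j : ℕ} {v : List ℕ} {d : List PE × List PE} {e : Multiset PE} (h : InI d e)
    (hv : ((v.map (evSp j) : List PE) : Multiset PE) ≤ e) :
    (v : Multiset ℕ).map freshP ≤ (spw j d.1 : Multiset Place) +
      ((v : Multiset ℕ).map freshP).filter (fun x => x ∈ spw j d.2) := by
  rw [Multiset.le_iff_count]
  intro x
  by_cases hx : x ∈ (v : Multiset ℕ).map freshP
  · obtain ⟨s, -, rfl⟩ := Multiset.mem_map.1 hx
    rw [Multiset.count_add]
    by_cases hs : freshP s ∈ spw j d.2
    · rw [Multiset.count_filter_of_pos (by exact hs)]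
      exact Nat.le_add_left _ _
    · refine le_add_right ?_
      have hd := (h (evSp j s)).resolve_left fun hd => hs (mem_spw.2 ⟨s, rfl, hd⟩)
      rw [← Multiset.coe_count] at hd
      rw [count_spw]
      refine le_trans ?_ hd
      refine le_trans (le_of_eq ?_) (Multiset.count_le_of_le _ hv)
      rw [← Multiset.map_coe, Multiset.count_map_eq_count' freshP _ (fun a b h => by simpa using h),
        Multiset.count_map_eq_count' (evSp j) _ (fun a b h => by simpa using h)]
  · rw [Multiset.count_eq_zero_of_notMem hx]
    exact Nat.zero_le _

theorem Cert.no_infinite_run {K : ℕ} {c : Code} (hl : ∀ r ∈ ruleList K c, r.2.2.2.2.length ≤ 2)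
    (hc : Cert K c) (f : ℕ → ℕ × Multiset Loc) (h0 : f 0 = (cG0 c, {([cGam0 c], 0)}))
    (hf : ∀ n, Macro K c (f n) (f (n + 1))) : False := by
  obtain ⟨D, T, hR, hp, hT, hN⟩ := hc
  choose loc p v o h1 h2 h3 h4 using hf
  let F : ℕ → Multiset Place := fun n => (v n : Multiset ℕ).map freshP
  have key : ∀ N n, ∃ β : Multiset (Loc × Multiset PE),
      Multiset.Rel (fun x y => x.1 = y ∧ Emits K c (some y) x.2) β (f n).2 ∧
      ∀ m0 m, Multiset.Rel (Repr D) β m0 → m0 ≤ m →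
        LWalk (fun n => BStep T (F n)) N n ((f n).1, m) := by
    intro N
    induction N with
    | zero =>
      intro n
      refine ⟨(f n).2.map fun l => (l, 0), ?_, fun _ _ _ _ => trivial⟩
      rw [Multiset.rel_map_left]
      exact Multiset.rel_refl_of_refl_on fun x _ => ⟨rfl, emits_zero _⟩
    | succ N ih =>
      intro n
      obtain ⟨β, hβ, hw⟩ := ih (n + 1)
      rw [h4, Multiset.rel_add_right] at hβ
      obtain ⟨β', βo, hβ', hβo, rfl⟩ := hβ
      rw [Multiset.rel_add_right] at hβ'
      obtain ⟨βp, βv, hβp, hβv, rfl⟩ := hβ'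
      obtain ⟨e', he', hβo'⟩ : ∃ e', Emits K c (o n) e' ∧
          βo = (o n).toList.map fun l => (l, e') := by
        cases hon : o n with
        | none =>
          rw [hon] at hβo
          exact ⟨0, rfl, by simpa [optM] using hβo⟩
        | some l =>
          rw [hon] at hβo
          have : optM (some l) = l ::ₘ 0 := rfl
          rw [this, Multiset.rel_cons_right] at hβo
          obtain ⟨⟨l', e'⟩, b, ⟨rfl, h⟩, hb, rfl⟩ := hβo
          rw [Multiset.rel_zero_right] at hb
          subst hb
          exact ⟨e', h, rfl⟩
      have hem := (h3 n).emits (h2 n) he'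
      set e : Multiset PE := ((evIn (loc n).2 (f n).1 :: ((v n).map (evSp (loc n).2) ++
        [evOut (loc n).2 (f (n + 1)).1]) : List PE) + e') with he
      have e1 : evIn (loc n).2 (f n).1 ∈ e := by simp [he]
      have e2 : evOut (loc n).2 (f (n + 1)).1 ∈ e := by simp [he]
      have e3 : (((v n).map (evSp (loc n).2) : List PE) : Multiset PE) ≤ e := by
        rw [he, ← Multiset.cons_coe, ← Multiset.coe_add]
        refine le_add_right ((le_add_right le_rfl).trans (Multiset.le_cons_self _ _))
      have e4 : e' ≤ e := Multiset.le_add_left _ _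
      clear_value e
      refine ⟨(loc n, e) ::ₘ βp, ?_, ?_⟩
      · rw [h1]
        exact Multiset.Rel.cons ⟨rfl, hem⟩ hβp
      · intro m0 m hm hle
        rw [Multiset.rel_cons_left] at hm
        obtain ⟨pl, m1, hpl, hm1, rfl⟩ := hm
        obtain ⟨r, rfl⟩ := Multiset.le_iff_exists_add.1 hle
        obtain ⟨γ, d, rfl, hd, hI⟩ := Emits.exists_ideal hR hl hp
          (fun h => by simp [h] at e1) hem hpl
        refine ⟨((f (n + 1)).1, (m1 + r) + (suspP ((loc n).2 + 1) γ d :: spw (loc n).2 d.1 :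
          List Place) + (F n).filter (fun x => x ∈ spw (loc n).2 d.2)),
          ⟨_, hT.mkT_mem hd (hI.mem e1) (hI.mem e2), m1 + r, by simp [mkT], rfl⟩, ?_⟩
        refine hw (m1 + F n + ((o n).toList.map fun _ => suspP ((loc n).2 + 1) γ d)) _
          ((hm1.add ?_).add ?_) ?_
        · rw [spawned, Multiset.rel_map_right] at hβv
          rw [Multiset.rel_map_right]
          exact hβv.mono fun x _ s _ h => Or.inl ⟨s, h.1, rfl⟩
        · rw [hβo']
          cases hon : o n with
          | none => simp
          | some l =>
            have hl2 : l.2 = (loc n).2 + 1 := Seg.snd_eq (hon ▸ h3 n)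
            have hr : Repr D (l, e') (suspP ((loc n).2 + 1) γ d) :=
              Or.inr ⟨γ, d, by simp only; omega, by simp only [hl2], hd, hI.mono e4⟩
            exact Multiset.Rel.cons hr Multiset.Rel.zero
        · have q1 : ((((o n).toList.map fun _ => suspP ((loc n).2 + 1) γ d) : List Place) :
              Multiset Place) ≤ {suspP ((loc n).2 + 1) γ d} := by
            cases o n with
            | none => simp
            | some l => exact le_rfl
          have q2 := le_spw hI e3
          calc _ ≤ m1 + ((spw (loc n).2 d.1 : Multiset Place) + (F n).filter _) +
                {suspP ((loc n).2 + 1) γ d} := add_le_add (add_le_add le_rfl q2) q1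
            _ ≤ r + (m1 + ((spw (loc n).2 d.1 : Multiset Place) + (F n).filter _) +
                {suspP ((loc n).2 + 1) γ d}) := Multiset.le_add_left _ _
            _ = _ := by
              rw [← Multiset.cons_coe, ← Multiset.singleton_add]
              abel
  have hW : ∀ N, LWalk (fun n => BStep T (F n)) N 0 (cG0 c, {freshP (cGam0 c)}) := by
    intro N
    obtain ⟨β, hβ, hw⟩ := key N 0
    rw [h0] at hβ hw
    rw [show ({([cGam0 c], 0)} : Multiset Loc) = ([cGam0 c], 0) ::ₘ 0 from rfl,
      Multiset.rel_cons_right] at hβ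
    obtain ⟨⟨l', e'⟩, b, ⟨rfl, h⟩, hb, rfl⟩ := hβ
    rw [Multiset.rel_zero_right] at hb
    subst hb
    exact hw _ _ (Multiset.Rel.cons (Or.inl ⟨_, rfl, rfl⟩) Multiset.Rel.zero) le_rfl
  obtain ⟨r, hr0, hr⟩ := exists_run_of_lWalk (fun n s => finite_bStep T (F n) s) hW
  exact hN.no_infinite_run r hr0 fun n => (hr n).nRel

end Link

section Bounded
variable {P : Type}

/-- Net steps with at most `N` additional tokens. -/
def NRelB (T : List (NTrans P)) (N : ℕ) (s s' : ℕ × Multiset P) : Prop :=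
  ∃ v, v.card ≤ N ∧ NStep T v s s'

theorem exists_bound_reflTransGen {T : List (NTrans P)} {s s' : ℕ × Multiset P}
    (h : Relation.ReflTransGen (NRel T) s s') :
    ∃ N, ∀ M ≥ N, Relation.ReflTransGen (NRelB T M) s s' := by
  induction h with
  | refl => exact ⟨0, fun _ _ => .refl⟩
  | tail _ h ih =>
    obtain ⟨N, ih⟩ := ih
    obtain ⟨v, h⟩ := h
    exact ⟨max N v.card, fun M hM => (ih M (by omega)).tail ⟨v, by omega, h⟩⟩

theorem exists_bound_transGen {T : List (NTrans P)} {s s' : ℕ × Multiset P}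
    (h : Relation.TransGen (NRel T) s s') :
    ∃ N, ∀ M ≥ N, Relation.TransGen (NRelB T M) s s' := by
  obtain ⟨b, ⟨v, h⟩, h2⟩ := Relation.TransGen.head'_iff.1 h
  obtain ⟨N, h2⟩ := exists_bound_reflTransGen h2
  exact ⟨max N v.card, fun M hM =>
    Relation.TransGen.head' ⟨v, by omega, h⟩ (h2 M (by omega))⟩

end Bounded

section Completeness

/-- A self-covering sequence of macro steps. -/
def MLasso (K : ℕ) (c : Code) : Prop :=
  ∃ g p p', Relation.ReflTransGen (Macro K c) (cG0 c, {([cGam0 c], 0)}) (g, p) ∧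
    Relation.TransGen (Macro K c) (g, p) (g, p') ∧ p ≤ p'

theorem exists_net (D : Summary PX PS PE) : ∃ T, TClosed D T ∧ ∀ τ ∈ T,
    ∃ γ d j h g, ((xStart, some γ, none), d) ∈ D ∧ evIn j h ∈ d.1 ++ d.2 ∧
      evOut j g ∈ d.1 ++ d.2 ∧ τ = mkT γ d j h g := by
  classical
  let P : NTrans Place → Prop := fun τ => ∃ γ d j h g, ((xStart, some γ, none), d) ∈ D ∧
    evIn j h ∈ d.1 ++ d.2 ∧ evOut j g ∈ d.1 ++ d.2 ∧ τ = mkT γ d j h g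
  let T0 := D.flatMap fun z => (z.2.1 ++ z.2.2).flatMap fun a => (z.2.1 ++ z.2.2).map fun b =>
    mkT (z.1.2.1.getD 0) z.2 a.2.1 a.2.2 b.2.2
  refine ⟨T0.filter fun τ => P τ, ?_, fun τ hτ => show P τ by simpa using (List.mem_filter.1 hτ).2⟩
  rintro ⟨⟨x, s, oy⟩, d⟩ hz
  by_cases hx : x ≠ xStart
  · exact Or.inl hx
  by_cases hy : oy ≠ none
  · exact Or.inr (Or.inl hy)
  refine Or.inr (Or.inr ?_)
  rintro ⟨a, j, h⟩ ha ⟨b, j', g⟩ hb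
  by_cases h1 : a ≠ 0
  · exact Or.inl h1
  by_cases h2 : b ≠ 1
  · exact Or.inr (Or.inl h2)
  by_cases h3 : j ≠ j'
  · exact Or.inr (Or.inr (Or.inl h3))
  cases s with
  | none => exact Or.inr (Or.inr (Or.inr (Or.inl rfl)))
  | some γ =>
    refine Or.inr (Or.inr (Or.inr (Or.inr ⟨γ, rfl, List.mem_filter.2 ⟨?_, ?_⟩⟩)))
    · exact List.mem_flatMap.2 ⟨_, hz, List.mem_flatMap.2 ⟨_, ha, List.mem_map.2 ⟨_, hb, rfl⟩⟩⟩
    · push Not at hx hy h1 h2 h3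
      subst hx hy h1 h2 h3
      exact decide_eq_true ⟨γ, d, j, h, g, hz, ha, hb, rfl⟩

/-- The threads described by the tokens of a place, when initial stack symbol and ideal determine
the history `t` of a thread. -/
def plThreads (t : ℕ → List PE × List PE → ℕ → Option Loc) (x : Place) : Multiset Loc :=
  if x.1 = 0 then {([x.2.1], 0)} else optM (t x.2.1 x.2.2 x.1)

theorem mem_inst {d : List PE × List PE} {x : PE} {N : ℕ} (hN : 1 ≤ N) (hx : x ∈ d.1 ++ d.2) :
    x ∈ inst d N := by
  rw [inst, Multiset.mem_add]
  exact (List.mem_append.1 hx).imp id fun h => Multiset.mem_nsmul.2 ⟨by omega, h⟩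

theorem spw_add_le {j N : ℕ} {d : List PE × List PE} {e : Multiset PE} {u : Multiset Place}
    {v : List ℕ} (hu : u.card ≤ N) (hu' : ∀ x ∈ u, x ∈ spw j d.2) (he : inst d N ≤ e)
    (hv : ∀ s, e.count (evSp j s) ≤ v.count s) :
    (spw j d.1 : Multiset Place) + u ≤ (v : Multiset ℕ).map freshP := by
  rw [Multiset.le_iff_count]
  intro x
  by_cases hx : ∃ s, x = freshP s
  · obtain ⟨s, rfl⟩ := hx
    rw [Multiset.count_map_eq_count' freshP _ (fun a b h => by simpa using h)]
    rw [Multiset.coe_count]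
    refine le_trans ?_ (hv s)
    refine le_trans ?_ (Multiset.count_le_of_le _ he)
    rw [inst, Multiset.count_add, Multiset.count_add, count_spw, Multiset.count_nsmul]
    refine add_le_add le_rfl ?_
    by_cases hs : freshP s ∈ u
    · obtain ⟨s', h1, h2⟩ := mem_spw.1 (hu' _ hs)
      obtain rfl : s = s' := by simpa using h1
      have h3 : 1 ≤ (d.2 : Multiset PE).count (evSp j s) := Multiset.one_le_count_iff_mem.2 h2
      have h4 := Multiset.count_le_card (freshP s) u
      nlinarith
    · rw [Multiset.count_eq_zero_of_notMem hs]
      exact Nat.zero_le _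
  · rw [Multiset.count_eq_zero_of_notMem]
    · exact Nat.zero_le _
    · intro h
      rcases Multiset.mem_add.1 h with h | h
      · obtain ⟨s, h, -⟩ := mem_spw.1 h
        exact hx ⟨s, h⟩
      · obtain ⟨s, h, -⟩ := mem_spw.1 (hu' _ h)
        exact hx ⟨s, h⟩

theorem cert_of_not_mLasso {K : ℕ} {c : Code} (hL : ¬ MLasso K c) : Cert K c := by
  obtain ⟨D, hR, hp, hD⟩ := exists_summary (rules K c) (List.finite_toSet _)
  obtain ⟨T, hT, hT'⟩ := exists_net D
  refine ⟨D, T, hR, hp, hT, nCert_of_not_nLasso ?_⟩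
  rintro ⟨h, m, m', w1, w2, hle⟩
  obtain ⟨N1, w1⟩ := exists_bound_reflTransGen w1
  obtain ⟨N2, w2⟩ := exists_bound_transGen w2
  obtain ⟨N, hN1, hN2, hN⟩ : ∃ N, N1 ≤ N ∧ N2 ≤ N ∧ 1 ≤ N :=
    ⟨max N1 (max N2 1), by omega, by omega, by omega⟩
  specialize w1 N hN1
  specialize w2 N hN2
  have ht : ∀ γ d, ∃ t : ℕ → Option Loc, ((xStart, some γ, none), d) ∈ D →
      t 0 = some ([γ], 0) ∧ ∃ e, Chain c t e 0 ∧ inst d N ≤ e ∧ ∀ ev ∈ e, ev.2.1 ≤ K := by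
    intro γ d
    by_cases hd : ((xStart, some γ, none), d) ∈ D
    · obtain ⟨e, he, hP⟩ := hD _ hd N
      obtain ⟨-, t, h0, ht⟩ := suspOk_of_pth_start hP
      exact ⟨t, fun _ => ⟨h0, e, ht, he, hP.idx_le⟩⟩
    · exact ⟨fun _ => none, fun h => absurd h hd⟩
  choose t ht using ht
  let Φ : Multiset Place → Multiset Loc := fun m => m.bind (plThreads t)
  have hΦ : ∀ m m', Φ (m + m') = Φ m + Φ m' := fun m m' => Multiset.add_bind _ _ _
  have hΦs : ∀ x, Φ {x} = plThreads t x := fun x => Multiset.singleton_bind _ _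
  have hΦl : ∀ m m', m ≤ m' → Φ m ≤ Φ m' := fun m m' h => by
    obtain ⟨r, rfl⟩ := Multiset.le_iff_exists_add.1 h
    rw [hΦ]
    exact Multiset.le_add_right _ _
  have hΦf : ∀ v : List ℕ, Φ ((v : Multiset ℕ).map freshP) = spawned v := fun v => by
    simp only [Φ, Multiset.bind_map, spawned]
    exact Multiset.bind_singleton _ _
  have step : ∀ s s' x, NRelB T N s s' →
      ∃ y, Macro K c (s.1, Φ s.2 + x) (s'.1, Φ s'.2 + (x + y)) := by
    rintro s s' x ⟨u, hu, τ, hτ, m0, rfl, hu', rfl⟩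
    obtain ⟨γ, d, j, h, g, hd, h1, h2, rfl⟩ := hT' τ hτ
    obtain ⟨ht0, e, hc, he, hi⟩ := ht γ d hd
    have hin := Multiset.mem_of_le he (mem_inst hN h1)
    obtain ⟨w, v, h3, h4, h5⟩ := hc j h g (Nat.zero_le _) hin
      (Multiset.mem_of_le he (mem_inst hN h2))
    have hpl : plThreads t (plj j γ d) = {(w, j)} := by
      by_cases hj : j = 0
      · subst hj
        rw [ht0] at h3
        simp only [plThreads, plj, if_true]
        rw [Option.some_inj.1 h3]
      · simp only [plThreads, plj, hj, if_false, h3]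
        rfl
    have hnext : plThreads t (suspP (j + 1) γ d) = optM (t γ d (j + 1)) := by
      simp [plThreads]
    obtain ⟨y, hy⟩ := Multiset.le_iff_exists_add.1
      (hΦl _ _ (spw_add_le hu hu' he h5))
    refine ⟨y, (w, j), Φ m0 + x, v, t γ d (j + 1), ?_, hi _ hin, h4, ?_⟩
    · simp only [mkT, ← Multiset.singleton_add, hΦ, hΦs, hpl, add_assoc]
    · rw [← hΦf, hy]
      simp only [mkT, ← Multiset.singleton_add, ← Multiset.cons_coe, hΦ, hΦs, hnext]
      abel
  have hw1 : ∀ s s' x, Relation.ReflTransGen (NRelB T N) s s' →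
      ∃ y, Relation.ReflTransGen (Macro K c) (s.1, Φ s.2 + x) (s'.1, Φ s'.2 + (x + y)) := by
    intro s s' x h
    induction h with
    | refl => exact ⟨0, by rw [add_zero]⟩
    | tail _ h ih =>
      obtain ⟨y, ih⟩ := ih
      obtain ⟨y', h⟩ := step _ _ (x + y) h
      exact ⟨y + y', by rw [← add_assoc x]; exact ih.tail h⟩
  obtain ⟨y, k1⟩ := hw1 _ _ 0 w1
  obtain ⟨b, w2, w3⟩ := Relation.TransGen.head'_iff.1 w2
  obtain ⟨y1, k2⟩ := step _ _ (0 + y) w2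
  obtain ⟨y2, k3⟩ := hw1 _ _ (0 + y + y1) w3
  refine hL ⟨h, _, _, ?_, Relation.TransGen.head' k2 k3, ?_⟩
  · simpa [hΦs, plThreads] using k1
  · exact add_le_add (hΦl _ _ hle) (by rw [add_assoc]; exact Multiset.le_add_right _ _)

end Completeness

section Lasso
variable {K : ℕ} {c : Code}

theorem Macro.add_right {s s' : ℕ × Multiset Loc} (h : Macro K c s s') (x : Multiset Loc) :
    Macro K c (s.1, s.2 + x) (s'.1, s'.2 + x) := by
  obtain ⟨loc, p, v, o, h1, h2, h3, h4⟩ := h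
  refine ⟨loc, p + x, v, o, ?_, h2, h3, ?_⟩
  · rw [h1, Multiset.cons_add]
  · simp only [h4, add_comm, add_left_comm]

theorem transGen_macro_add_right {s s' : ℕ × Multiset Loc}
    (h : Relation.TransGen (Macro K c) s s') (x : Multiset Loc) :
    Relation.TransGen (Macro K c) (s.1, s.2 + x) (s'.1, s'.2 + x) :=
  h.lift (fun s => (s.1, s.2 + x)) fun _ _ h => h.add_right x

/-- There is an infinite sequence of macro steps from `s`. -/
def Live (K : ℕ) (c : Code) (s : ℕ × Multiset Loc) : Prop :=
  ∃ f : ℕ → ℕ × Multiset Loc, f 0 = s ∧ ∀ n, Macro K c (f n) (f (n + 1))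

theorem Live.exists_macro {s : ℕ × Multiset Loc} (h : Live K c s) :
    ∃ s', Macro K c s s' ∧ Live K c s' := by
  obtain ⟨f, rfl, hf⟩ := h
  exact ⟨f 1, hf 0, fun n => f (n + 1), rfl, fun n => hf (n + 1)⟩

/-- Iteration of a total relation on the elements satisfying an invariant. -/
theorem exists_orbit {α : Type} {I : α → Prop} {r : α → α → Prop}
    (h : ∀ a, I a → ∃ b, r a b ∧ I b) {a : α} (ha : I a) :
    ∃ f : ℕ → α, f 0 = a ∧ (∀ n, I (f n)) ∧ ∀ n, r (f n) (f (n + 1)) := by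
  choose F hF hI using h
  let G : ℕ → {a // I a} := fun n => Nat.rec ⟨a, ha⟩ (fun _ x => ⟨F x.1 x.2, hI x.1 x.2⟩) n
  exact ⟨fun n => (G n).1, rfl, fun n => (G n).2, fun n => hF (G n).1 (G n).2⟩

theorem MLasso.live (h : MLasso K c) : Live K c (cG0 c, {([cGam0 c], 0)}) := by
  obtain ⟨g, p, p', h1, h2, hle⟩ := h
  obtain ⟨r, rfl⟩ := Multiset.le_iff_exists_add.1 hle
  obtain ⟨f, h0, -, hf⟩ := exists_orbit
    (I := fun s => ∃ x, Relation.ReflTransGen (Macro K c) s (g, p + x)) (r := Macro K c)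
    (fun s hs => by
      obtain ⟨x, hx⟩ := hs
      rcases Relation.ReflTransGen.cases_head hx with rfl | ⟨s', h3, h4⟩
      · obtain ⟨s', h3, h4⟩ := Relation.TransGen.head'_iff.1 (transGen_macro_add_right h2 x)
        exact ⟨s', h3, r + x, by simpa only [add_assoc] using h4⟩
      · exact ⟨s', h3, x, h4⟩)
    ⟨0, by simpa using h1⟩
  exact ⟨f, h0, hf⟩

end Lasso

section Runs

/-- `c` lists the components of `A`. -/
def IsCode (A : DCPS) (c : Code) : Prop :=
  (∀ q, q ∈ cCre c ↔ q ∈ A.creation) ∧ (∀ q, q ∈ cInt c ↔ q ∈ A.interruption) ∧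
  (∀ q, q ∈ cRes c ↔ q ∈ A.resumption) ∧ (∀ q, q ∈ cTer c ↔ q ∈ A.termination) ∧
  cG0 c = A.g0 ∧ cGam0 c = A.gamma0

variable {K : ℕ} {A : DCPS} {c : Code}

theorem spawned_toList_append (sp : Option ℕ) (v : List ℕ) :
    spawned (sp.toList ++ v) = spawnOf sp + spawned v := by
  rw [spawned, ← Multiset.coe_add, Multiset.map_add]
  congr 1
  cases sp <;> rfl

theorem exists_tSeg (hc : IsCode A c) {rho : ℕ → DConfig}
    (hr : ∀ i, DStep A (rho i) (rho (i + 1))) (d : ℕ) : ∀ i w k,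
    (rho i).act = some (w, k) → (∀ m ≤ d, (rho (i + m)).act ≠ none) →
    (rho (i + d + 1)).act = none → ∃ v o, TSeg c d (rho i).g w k v (rho (i + d + 1)).g o ∧
      (rho (i + d + 1)).pend = (rho i).pend + spawned v + optM o := by
  induction d with
  | zero =>
    intro i w k h1 _ h3
    rcases hr i with ⟨_, _, _, _, _, _, _, _, _, h, _⟩ |
      ⟨γ, w0, j, g', w', h4, h5, h6, _, h7⟩ | ⟨_, _, _, _, _, _, _, _, h, _⟩ |
      ⟨j, g', h4, h5, h6, _, h7⟩
    · rw [add_zero, h] at h3; cases h3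
    · rw [h1] at h5
      simp only [Option.some.injEq, Prod.mk.injEq] at h5
      obtain ⟨rfl, rfl⟩ := h5
      refine ⟨[], some (w' ++ w0, k + 1), ⟨_, _, .refl _ _, Or.inl ⟨γ, w', w0, ?_, rfl, rfl⟩⟩, ?_⟩
      · rw [hc.2.1, add_zero, h6]; exact h4
      · rw [add_zero, h7]; simp [spawned, optM]
    · rw [h1] at h; cases h
    · rw [h1] at h5
      simp only [Option.some.injEq, Prod.mk.injEq] at h5
      obtain ⟨rfl, rfl⟩ := h5
      refine ⟨[], none, ⟨_, _, .refl _ _, Or.inr ⟨rfl, ?_, rfl⟩⟩, ?_⟩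
      · rw [hc.2.2.2.1, add_zero, h6]; exact h4
      · rw [add_zero, h7]; simp [spawned, optM]
  | succ d ih =>
    intro i w k h1 h2 h3
    have h2' := h2 1 (by omega)
    rcases hr i with ⟨γ, w0, j, g', w', sp, h4, h5, h6, h7, h8⟩ |
      ⟨_, _, _, _, _, _, _, _, h, _⟩ | ⟨_, _, _, _, _, _, _, _, h, _⟩ | ⟨_, _, _, _, _, h, _⟩
    · rw [h1] at h5
      simp only [Option.some.injEq, Prod.mk.injEq] at h5
      obtain ⟨rfl, rfl⟩ := h5
      have e : i + 1 + d + 1 = i + (d + 1) + 1 := by omega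
      obtain ⟨v, o, ⟨g2, w2, k1, k2⟩, k3⟩ := ih (i + 1) (w' ++ w0) k h7
        (fun m hm => by rw [show i + 1 + m = i + (m + 1) by omega]; exact h2 _ (by omega))
        (by rw [e]; exact h3)
      rw [e] at k2 k3
      refine ⟨sp.toList ++ v, o, ⟨g2, w2, .step ((hc.1 _).2 h4) (h6 ▸ k1), k2⟩, ?_⟩
      rw [k3, h8, spawned_toList_append]
      simp only [add_assoc]
    · exact absurd h h2'
    · rw [h1] at h; cases h
    · exact absurd h h2'

theorem exists_macro_of_run (hc : IsCode A c) {rho : ℕ → DConfig} (hr : IsInfRunD A rho)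
    (hK : KBoundedD K rho) {i : ℕ} (hi : (rho i).act = none) :
    ∃ j, (rho j).act = none ∧ Macro K c ((rho i).g, (rho i).pend) ((rho j).g, (rho j).pend) := by
  classical
  obtain ⟨-, hr, hne, hinf⟩ := hr
  have hstep : ∃ γ w k g' p, ((rho i).g, g', γ) ∈ A.resumption ∧
      (rho i).pend = p + {(γ :: w, k)} ∧ (rho (i + 1)).g = g' ∧
      (rho (i + 1)).act = some (γ :: w, k) ∧ (rho (i + 1)).pend = p := by
    rcases hr i with ⟨_, _, _, _, _, _, _, h, _⟩ |
      ⟨_, _, _, _, _, _, h, _⟩ | ⟨_, γ, w, k, g', p, h1, rfl, _, h2, h3, h4, h5⟩ | ⟨_, _, _, h, _⟩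
    · rw [hi] at h; cases h
    · rw [hi] at h; cases h
    · exact ⟨γ, w, k, g', p, h1, h2, h3, h4, h5⟩
    · rw [hi] at h; cases h
  obtain ⟨γ, w, k, g', p, h1, h2, h3, h4, h5⟩ := hstep
  have hex : ∃ m, (rho (i + 3 + m)).act = none := by
    obtain ⟨j, hj, h⟩ := hinf (i + 3)
    exact ⟨j - (i + 3), by rwa [Nat.add_sub_cancel' hj]⟩
  have hm := Nat.find_spec hex
  have hmin := fun m => Nat.find_min hex (m := m)
  generalize Nat.find hex = d at hm hmin
  have e : i + 1 + (d + 1) + 1 = i + 3 + d := by omega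
  obtain ⟨v, o, k1, k2⟩ := exists_tSeg hc hr (d + 1) (i + 1) (γ :: w) k h4 (fun m hm => by
    match m, hm with
    | 0, _ => rw [add_zero, h4]; simp
    | 1, _ => exact hne i hi
    | m + 2, hm =>
      rw [show i + 1 + (m + 2) = i + 3 + m by omega]
      exact hmin m (by omega)) (by rw [e]; exact hm)
  rw [e] at k1 k2
  refine ⟨_, hm, (γ :: w, k), p, v, o, ?_, hK _ _ _ h4, ⟨γ, w, g', d, rfl, (hc.2.2.1 _).2 h1, ?_⟩, ?_⟩
  · rw [h2, add_comm]; rfl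
  · exact h3 ▸ k1
  · rw [k2, h5]

theorem live_of_run (hc : IsCode A c) {rho : ℕ → DConfig} (hr : IsInfRunD A rho)
    (hK : KBoundedD K rho) : Live K c (cG0 c, {([cGam0 c], 0)}) := by
  obtain ⟨f, h0, -, hf⟩ := exists_orbit (I := fun i => (rho i).act = none)
    (r := fun i j => Macro K c ((rho i).g, (rho i).pend) ((rho j).g, (rho j).pend))
    (fun i hi => by
      obtain ⟨j, h1, h2⟩ := exists_macro_of_run hc hr hK hi
      exact ⟨j, h2, h1⟩) (a := 0) (by rw [hr.1]; rfl)
  refine ⟨fun n => ((rho (f n)).g, (rho (f n)).pend), ?_, hf⟩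
  simp only [h0, hr.1, DCPS.init, hc.2.2.2.2.1, hc.2.2.2.2.2]

/-- Configurations of an infinite computation, together with the number of remaining steps of the
active thread. -/
def RunInv (K : ℕ) (c : Code) (x : DConfig × Option ℕ) : Prop :=
  match x.2 with
  | none => x.1.act = none ∧ Live K c (x.1.g, x.1.pend)
  | some d => ∃ w k g1 v o, x.1.act = some (w, k) ∧ k ≤ K ∧ TSeg c d x.1.g w k v g1 o ∧
      Live K c (g1, x.1.pend + spawned v + optM o)

/-- The number of remaining steps decreases, and is initially positive. -/
def Countdown : Option ℕ → Option ℕ → Prop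
  | none, y => ∃ d, y = some (d + 1)
  | some 0, y => y = none
  | some (d + 1), y => y = some d

theorem RunInv.exists_step (hc : IsCode A c) {x : DConfig × Option ℕ} (hx : RunInv K c x) :
    ∃ y, (DStep A x.1 y.1 ∧ Countdown x.2 y.2) ∧ RunInv K c y := by
  obtain ⟨⟨g, act, p⟩, _ | _ | d⟩ := x
  · obtain ⟨rfl, hx⟩ := hx
    obtain ⟨⟨g1, p1⟩, ⟨⟨l, k⟩, p0, v, o, h0, hk, ⟨a, w, g', d, h1, h2, h3⟩, h4⟩, hL⟩ :=
      hx.exists_macro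
    obtain rfl : p = (l, k) ::ₘ p0 := h0
    obtain rfl : p1 = p0 + spawned v + optM o := h4
    obtain rfl : l = a :: w := h1
    refine ⟨(⟨g', some (a :: w, k), p0⟩, some (d + 1)), ⟨?_, d, rfl⟩,
      ⟨_, _, _, v, o, rfl, hk, h3, hL⟩⟩
    exact Or.inr (Or.inr (Or.inl ⟨_, a, w, k, g', p0, (hc.2.2.1 _).1 h2, rfl, rfl,
      by rw [add_comm]; rfl, rfl, rfl, rfl⟩))
  · obtain ⟨w, k, g1, v, o, rfl, hk, ⟨g2, w2, h1, h2⟩, hL⟩ := hx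
    cases h1
    rcases h2 with ⟨a, w', w0, h3, rfl, rfl⟩ | ⟨rfl, h3, rfl⟩
    · refine ⟨(⟨g1, none, p + {(w' ++ w0, k + 1)}⟩, none), ⟨?_, rfl⟩, rfl, ?_⟩
      · exact Or.inr (Or.inl ⟨a, w0, k, g1, w', (hc.2.1 _).1 h3, rfl, rfl, rfl, rfl⟩)
      · simpa [spawned, optM] using hL
    · refine ⟨(⟨g1, none, p⟩, none), ⟨?_, rfl⟩, rfl, ?_⟩
      · exact Or.inr (Or.inr (Or.inr ⟨k, g1, (hc.2.2.2.1 _).1 h3, rfl, rfl, rfl, rfl⟩))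
      · simpa [spawned, optM] using hL
  · obtain ⟨w, k, g1, v, o, rfl, hk, ⟨g2, w2, h1, h2⟩, hL⟩ := hx
    cases h1 with
    | @step _ _ a g3 w' sp w v _ _ hr h =>
      refine ⟨(⟨g3, some (w' ++ w, k), p + spawnOf sp⟩, some d), ⟨?_, rfl⟩,
        ⟨_, _, g1, v, o, rfl, hk, ⟨g2, w2, h, h2⟩, ?_⟩⟩
      · exact Or.inl ⟨a, w, k, g3, w', sp, (hc.1 _).1 hr, rfl, rfl, rfl, rfl⟩
      · rw [spawned_toList_append, ← add_assoc] at hL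
        exact hL

theorem run_of_live (hc : IsCode A c) (h : Live K c (cG0 c, {([cGam0 c], 0)})) :
    ∃ rho, IsInfRunD A rho ∧ KBoundedD K rho := by
  have hinit : RunInv K c (A.init, none) := by
    rw [hc.2.2.2.2.1, hc.2.2.2.2.2] at h
    exact ⟨rfl, h⟩
  obtain ⟨f, h0, hI, hf⟩ := exists_orbit (r := fun x y : DConfig × Option ℕ =>
    DStep A x.1 y.1 ∧ Countdown x.2 y.2) (fun x hx => hx.exists_step hc) hinit
  have hnone : ∀ i, (f i).2 = none → (f i).1.act = none := fun i hi => by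
    have := hI i
    rw [RunInv, hi] at this
    exact this.1
  have hsome : ∀ i d, (f i).2 = some d → ∃ w k, (f i).1.act = some (w, k) ∧ k ≤ K :=
    fun i d hi => by
      have := hI i
      rw [RunInv, hi] at this
      obtain ⟨w, k, _, _, _, h1, h2, _⟩ := this
      exact ⟨w, k, h1, h2⟩
  have hdown : ∀ d i, (f i).2 = some d → (f (i + d + 1)).2 = none := by
    intro d
    induction d with
    | zero =>
      intro i hi
      have := (hf i).2
      rw [hi] at this
      exact this
    | succ d ih =>
      intro i hi
      have := (hf i).2
      rw [hi] at this
      rw [show i + (d + 1) + 1 = i + 1 + d + 1 by omega]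
      exact ih (i + 1) this
  refine ⟨fun i => (f i).1, ⟨by simp only [h0], fun i => (hf i).1, fun i hi => ?_, fun i => ?_⟩,
    fun i w j hij => ?_⟩
  · cases hx : (f i).2 with
    | some d =>
      obtain ⟨w, k, h1, -⟩ := hsome i d hx
      simp only [h1] at hi
      cases hi
    | none =>
      have h1 := (hf i).2
      rw [hx] at h1
      obtain ⟨d, h1⟩ := h1
      have h2 := (hf (i + 1)).2
      rw [h1] at h2
      obtain ⟨w, k, h3, -⟩ := hsome (i + 2) d h2
      simp [h3]
  · cases hx : (f i).2 with
    | none => exact ⟨i, le_rfl, hnone i hx⟩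
    | some d => exact ⟨i + d + 1, by omega, hnone _ (hdown d i hx)⟩
  · cases hx : (f i).2 with
    | none =>
      have := hnone i hx
      simp only [this] at hij
      cases hij
    | some d =>
      obtain ⟨w', k, h1, h2⟩ := hsome i d hx
      simp only [h1, Option.some.injEq, Prod.mk.injEq] at hij
      omega

end Runs

section Effective
variable {α β γ σ : Type} [Primcodable α] [Primcodable β] [Primcodable γ] [Primcodable σ]

@[fun_prop] theorem primrec_map' {f : α → List β} {g : α → β → γ} (hf : Primrec f)
    (hg : Primrec fun x : α × β => g x.1 x.2) : Primrec fun a => (f a).map (g a) :=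
  Primrec.list_map hf hg

@[fun_prop] theorem primrec_flatMap' {f : α → List β} {g : α → β → List γ} (hf : Primrec f)
    (hg : Primrec fun x : α × β => g x.1 x.2) : Primrec fun a => (f a).flatMap (g a) :=
  Primrec.list_flatMap hf hg

@[fun_prop] theorem primrec_head?' {f : α → List β} (hf : Primrec f) :
    Primrec fun a => (f a).head? := Primrec.list_head?.comp hf

@[fun_prop] theorem primrec_toList' {f : α → Option β} (hf : Primrec f) :
    Primrec fun a => (f a).toList := by
  refine (Primrec.option_casesOn hf (Primrec.const []) (g := fun _ b => [b])
    (by unfold Primrec₂; fun_prop)).of_eq fun a => ?_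
  cases f a <;> rfl

@[fun_prop] theorem primrec_sum' {f : α → List ℕ} (hf : Primrec f) :
    Primrec fun a => (f a).sum :=
  (Primrec.list_foldr hf (Primrec.const 0) (h := fun _ x => x.1 + x.2)
    (by unfold Primrec₂; fun_prop)).of_eq fun a => List.sum_eq_foldr.symm

@[fun_prop] theorem primrec_count' [DecidableEq β] {f : α → List β} {g : α → β} (hf : Primrec f)
    (hg : Primrec g) : Primrec fun a => (f a).count (g a) := by
  refine (primrec_sum' (primrec_map' hf (g := fun a b => if b = g a then 1 else 0)
    (Primrec.ite (Primrec.eq.comp (by fun_prop) (by fun_prop)) (by fun_prop)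
      (by fun_prop)))).of_eq fun a => ?_
  generalize f a = l
  induction l with
  | nil => rfl
  | cons b l ih => simp only [List.map_cons, List.sum_cons, ih, List.count_cons, beq_iff_eq, add_comm]

@[fun_prop] theorem primrec_dot' [DecidableEq β] {f g : α → List β} (hf : Primrec f)
    (hg : Primrec g) : Primrec fun a => dot (f a) (g a) := by
  unfold dot
  fun_prop

@[fun_prop] theorem primrec_subs' {f : α → List β} (hf : Primrec f) :
    Primrec fun a => subs (f a) :=
  (Primrec.list_foldr hf (Primrec.const [[]]) (h := fun _ x => x.2 ++ x.2.map fun s => x.1 :: s)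
    (by unfold Primrec₂; fun_prop)).of_eq fun _ => rfl

@[fun_prop] theorem primrec_iadd' {f g : α → List β × List β} (hf : Primrec f)
    (hg : Primrec g) : Primrec fun a => iadd (f a) (g a) := by
  unfold iadd
  fun_prop

@[fun_prop] theorem primrec_spw' {f : α → ℕ} {g : α → List PE} (hf : Primrec f)
    (hg : Primrec g) : Primrec fun a => spw (f a) (g a) := by
  unfold spw
  refine primrec_flatMap' hg (Primrec.ite (PrimrecPred.and ?_ ?_) (by fun_prop) (by fun_prop))
  · exact Primrec.eq.comp (by fun_prop) (by fun_prop)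
  · exact Primrec.eq.comp (by fun_prop) (by fun_prop)

@[fun_prop] theorem primrec_plj' {f g : α → ℕ} {h : α → List PE × List PE} (hf : Primrec f)
    (hg : Primrec g) (hh : Primrec h) : Primrec fun a => plj (f a) (g a) (h a) := by
  unfold plj
  exact Primrec.ite (Primrec.eq.comp hf (by fun_prop)) (by fun_prop) (by fun_prop)

@[fun_prop] theorem primrec_mkT' {f g h k : α → ℕ} {d : α → List PE × List PE} (hf : Primrec f)
    (hg : Primrec g) (hh : Primrec h) (hk : Primrec k) (hd : Primrec d) :
    Primrec fun a => mkT (f a) (d a) (g a) (h a) (k a) := by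
  unfold mkT
  fun_prop

namespace Sig

theorem ex_mem {l : α → List β} {p : α → β → Prop} (hl : Primrec l)
    (hp : Sig fun x : α × β => p x.1 x.2) : Sig fun a => ∃ b ∈ l a, p a b :=
  ex (and (mem (by fun_prop) (by fun_prop)) hp)

theorem coe_le {f g : α → List β} (hf : Primrec f) (hg : Primrec g) :
    Sig fun a => (f a : Multiset β) ≤ g a := by
  classical
  have : Sig fun a => ∀ b ∈ f a, (f a).count b ≤ (g a).count b :=
    all_mem hf (le (by fun_prop) (by fun_prop))
  refine this.congr fun a => ?_
  rw [Multiset.le_iff_count]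
  simp only [Multiset.coe_count]
  refine ⟨fun h b _ => h b, fun h b => ?_⟩
  by_cases hb : b ∈ f a
  · exact h b hb
  · rw [List.count_eq_zero_of_not_mem hb]
    exact Nat.zero_le _

theorem coe_eq {f g : α → List β} (hf : Primrec f) (hg : Primrec g) :
    Sig fun a => (f a : Multiset β) = g a :=
  (and (coe_le hf hg) (coe_le hg hf)).congr fun _ => le_antisymm_iff

theorem isSub [DecidableEq β] {f g : α → List β × List β} (hf : Primrec f) (hg : Primrec g) :
    Sig fun a => Sub (f a) (g a) := by
  refine and (all_mem (by fun_prop) (mem (by fun_prop) (by fun_prop)))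
    (all_mem (by fun_prop) (or (mem (by fun_prop) (by fun_prop)) (le (by fun_prop) (by fun_prop))))

variable {X S E : Type} [Primcodable X] [Primcodable S] [Primcodable E] [DecidableEq E]

theorem cover {D : α → Summary X S E} {t : α → X × S × Option X} {d : α → List E × List E}
    (hD : Primrec D) (ht : Primrec t) (hd : Primrec d) : Sig fun a => Cover (D a) (t a) (d a) :=
  ex_mem hD (and (eq (by fun_prop) (by fun_prop)) (isSub (by fun_prop) (by fun_prop)))

theorem rClosed {D : α → Summary X S E} {r : α → PRule X S E}
    (hD : Primrec D) (hr : Primrec r) : Sig fun a => RClosed (D a) (r a) := by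
  refine and (cover (by fun_prop) (by fun_prop) (by fun_prop)) (and (or (ne (by fun_prop)
    (by fun_prop)) (cover (by fun_prop) (by fun_prop) (by fun_prop))) (all_mem hD
    (or (ne (by fun_prop) (by fun_prop)) (and (or ?_ ?_) (and (or ?_ ?_) (all_mem ?_
      (or ?_ (or ?_ ?_))))))))
  · exact ne (by fun_prop) (by fun_prop)
  · exact cover (by fun_prop) (by fun_prop) (by fun_prop)
  · exact ne (by fun_prop) (by fun_prop)
  · exact cover (by fun_prop) (by fun_prop) (by fun_prop)
  · fun_prop
  · exact ne (by fun_prop) (by fun_prop)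
  · exact ne (by fun_prop) (by fun_prop)
  · exact cover (by fun_prop) (by fun_prop) (by fun_prop)

theorem popClosed {D : α → Summary X S E} (hD : Primrec D) : Sig fun a => PopClosed (D a) :=
  all_mem hD (or (eq (by fun_prop) (by fun_prop))
    (cover (by fun_prop) (by fun_prop) (by fun_prop)))

theorem tClosed {D : α → Summary PX PS PE} {T : α → List (NTrans Place)} (hD : Primrec D)
    (hT : Primrec T) : Sig fun a => TClosed (D a) (T a) := by
  refine all_mem hD (or (ne (by fun_prop) (by fun_prop)) (or (ne (by fun_prop) (by fun_prop))
    (all_mem (by fun_prop) (all_mem (by fun_prop) (or ?_ (or ?_ (or ?_ (or ?_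
      (ex (and ?_ ?_))))))))))
  · exact ne (by fun_prop) (by fun_prop)
  · exact ne (by fun_prop) (by fun_prop)
  · exact ne (by fun_prop) (by fun_prop)
  · exact eq (by fun_prop) (by fun_prop)
  · exact eq (by fun_prop) (by fun_prop)
  · exact mem (by fun_prop) (by fun_prop)

variable {P : Type} [Primcodable P] [DecidableEq P]

theorem edgeOk {e : α → NEdge P} (he : Primrec e) : Sig fun a => EdgeOk (e a) := by
  refine and (eq (by fun_prop) (by fun_prop)) (and (all_mem (by fun_prop)
    (mem (by fun_prop) (by fun_prop))) (all_mem (by fun_prop) (or (mem (by fun_prop) (by fun_prop))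
      (le (by fun_prop) (by fun_prop)))))

theorem rankOk {S : α → List (NEdge P)} {yp : α → List P} {yn : α → List (NNode P)}
    (hS : Primrec S) (hp : Primrec yp) (hn : Primrec yn) :
    Sig fun a => RankOk (S a) (yp a) (yn a) := by
  refine and (all_mem hS (all_mem (by fun_prop) (notMem (by fun_prop) (by fun_prop))))
    (and (all_mem hS (le (by fun_prop) (by fun_prop))) (or (ex_mem hS (lt (by fun_prop)
      (by fun_prop))) (and (eq (by fun_prop) (by fun_prop)) (ex_mem hS (ex_mem (by fun_prop)
        (ne (by fun_prop) (by fun_prop)))))))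

theorem nCert {T : α → List (NTrans P)} {g : α → ℕ} {p : α → P} (hT : Primrec T)
    (hg : Primrec g) (hp : Primrec p) : Sig fun a => NCert (T a) (g a) (p a) := by
  refine ex (ex (and (ex_mem ?_ (and ?_ ?_)) (and (all_mem ?_ (all_mem ?_ (or ?_ (or ?_
    (ex_mem ?_ (and ?_ ?_)))))) (all_mem ?_ (or ?_ (ex (ex ?_)))))))
  · fun_prop
  · exact eq (by fun_prop) (by fun_prop)
  · exact mem (by fun_prop) (by fun_prop)
  · fun_prop
  · fun_prop
  · exact ne (by fun_prop) (by fun_prop)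
  · exact notMem (by fun_prop) (by fun_prop)
  · fun_prop
  · exact mem (by fun_prop) (by fun_prop)
  · exact edgeOk (by fun_prop)
  · fun_prop
  · exact eq (by fun_prop) (by fun_prop)
  · exact rankOk (by fun_prop) (by fun_prop) (by fun_prop)

set_option synthInstance.maxSize 1024 in
theorem cert (K : ℕ) : Sig (Cert K) := by
  refine ex (ex (and ?_ (and (popClosed (by fun_prop)) (and (tClosed (by fun_prop) (by fun_prop))
    (nCert (by fun_prop) (by fun_prop) (by fun_prop))))))
  refine congr ?_ fun _ => forall_ruleList
  refine and ?_ (all_mem ?_ (and ?_ (and ?_ (and ?_ (and ?_ ?_)))))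
  · exact all_mem (by fun_prop) (rClosed (by fun_prop) (by fun_prop))
  · fun_prop
  · exact all_mem (by fun_prop) (rClosed (by fun_prop) (by fun_prop))
  · exact all_mem (by fun_prop) (rClosed (by fun_prop) (by fun_prop))
  · exact all_mem (by fun_prop) (rClosed (by fun_prop) (by fun_prop))
  · exact all_mem (by fun_prop) (rClosed (by fun_prop) (by fun_prop))
  · exact all_mem (by fun_prop) (rClosed (by fun_prop) (by fun_prop))

end Sig

/-- A thread step on triples of a global state, a stack and the list of spawned symbols. -/
def TStep (c : Code) (s s' : ℕ × List ℕ × List ℕ) : Prop :=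
  ∃ q ∈ cCre c, ∃ w, q.1 = s.1 ∧ s.2.1 = q.2.1 :: w ∧
    s' = (q.2.2.1, q.2.2.2.1 ++ w, s.2.2 ++ q.2.2.2.2.toList)

theorem TRun.reflTransGen {c : Code} {d g g' : ℕ} {w v w' : List ℕ} (h : TRun c d g w v g' w')
    (u : List ℕ) : Relation.ReflTransGen (TStep c) (g, w, u) (g', w', u ++ v) := by
  induction h generalizing u with
  | refl => rw [List.append_nil]
  | step hr h ih =>
    refine .head ⟨_, hr, _, rfl, rfl, rfl⟩ ?_
    rw [← List.append_assoc]
    exact ih _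

theorem exists_tRun {c : Code} {s s' : ℕ × List ℕ × List ℕ}
    (h : Relation.ReflTransGen (TStep c) s s') :
    ∃ d v, s'.2.2 = s.2.2 ++ v ∧ TRun c d s.1 s.2.1 v s'.1 s'.2.1 := by
  induction h using Relation.ReflTransGen.head_induction_on with
  | refl => exact ⟨0, [], (List.append_nil _).symm, .refl _ _⟩
  | head h _ ih =>
    rename_i s s1
    obtain ⟨⟨g, a, g1, w', sp⟩, hr, w, h1, h2, rfl⟩ := h
    obtain ⟨d, v, h3, h4⟩ := ih
    refine ⟨d + 1, sp.toList ++ v, by rw [h3, List.append_assoc], ?_⟩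
    rw [← h1, h2]
    exact .step hr h4

theorem exists_tRun_succ_iff {c : Code} {g g' : ℕ} {w v w' : List ℕ} :
    (∃ d, TRun c (d + 1) g w v g' w') ↔ Relation.TransGen (TStep c) (g, w, []) (g', w', v) := by
  rw [Relation.TransGen.head'_iff]
  constructor
  · rintro ⟨d, h⟩
    cases h with
    | step hr h => exact ⟨_, ⟨_, hr, _, rfl, rfl, rfl⟩, h.reflTransGen _⟩
  · rintro ⟨_, ⟨⟨g, a, g1, w', sp⟩, hr, w, h1, h2, rfl⟩, h⟩
    obtain ⟨d, v', h3, h4⟩ := exists_tRun h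
    cases h1
    cases h2
    cases h3
    exact ⟨d, .step hr h4⟩

theorem seg_iff {c : Code} {h g1 : ℕ} {loc : Loc} {v : List ℕ} {o : Option Loc} :
    Seg c h loc v g1 o ↔ ∃ q ∈ cRes c, q.1 = h ∧ loc.1.head? = some q.2.2 ∧ ∃ g2 w2,
      Relation.TransGen (TStep c) (q.2.1, loc.1, []) (g2, w2, v) ∧ TEnd c g2 w2 loc.2 g1 o := by
  simp only [← exists_tRun_succ_iff]
  constructor
  · rintro ⟨a, w, g', d, h1, h2, g2, w2, h3, h4⟩
    exact ⟨_, h2, rfl, by rw [h1]; rfl, g2, w2, ⟨d, h3⟩, h4⟩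
  · rintro ⟨q, h1, rfl, h2, g2, w2, ⟨d, h3⟩, h4⟩
    obtain ⟨w, h2⟩ := List.head?_eq_some_iff.1 h2
    exact ⟨_, w, _, d, h2, h1, g2, w2, h3, h4⟩

/-- The multiset of the elements of a list of threads. -/
def toMS (s : ℕ × List Loc) : ℕ × Multiset Loc := (s.1, s.2)

theorem toMS_surjective : Function.Surjective toMS := fun ⟨g, p⟩ =>
  ⟨(g, p.toList), Prod.ext rfl p.coe_toList⟩

theorem reflTransGen_comp_iff {A B : Type} {f : A → B} (hf : f.Surjective) {r : B → B → Prop}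
    {a : A} {b : B} : Relation.ReflTransGen r (f a) b ↔
      ∃ a', f a' = b ∧ Relation.ReflTransGen (fun x y => r (f x) (f y)) a a' := by
  constructor
  · intro h
    induction h with
    | refl => exact ⟨a, rfl, .refl⟩
    | tail _ h ih =>
      obtain ⟨a', rfl, h'⟩ := ih
      obtain ⟨b, rfl⟩ := hf ‹_›
      exact ⟨b, rfl, h'.tail h⟩
  · rintro ⟨a', rfl, h⟩
    exact h.lift f fun _ _ h => h

theorem transGen_comp_iff {A B : Type} {f : A → B} (hf : f.Surjective) {r : B → B → Prop}
    {a : A} {b : B} : Relation.TransGen r (f a) b ↔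
      ∃ a', f a' = b ∧ Relation.TransGen (fun x y => r (f x) (f y)) a a' := by
  simp only [Relation.TransGen.head'_iff]
  constructor
  · rintro ⟨b', h1, h2⟩
    obtain ⟨b', rfl⟩ := hf b'
    obtain ⟨a', h3, h4⟩ := (reflTransGen_comp_iff hf).1 h2
    exact ⟨a', h3, b', h1, h4⟩
  · rintro ⟨a', h3, b', h1, h4⟩
    exact ⟨f b', h1, (reflTransGen_comp_iff hf).2 ⟨a', h3, h4⟩⟩

theorem mLasso_iff {K : ℕ} {c : Code} : MLasso K c ↔ ∃ s s' : ℕ × List Loc,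
    Relation.ReflTransGen (fun x y => Macro K c (toMS x) (toMS y)) (cG0 c, [([cGam0 c], 0)]) s ∧
    Relation.TransGen (fun x y => Macro K c (toMS x) (toMS y)) s s' ∧ s.1 = s'.1 ∧
    (s.2 : Multiset Loc) ≤ s'.2 := by
  constructor
  · rintro ⟨g, p, p', h1, h2, h3⟩
    obtain ⟨s, e, h4⟩ := (reflTransGen_comp_iff (a := (cG0 c, [([cGam0 c], 0)]))
      toMS_surjective).1 h1
    rw [← e] at h2
    obtain ⟨s', e', h5⟩ := (transGen_comp_iff toMS_surjective).1 h2
    obtain ⟨rfl, rfl⟩ := Prod.mk.inj e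
    obtain ⟨e1, rfl⟩ := Prod.mk.inj e'
    exact ⟨s, s', h4, h5, e1.symm, h3⟩
  · rintro ⟨⟨g, l⟩, ⟨g', l'⟩, h1, h2, rfl, h3⟩
    exact ⟨g, l, l', (reflTransGen_comp_iff (a := (cG0 c, [([cGam0 c], 0)]))
      toMS_surjective).2 ⟨_, rfl, h1⟩, (transGen_comp_iff toMS_surjective).2 ⟨_, rfl, h2⟩, h3⟩

namespace Sig

theorem tStep {c : α → Code} {s s' : α → ℕ × List ℕ × List ℕ} (hc : Primrec c) (hs : Primrec s)
    (hs' : Primrec s') : Sig fun a => TStep (c a) (s a) (s' a) := by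
  refine ex_mem (by fun_prop) (ex (and ?_ (and ?_ ?_)))
  · exact eq (by fun_prop) (by fun_prop)
  · exact eq (by fun_prop) (by fun_prop)
  · exact eq (by fun_prop) (by fun_prop)

theorem tEnd {c : α → Code} {g k g1 : α → ℕ} {w : α → List ℕ} {o : α → Option Loc}
    (hc : Primrec c) (hg : Primrec g) (hw : Primrec w) (hk : Primrec k) (hg1 : Primrec g1)
    (ho : Primrec o) : Sig fun a => TEnd (c a) (g a) (w a) (k a) (g1 a) (o a) := by
  refine or (ex (ex (ex (and ?_ (and ?_ ?_))))) (and ?_ (and ?_ ?_))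
  · exact mem (by fun_prop) (by fun_prop)
  · exact eq (by fun_prop) (by fun_prop)
  · exact eq (by fun_prop) (by fun_prop)
  · exact eq (by fun_prop) (by fun_prop)
  · exact mem (by fun_prop) (by fun_prop)
  · exact eq (by fun_prop) (by fun_prop)

theorem seg {c : α → Code} {h g1 : α → ℕ} {loc : α → Loc} {v : α → List ℕ} {o : α → Option Loc}
    (hc : Primrec c) (hh : Primrec h) (hl : Primrec loc) (hv : Primrec v) (hg1 : Primrec g1)
    (ho : Primrec o) : Sig fun a => Seg (c a) (h a) (loc a) (v a) (g1 a) (o a) := by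
  refine congr ?_ fun _ => seg_iff
  refine ex_mem ?_ (and ?_ (and ?_ (ex (ex (and (transGen ?_ ?_ ?_) ?_)))))
  · fun_prop
  · exact eq (by fun_prop) (by fun_prop)
  · exact eq (by fun_prop) (by fun_prop)
  · exact tStep (by fun_prop) (by fun_prop) (by fun_prop)
  · fun_prop
  · fun_prop
  · exact tEnd (by fun_prop) (by fun_prop) (by fun_prop) (by fun_prop) (by fun_prop) (by fun_prop)

theorem macro_toMS {K : ℕ} {c : α → Code} {s s' : α → ℕ × List Loc} (hc : Primrec c)
    (hs : Primrec s) (hs' : Primrec s') :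
    Sig fun a => Macro K (c a) (toMS (s a)) (toMS (s' a)) := by
  have : Sig fun a => ∃ (loc : Loc) (l : List Loc) (v : List ℕ) (o : Option Loc),
      ((s a).2 : Multiset Loc) = (loc :: l : List Loc) ∧ loc.2 ≤ K ∧
      Seg (c a) (s a).1 loc v (s' a).1 o ∧
      ((s' a).2 : Multiset Loc) = (l ++ v.map (fun s => ([s], 0)) ++ o.toList : List Loc) := by
    refine ex (ex (ex (ex (and ?_ (and ?_ (and ?_ ?_))))))
    · exact coe_eq (by fun_prop) (by fun_prop)
    · exact le (by fun_prop) (by fun_prop)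
    · exact seg (by fun_prop) (by fun_prop) (by fun_prop) (by fun_prop) (by fun_prop) (by fun_prop)
    · exact coe_eq (by fun_prop) (by fun_prop)
  refine this.congr fun a => exists_congr fun loc => ?_
  constructor
  · rintro ⟨p, v, o, h⟩
    induction p using Quotient.inductionOn with
    | h l => exact ⟨l, v, o, h⟩
  · rintro ⟨l, v, o, h⟩
    exact ⟨l, v, o, h⟩

theorem mLasso (K : ℕ) : Sig (MLasso K) := by
  refine congr ?_ fun _ => mLasso_iff
  refine ex (ex (and (reflTransGen ?_ ?_ ?_) (and (transGen ?_ ?_ ?_) (and ?_ ?_))))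
  · exact macro_toMS (by fun_prop) (by fun_prop) (by fun_prop)
  · fun_prop
  · fun_prop
  · exact macro_toMS (by fun_prop) (by fun_prop) (by fun_prop)
  · fun_prop
  · fun_prop
  · exact eq (by fun_prop) (by fun_prop)
  · exact coe_le (by fun_prop) (by fun_prop)

end Sig
end Effective

theorem exists_encode_eq {α : Type} [Encodable α] (s : Multiset α) :
    ∃ l : List α, (l : Multiset α) = s ∧ Encodable.encode l = Encodable.encode s := by
  obtain ⟨l, hl⟩ : ∃ l : List α, Encodable.encode l = Encodable.encode s := ⟨_, rfl⟩
  have h : (Encodable.decode (α := List α) (Encodable.encode s)).map Multiset.ofList =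
    some s := Encodable.encodek s
  rw [← hl, Encodable.encodek, Option.map_some, Option.some_inj] at h
  exact ⟨l, h, hl⟩

theorem exists_isCode (A : DCPS) : ∃ c, IsCode A c ∧ Encodable.encode c = encodeDCPS A := by
  obtain ⟨l1, -, e1⟩ := exists_encode_eq A.glob.val
  obtain ⟨l2, -, e2⟩ := exists_encode_eq A.alph.val
  obtain ⟨l3, h3, e3⟩ := exists_encode_eq A.creation.val
  obtain ⟨l4, h4, e4⟩ := exists_encode_eq A.interruption.val
  obtain ⟨l5, h5, e5⟩ := exists_encode_eq A.resumption.val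
  obtain ⟨l6, h6, e6⟩ := exists_encode_eq A.termination.val
  refine ⟨(l1, l2, l3, l4, l5, l6, A.g0, A.gamma0), ⟨?_, ?_, ?_, ?_, rfl, rfl⟩, ?_⟩
  · exact fun q => by rw [← Finset.mem_val, ← h3, Multiset.mem_coe]
  · exact fun q => by rw [← Finset.mem_val, ← h4, Multiset.mem_coe]
  · exact fun q => by rw [← Finset.mem_val, ← h5, Multiset.mem_coe]
  · exact fun q => by rw [← Finset.mem_val, ← h6, Multiset.mem_coe]
  · simp only [encodeDCPS, Encodable.encode_prod_val, e1, e2, e3, e4, e5, e6]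

theorem IsCode.length_le {A : DCPS} {c : Code} (hc : IsCode A c) (K : ℕ) :
    ∀ r ∈ ruleList K c, r.2.2.2.2.length ≤ 2 := by
  obtain ⟨h1, h2, -⟩ := hc
  rw [forall_ruleList]
  refine ⟨by simp, fun k _ => ⟨by simp, fun q hq => ?_, fun q hq => ?_, fun q hq => ?_, by simp⟩⟩
  · simpa using A.creation_wf q ((h1 q).1 hq)
  · simpa using A.creation_wf q ((h1 q).1 hq)
  · simpa using (A.interruption_wf q ((h2 q).1 hq)).2

/-- For each `K ≥ 1`, the `K`-bounded non-termination problem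
for DCPS is decidable: there is an algorithm that, given a DCPS `A`, decides
whether `A` has an infinite `K`-context switch bounded run. -/
theorem nonTermination_decidable :
    ∀ K : ℕ, 1 ≤ K →
      ∃ f : ℕ → Bool, Computable f ∧
        ∀ A : DCPS,
          (f (encodeDCPS A) = true ↔
            ∃ rho : ℕ → DConfig, IsInfRunD A rho ∧ KBoundedD K rho) := by
  intro K _
  obtain ⟨f, hf, h⟩ := Sig.exists_computable (Sig.mLasso K) (Sig.cert K) fun c => by
    by_cases hL : MLasso K c
    · exact Or.inl hL
    · exact Or.inr (cert_of_not_mLasso hL)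
  refine ⟨fun n => ((Encodable.decode (α := Code) n).map f).getD false,
    Computable.option_getD (Computable.option_map Computable.decode
      (hf.comp Computable.snd).to₂) (Computable.const false), fun A => ?_⟩
  obtain ⟨c, hc, hn⟩ := exists_isCode A
  simp only [← hn, Encodable.encodek, Option.map_some, Option.getD_some]
  refine ⟨fun hT => run_of_live hc ((h c).1 hT).live, fun ⟨rho, hr, hK⟩ => ?_⟩
  by_contra hF
  obtain ⟨g, h0, hg⟩ := live_of_run hc hr hK
  exact ((h c).2 (Bool.not_eq_true _ ▸ hF)).no_infinite_run (hc.length_le K) g h0 hg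

end CBL
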